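/- arXiv:0907.4450 — 4 statements merged into one kernel-verified Lean document; each statement's English description precedes it below -/
import Mathlib

section
/- Let (W,W') be an exchangeable pair with E(W−W'|W) = g(W) + r(W) and Δ = W − W'. Assume hypotheses (H1) and (H2). Then for every absolutely continuous function h: ℝ → ℝ with ‖h'‖ := sup_x |h'(x)| < ∞, one has |E h(W) − E h(Y)| ≤ ‖h'‖·{ ((1+c₂)/c₁)·E|1 − (c₀/2)E(Δ²|W)| + (1/2)·c₀·(1+c₂)·E|Δ|³ + c₀·c₂·E|r(W)| }. -/
open MeasureTheory Set Filter Topology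

/-- The weight `e` is a positive integrable function with `e' = -φ e` and `e 0 = 1`, for a
monotone `φ` vanishing at `0`. -/
structure LogConcaveWeight (φ e : ℝ → ℝ) : Prop where
  mono : Monotone φ
  zero : φ 0 = 0
  hasDerivAt : ∀ x, HasDerivAt e (-(φ x * e x)) x
  pos : ∀ x, 0 < e x
  one : e 0 = 1
  integrable : Integrable e

namespace LogConcaveWeight

variable {φ e : ℝ → ℝ}

lemma reflect (H : LogConcaveWeight φ e) :
    LogConcaveWeight (fun x => -φ (-x)) (fun x => e (-x)) where
  mono := fun x y hxy => neg_le_neg (H.mono (neg_le_neg hxy))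
  zero := by simp [H.zero]
  hasDerivAt := fun x =>
    ((H.hasDerivAt (-x)).comp x (hasDerivAt_neg x)).congr_deriv (by simp)
  pos := fun x => H.pos _
  one := by simp [H.one]
  integrable := H.integrable.comp_neg

lemma continuous (H : LogConcaveWeight φ e) : Continuous e :=
  continuous_iff_continuousAt.2 fun x => (H.hasDerivAt x).continuousAt

lemma nonneg (H : LogConcaveWeight φ e) {x : ℝ} (hx : 0 ≤ x) : 0 ≤ φ x :=
  H.zero ▸ H.mono hx

lemma integral_pos (H : LogConcaveWeight φ e) : 0 < ∫ t, e t := by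
  refine (integral_pos_iff_support_of_nonneg (fun x => (H.pos x).le) H.integrable).2 ?_
  have : Function.support e = univ := by
    ext x; simp [(H.pos x).ne']
  simp [this]

lemma apply_add_le (H : LogConcaveWeight φ e) {x s : ℝ} (hx : 0 ≤ x) (hs : 0 ≤ s) :
    e (s + x) ≤ e x * e s := by
  have hd : ∀ s, HasDerivAt (fun s => e (s + x) / e s)
      ((-(φ (s + x) * e (s + x)) * e s - e (s + x) * -(φ s * e s)) / e s ^ 2) s := fun s =>
    ((H.hasDerivAt (s + x)).comp_add_const s x).div (H.hasDerivAt s) (H.pos s).ne'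
  have ha : Antitone fun s => e (s + x) / e s := by
    refine antitone_of_deriv_nonpos (fun s => (hd s).differentiableAt) fun s => ?_
    rw [(hd s).deriv]
    refine div_nonpos_of_nonpos_of_nonneg ?_ (sq_nonneg _)
    have h1 : φ s ≤ φ (s + x) := H.mono (by linarith)
    have h2 := mul_pos (H.pos s) (H.pos (s + x))
    nlinarith
  have := ha hs
  simp only [zero_add, H.one, div_one] at this
  rwa [div_le_iff₀ (H.pos s)] at this

lemma intervalIntegral_le (H : LogConcaveWeight φ e) {a b : ℝ} (hab : a ≤ b) :
    ∫ t in a..b, e t ≤ ∫ t, e t := by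
  rw [intervalIntegral.integral_of_le hab]
  exact setIntegral_le_integral H.integrable (ae_of_all _ fun x => (H.pos x).le)

lemma intervalIntegral_le_tail (H : LogConcaveWeight φ e) {a b : ℝ} (hab : a ≤ b) :
    ∫ t in a..b, e t ≤ ∫ t in Ioi a, e t := by
  rw [intervalIntegral.integral_of_le hab]
  exact setIntegral_mono_set H.integrable.integrableOn (ae_of_all _ fun x => (H.pos x).le)
    Ioc_subset_Ioi_self.eventuallyLE

lemma tail_nonneg (H : LogConcaveWeight φ e) (x : ℝ) : 0 ≤ ∫ t in Ioi x, e t :=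
  integral_nonneg fun t => (H.pos t).le

lemma tendsto_tail (H : LogConcaveWeight φ e) (x : ℝ) :
    Tendsto (fun T => ∫ t in x..T, e t) atTop (𝓝 (∫ t in Ioi x, e t)) :=
  intervalIntegral_tendsto_integral_Ioi x H.integrable.integrableOn tendsto_id

lemma tail_le_mul (H : LogConcaveWeight φ e) {x : ℝ} (hx : 0 ≤ x) :
    ∫ t in Ioi x, e t ≤ (∫ t, e t) * e x := by
  refine le_of_tendsto (H.tendsto_tail x) ?_
  filter_upwards [eventually_ge_atTop x] with T hT
  have h0 : 0 ≤ T - x := by linarith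
  calc ∫ t in x..T, e t = ∫ s in (0:ℝ)..(T - x), e (s + x) := by
        rw [intervalIntegral.integral_comp_add_right]; simp
    _ ≤ ∫ s in (0:ℝ)..(T - x), e x * e s := by
        refine intervalIntegral.integral_mono_on h0
          (Continuous.intervalIntegrable (H.continuous.comp (by fun_prop)) _ _)
          ((H.continuous.const_mul _).intervalIntegrable _ _) fun s hs => ?_
        exact H.apply_add_le hx hs.1
    _ = e x * ∫ s in (0:ℝ)..(T - x), e s := by rw [intervalIntegral.integral_const_mul]
    _ ≤ (∫ t, e t) * e x := by
        rw [mul_comm]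
        exact mul_le_mul_of_nonneg_right (H.intervalIntegral_le h0) (H.pos x).le

lemma mul_tail_le (H : LogConcaveWeight φ e) (hφ : Continuous φ) (x : ℝ) :
    φ x * ∫ t in Ioi x, e t ≤ e x := by
  refine le_of_tendsto ((H.tendsto_tail x).const_mul (φ x)) ?_
  filter_upwards [eventually_ge_atTop x] with T hT
  have hc : Continuous fun t => φ t * e t := hφ.mul H.continuous
  calc φ x * ∫ t in x..T, e t = ∫ t in x..T, φ x * e t := by
        rw [intervalIntegral.integral_const_mul]
    _ ≤ ∫ t in x..T, φ t * e t := by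
        refine intervalIntegral.integral_mono_on hT
          ((H.continuous.const_mul _).intervalIntegrable _ _)
          (hc.intervalIntegrable _ _) fun s hs => ?_
        exact mul_le_mul_of_nonneg_right (H.mono hs.1) (H.pos s).le
    _ = e x - e T := by
        have := intervalIntegral.integral_eq_sub_of_hasDerivAt
          (f := e) (a := x) (b := T) (fun t _ => H.hasDerivAt t)
          (hc.neg.intervalIntegrable _ _)
        rw [intervalIntegral.integral_neg] at this
        linarith
    _ ≤ e x := by linarith [H.pos T]

lemma hasDerivAt_tail (H : LogConcaveWeight φ e) (x : ℝ) :
    HasDerivAt (fun x => ∫ t in Ioi x, e t) (-e x) x := by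
  have h1 : (fun x => ∫ t in Ioi x, e t)
      = fun x => (∫ t in Ioi 0, e t) - ∫ t in (0:ℝ)..x, e t := by
    funext y
    rw [← intervalIntegral.integral_Ioi_sub_Ioi' H.integrable.integrableOn
      H.integrable.integrableOn]
    ring
  rw [h1]
  exact (H.continuous.integral_hasStrictDerivAt 0 x).hasDerivAt.const_sub _

lemma intervalIntegral_id_mul_le (H : LogConcaveWeight φ e) {x T : ℝ} (hx : 0 ≤ x)
    (hT : x ≤ T) :
    ∫ t in x..T, t * e t ≤ (x + ∫ t, e t) * ∫ t in Ioi x, e t := by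
  set K := ∫ t, e t with hK
  set q := fun x => ∫ t in Ioi x, e t with hq
  have hqc : Continuous q :=
    continuous_iff_continuousAt.2 fun x => (H.hasDerivAt_tail x).continuousAt
  have hc : Continuous fun t => t * e t := continuous_id.mul H.continuous
  have h1 : ∫ t in x..T, (q t - t * e t) = T * q T - x * q x := by
    refine intervalIntegral.integral_eq_sub_of_hasDerivAt (f := fun t => t * q t)
      (fun t _ => ?_) ((hqc.sub hc).intervalIntegrable _ _)
    exact ((hasDerivAt_id' t).mul (H.hasDerivAt_tail t)).congr_deriv (by simp only [hq]; ring)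
  rw [intervalIntegral.integral_sub (hqc.intervalIntegrable _ _) (hc.intervalIntegrable _ _)]
    at h1
  have h2 : ∫ t in x..T, q t ≤ ∫ t in x..T, K * e t := by
    refine intervalIntegral.integral_mono_on hT (hqc.intervalIntegrable _ _)
      ((H.continuous.const_mul _).intervalIntegrable _ _) fun s hs => ?_
    exact H.tail_le_mul (hx.trans hs.1)
  rw [intervalIntegral.integral_const_mul] at h2
  have h3 := mul_le_mul_of_nonneg_left (H.intervalIntegral_le_tail hT) H.integral_pos.le
  have h4 : 0 ≤ T * q T := mul_nonneg (hx.trans hT) (H.tail_nonneg T)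
  change _ ≤ (x + K) * q x
  change K * _ ≤ K * q x at h3
  linarith

lemma integrableOn_id_mul (H : LogConcaveWeight φ e) {x : ℝ} (hx : 0 ≤ x) :
    IntegrableOn (fun t => t * e t) (Ioi x) := by
  have hc : Continuous fun t => t * e t := continuous_id.mul H.continuous
  refine integrableOn_Ioi_of_intervalIntegral_norm_bounded
    ((x + ∫ t, e t) * ∫ t in Ioi x, e t) x (b := id) (l := atTop)
    (fun T => hc.integrableOn_Ioc) tendsto_id ?_
  filter_upwards [eventually_ge_atTop x] with T hT
  refine le_trans (le_of_eq ?_) (H.intervalIntegral_id_mul_le hx hT)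
  refine intervalIntegral.integral_congr fun t ht => ?_
  rw [id, uIcc_of_le hT] at ht
  exact Real.norm_of_nonneg (mul_nonneg (hx.trans ht.1) (H.pos t).le)

lemma integral_id_mul_le (H : LogConcaveWeight φ e) {x : ℝ} (hx : 0 ≤ x) :
    ∫ t in Ioi x, t * e t ≤ (x + ∫ t, e t) * ∫ t in Ioi x, e t := by
  refine le_of_tendsto (intervalIntegral_tendsto_integral_Ioi x
    (H.integrableOn_id_mul hx) tendsto_id) ?_
  filter_upwards [eventually_ge_atTop x] with T hT
  exact H.intervalIntegral_id_mul_le hx hT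

lemma integral_reflect (e : ℝ → ℝ) : ∫ t, e (-t) = ∫ t, e t :=
  integral_neg_eq_self e volume

lemma integrable_abs_mul (H : LogConcaveWeight φ e) : Integrable fun t => |t| * e t := by
  rw [← integrableOn_univ, ← Iic_union_Ioi (a := (0:ℝ)), integrableOn_union]
  constructor
  · have h := H.reflect.integrableOn_id_mul le_rfl
    rw [← integrableOn_Ici_iff_integrableOn_Ioi] at h
    have h2 : IntegrableOn (fun t => -t * e t) (Iic 0) := by
      have h3 := (integrable_indicator_iff measurableSet_Ici).2 h
      refine (integrable_indicator_iff measurableSet_Iic).1 ?_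
      refine h3.comp_neg.congr (ae_of_all _ fun t => ?_)
      simp [indicator]
    refine h2.congr_fun (fun t ht => ?_) measurableSet_Iic
    simp only [abs_of_nonpos (mem_Iic.1 ht)]
  · refine (H.integrableOn_id_mul le_rfl).congr_fun (fun t ht => ?_) measurableSet_Ioi
    simp only [abs_of_pos (mem_Ioi.1 ht)]

lemma integral_abs_mul_le (H : LogConcaveWeight φ e) :
    ∫ t, |t| * e t ≤ (∫ t, e t) * ∫ t, e t := by
  have h1 := H.integral_id_mul_le le_rfl
  have h2 := H.reflect.integral_id_mul_le le_rfl
  rw [integral_reflect, zero_add] at h2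
  rw [zero_add] at h1
  rw [← intervalIntegral.integral_Iic_add_Ioi (b := 0) H.integrable_abs_mul.integrableOn
    H.integrable_abs_mul.integrableOn]
  have h3 : ∫ t in Ioi 0, |t| * e t = ∫ t in Ioi 0, t * e t :=
    setIntegral_congr_fun measurableSet_Ioi fun t ht => by simp only [abs_of_pos (mem_Ioi.1 ht)]
  have h4 : ∫ t in Iic 0, |t| * e t = ∫ t in Ioi 0, t * e (-t) := by
    have := integral_comp_neg_Ioi 0 fun t => |t| * e t
    rw [neg_zero] at this
    rw [← this]
    exact setIntegral_congr_fun measurableSet_Ioi fun t ht => by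
      simp only [abs_neg, abs_of_pos (mem_Ioi.1 ht)]
  have h5 : ∫ t in Ioi 0, e (-t) = ∫ t in Iic 0, e t := by
    simp
  have h6 := intervalIntegral.integral_Iic_add_Ioi (b := 0) (f := e) (μ := volume)
    H.integrable.integrableOn H.integrable.integrableOn
  rw [h5] at h2
  rw [h3, h4]
  have h7 := congrArg (fun z => (∫ t, e t) * z) h6
  simp only [mul_add] at h7
  linarith

/-- The bound `min K (1 / |φ x|)`, with `1 / 0` read as `+∞`. -/
noncomputable def tailRatioBound (φ : ℝ → ℝ) (K x : ℝ) : ℝ :=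
  if φ x = 0 then K else min K (1 / |φ x|)

lemma tailRatioBound_reflect (φ : ℝ → ℝ) (K x : ℝ) :
    tailRatioBound (fun x => -φ (-x)) K x = tailRatioBound φ K (-x) := by
  simp [tailRatioBound]

lemma tailRatioBound_le (φ : ℝ → ℝ) (K x : ℝ) : tailRatioBound φ K x ≤ K := by
  unfold tailRatioBound
  split_ifs
  · exact le_rfl
  · exact min_le_left _ _

lemma tailRatioBound_nonneg (φ : ℝ → ℝ) {K : ℝ} (hK : 0 ≤ K) (x : ℝ) :
    0 ≤ tailRatioBound φ K x := by
  unfold tailRatioBound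
  split_ifs
  · exact hK
  · exact le_min hK (by positivity)

lemma abs_mul_tailRatioBound_le (φ : ℝ → ℝ) (K x : ℝ) : |φ x| * tailRatioBound φ K x ≤ 1 := by
  unfold tailRatioBound
  split_ifs with h
  · simp [h]
  · have h0 : 0 < |φ x| := abs_pos.2 h
    calc |φ x| * min K (1 / |φ x|) ≤ |φ x| * (1 / |φ x|) := by
          gcongr; exact min_le_right _ _
      _ = 1 := by field_simp

lemma tail_le_tailRatioBound_mul (H : LogConcaveWeight φ e) (hφ : Continuous φ) {x : ℝ}
    (hx : 0 ≤ x) : ∫ t in Ioi x, e t ≤ tailRatioBound φ (∫ t, e t) x * e x := by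
  unfold tailRatioBound
  split_ifs with h
  · exact H.tail_le_mul hx
  · have h0 : 0 < |φ x| := abs_pos.2 h
    rw [min_mul_of_nonneg _ _ (H.pos x).le]
    refine le_min (H.tail_le_mul hx) ?_
    have := H.mul_tail_le hφ x
    rw [← abs_of_nonneg (H.nonneg hx)] at this
    rw [one_div, inv_mul_eq_div, le_div_iff₀ h0]
    linarith

lemma integrable_mul (H : LogConcaveWeight φ e) {η : ℝ → ℝ} (hη : Continuous η) {a b : ℝ}
    (hb : ∀ t, |η t| ≤ a * |t| + b) : Integrable fun t => η t * e t := by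
  refine Integrable.mono' ((H.integrable_abs_mul.const_mul a).add (H.integrable.const_mul b))
    (hη.mul H.continuous).aestronglyMeasurable (ae_of_all _ fun t => ?_)
  rw [norm_mul, Real.norm_eq_abs, Real.norm_of_nonneg (H.pos t).le]
  simp only [Pi.add_apply]
  nlinarith [hb t, H.pos t]

lemma abs_integral_Ioi_mul_le (H : LogConcaveWeight φ e) (hφ : Continuous φ) {η : ℝ → ℝ}
    {B : ℝ} (hη : Continuous η) (hB : 0 ≤ B) (hb : ∀ t, |η t| ≤ B * (|t| + ∫ t, e t)) {x : ℝ}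
    (hx : 0 ≤ x) :
    |∫ t in Ioi x, η t * e t|
      ≤ B * (|x| + 2 * ∫ t, e t) * (tailRatioBound φ (∫ t, e t) x * e x) := by
  have hi := (H.integrable_mul (a := B) (b := B * ∫ t, e t) hη
    (fun t => (hb t).trans_eq (mul_add _ _ _))).integrableOn (s := Ioi x)
  have hK := H.integral_pos
  have h1 : |∫ t in Ioi x, η t * e t| ≤ ∫ t in Ioi x, (B * (t * e t) + B * (∫ t, e t) * e t) := by
    refine (abs_integral_le_integral_abs).trans ?_
    refine setIntegral_mono_on hi.abs
      (((H.integrableOn_id_mul hx).const_mul _).add (H.integrable.integrableOn.const_mul _))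
      measurableSet_Ioi fun t ht => ?_
    rw [abs_mul, abs_of_pos (H.pos t)]
    have := hb t
    rw [abs_of_pos (lt_of_le_of_lt hx ht)] at this
    nlinarith [H.pos t]
  rw [integral_add ((H.integrableOn_id_mul hx).const_mul _)
    (H.integrable.integrableOn.const_mul _), integral_const_mul, integral_const_mul] at h1
  have h2 := mul_le_mul_of_nonneg_left (H.integral_id_mul_le hx) hB
  have h3 := mul_le_mul_of_nonneg_left (H.tail_le_tailRatioBound_mul hφ hx)
    (show 0 ≤ B * (|x| + 2 * ∫ t, e t) by positivity)
  refine le_trans ?_ h3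
  rw [abs_of_nonneg hx]
  linarith

lemma abs_integral_Iic_mul_le (H : LogConcaveWeight φ e) (hφ : Continuous φ) {η : ℝ → ℝ}
    {B : ℝ} (hη : Continuous η) (hB : 0 ≤ B) (hb : ∀ t, |η t| ≤ B * (|t| + ∫ t, e t))
    (h0 : ∫ t, η t * e t = 0) (x : ℝ) :
    |∫ t in Iic x, η t * e t|
      ≤ B * (|x| + 2 * ∫ t, e t) * (tailRatioBound φ (∫ t, e t) x * e x) := by
  have hi := H.integrable_mul (a := B) (b := B * ∫ t, e t) hη
    (fun t => (hb t).trans_eq (mul_add _ _ _))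
  rcases le_total 0 x with hx | hx
  · have h1 := intervalIntegral.integral_Iic_add_Ioi (b := x) hi.integrableOn hi.integrableOn
    rw [h0] at h1
    rw [eq_neg_of_add_eq_zero_left h1, abs_neg]
    exact H.abs_integral_Ioi_mul_le hφ hη hB hb hx
  · have h1 := H.reflect.abs_integral_Ioi_mul_le (η := fun t => η (-t))
      (hφ.comp continuous_neg).neg (hη.comp continuous_neg) hB
      (fun t => by simpa [integral_reflect] using hb (-t)) (neg_nonneg.2 hx)
    rw [integral_reflect, tailRatioBound_reflect, abs_neg,
      integral_comp_neg_Ioi (-x) (fun t => η t * e t), neg_neg] at h1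
    exact h1

lemma abs_le_of_abs_deriv_le_of_nonneg (H : LogConcaveWeight φ e) (hφ : Continuous φ)
    {k k' : ℝ → ℝ} {L : ℝ} (hL : 0 ≤ L) (hk : ∀ x, HasDerivAt k (k' x) x)
    (hk' : ∀ x, |k' x| ≤ L * e x) (hi : Integrable k) {x : ℝ} (hx : 0 ≤ x) :
    |k x| ≤ L * (tailRatioBound φ (∫ t, e t) x * e x) := by
  have hm : Measurable k' := by
    have : k' = deriv k := funext fun x => (hk x).deriv.symm
    rw [this]
    exact measurable_deriv k
  have hi' : Integrable k' := Integrable.mono' (H.integrable.const_mul L)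
    hm.aestronglyMeasurable (ae_of_all _ hk')
  have ht : Tendsto k atTop (𝓝 0) := tendsto_zero_of_hasDerivAt_of_integrableOn_Ioi (a := x)
    (fun t _ => hk t) hi'.integrableOn hi.integrableOn
  have h1 := integral_Ioi_of_hasDerivAt_of_tendsto' (a := x) (fun t _ => hk t)
    hi'.integrableOn ht
  have h2 : |k x| = |∫ t in Ioi x, k' t| := by rw [h1, zero_sub, abs_neg]
  rw [h2]
  calc |∫ t in Ioi x, k' t| ≤ ∫ t in Ioi x, |k' t| := abs_integral_le_integral_abs
    _ ≤ ∫ t in Ioi x, L * e t :=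
        integral_mono hi'.integrableOn.abs (H.integrable.integrableOn.const_mul L) hk'
    _ = L * ∫ t in Ioi x, e t := integral_const_mul _ _
    _ ≤ _ := mul_le_mul_of_nonneg_left (H.tail_le_tailRatioBound_mul hφ hx) hL

lemma abs_le_of_abs_deriv_le (H : LogConcaveWeight φ e) (hφ : Continuous φ)
    {k k' : ℝ → ℝ} {L : ℝ} (hL : 0 ≤ L) (hk : ∀ x, HasDerivAt k (k' x) x)
    (hk' : ∀ x, |k' x| ≤ L * e x) (hi : Integrable k) (x : ℝ) :
    |k x| ≤ L * (tailRatioBound φ (∫ t, e t) x * e x) := by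
  rcases le_total 0 x with hx | hx
  · exact H.abs_le_of_abs_deriv_le_of_nonneg hφ hL hk hk' hi hx
  · have h1 := H.reflect.abs_le_of_abs_deriv_le_of_nonneg (k := fun t => k (-t))
      (k' := fun t => -k' (-t)) (hφ.comp continuous_neg).neg hL
      (fun t => ((hk (-t)).comp t (hasDerivAt_neg t)).congr_deriv (by simp))
      (fun t => by simpa using hk' (-t)) hi.comp_neg (neg_nonneg.2 hx)
    simpa [integral_reflect, tailRatioBound_reflect] using h1

/-- The bounded solution of the Stein equation `f' - φ f = η` together with bounds on its first
two derivatives. -/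
theorem exists_stein_solution (H : LogConcaveWeight φ e) {φ' : ℝ → ℝ}
    (hφ : ∀ x, HasDerivAt φ (φ' x) x) {η η' : ℝ → ℝ} {B c : ℝ}
    (hη : ∀ x, HasDerivAt η (η' x) x) (hη' : ∀ x, |η' x| ≤ B)
    (hb : ∀ t, |η t| ≤ B * (|t| + ∫ t, e t)) (h0 : ∫ t, η t * e t = 0)
    (hc : ∀ x, tailRatioBound φ (∫ t, e t) x * (|x| + 3 * ∫ t, e t) * max 1 |φ' x| ≤ c) :
    ∃ f f₁ f₂ : ℝ → ℝ, (∀ x, HasDerivAt f (f₁ x) x) ∧ (∀ x, HasDerivAt f₁ (f₂ x) x) ∧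
      (∀ x, f₁ x = φ x * f x + η x) ∧ (∀ x, |f x| ≤ c * B) ∧
      (∀ x, |f₁ x| ≤ (1 + c) * B * ∫ t, e t) ∧ ∀ x, |f₂ x| ≤ 2 * (1 + c) * B := by
  have hB : 0 ≤ B := (abs_nonneg _).trans (hη' 0)
  have hK := H.integral_pos
  set K := ∫ t, e t with hKdef
  set M := tailRatioBound φ K with hM
  have hM0 : ∀ x, 0 ≤ M x := tailRatioBound_nonneg φ hK.le
  have hηc : Continuous η := continuous_iff_continuousAt.2 fun x => (hη x).continuousAt
  have hφc : Continuous φ := continuous_iff_continuousAt.2 fun x => (hφ x).continuousAt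
  have hi : Integrable fun t => η t * e t := H.integrable_mul (a := B) (b := B * K) hηc
    (fun t => (hb t).trans_eq (mul_add _ _ _))
  have hec : Continuous fun t => η t * e t := hηc.mul H.continuous
  set P := fun x => ∫ t in Iic x, η t * e t with hP
  have hPd : ∀ x, HasDerivAt P (η x * e x) x := fun x => by
    have h1 : P = fun y => (∫ t in Iic 0, η t * e t) + ∫ t in (0:ℝ)..y, η t * e t := by
      funext y
      rw [← intervalIntegral.integral_Iic_sub_Iic hi.integrableOn hi.integrableOn]
      simp [hP]
    rw [h1]
    exact (hec.integral_hasStrictDerivAt 0 x).hasDerivAt.const_add _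
  set f := fun x => P x / e x with hf
  set f₁ := fun x => φ x * f x + η x with hf₁
  set f₂ := fun x => φ' x * f x + φ x * f₁ x + η' x with hf₂
  have hfd : ∀ x, HasDerivAt f (f₁ x) x := fun x => by
    refine ((hPd x).div (H.hasDerivAt x) (H.pos x).ne').congr_deriv ?_
    have := (H.pos x).ne'
    simp only [hf₁, hf]
    field_simp
    ring
  have hf₁d : ∀ x, HasDerivAt f₁ (f₂ x) x := fun x =>
    ((hφ x).mul (hfd x)).add (hη x)
  have hfb : ∀ x, |f x| ≤ M x * (|x| + 2 * K) * B := fun x => by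
    rw [hf, abs_div, abs_of_pos (H.pos x), div_le_iff₀ (H.pos x)]
    refine (H.abs_integral_Iic_mul_le hφc hηc hB hb h0 x).trans_eq ?_
    ring
  have hMle : ∀ x, M x * (|x| + 2 * K) ≤ M x * (|x| + 3 * K) := fun x =>
    mul_le_mul_of_nonneg_left (by linarith) (hM0 x)
  have hMnn : ∀ x, 0 ≤ M x * (|x| + 3 * K) := fun x =>
    mul_nonneg (hM0 x) (by positivity)
  have hfc : ∀ x, |f x| ≤ c * B := fun x => by
    refine (hfb x).trans (mul_le_mul_of_nonneg_right ((hMle x).trans ?_) hB)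
    exact (le_mul_of_one_le_right (hMnn x) (le_max_left _ _)).trans (hc x)
  have hφ'f : ∀ x, |φ' x * f x| ≤ c * B := fun x => by
    rw [abs_mul]
    calc |φ' x| * |f x| ≤ max 1 |φ' x| * (M x * (|x| + 3 * K) * B) := by
          refine mul_le_mul (le_max_right _ _) ((hfb x).trans ?_) (abs_nonneg _) (by positivity)
          exact mul_le_mul_of_nonneg_right (hMle x) hB
      _ = M x * (|x| + 3 * K) * max 1 |φ' x| * B := by ring
      _ ≤ c * B := mul_le_mul_of_nonneg_right (hc x) hB
  have hc0 : 0 ≤ c := (mul_nonneg (hMnn 0) (by positivity)).trans (hc 0)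
  have hL : 0 ≤ (1 + c) * B := by positivity
  have hHb : ∀ x, |φ' x * f x + η' x| ≤ (1 + c) * B := fun x => by
    refine (abs_add_le _ _).trans ?_
    linarith [hφ'f x, hη' x]
  have hf₁b : ∀ x, |f₁ x| ≤ (1 + c) * B * M x := fun x => by
    have hi₁ : Integrable fun t => f₁ t * e t := by
      refine H.integrable_mul (a := 2 * B) (b := 3 * K * B)
        (continuous_iff_continuousAt.2 fun x => (hf₁d x).continuousAt) fun t => ?_
      have h1 : |φ t * f t| ≤ (|t| + 2 * K) * B := by
        rw [abs_mul]
        calc |φ t| * |f t| ≤ |φ t| * (M t * (|t| + 2 * K) * B) :=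
              mul_le_mul_of_nonneg_left (hfb t) (abs_nonneg _)
          _ = |φ t| * M t * ((|t| + 2 * K) * B) := by ring
          _ ≤ 1 * ((|t| + 2 * K) * B) :=
              mul_le_mul_of_nonneg_right (abs_mul_tailRatioBound_le φ K t) (by positivity)
          _ = _ := one_mul _
      refine (abs_add_le _ _).trans ?_
      linarith [hb t]
    have h1 := H.abs_le_of_abs_deriv_le hφc hL
      (k := fun t => f₁ t * e t) (k' := fun t => (φ' t * f t + η' t) * e t)
      (fun t => ((hf₁d t).mul (H.hasDerivAt t)).congr_deriv (by simp only [hf₂]; ring))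
      (fun t => by
        rw [abs_mul, abs_of_pos (H.pos t)]
        exact mul_le_mul_of_nonneg_right (hHb t) (H.pos t).le) hi₁ x
    rw [abs_mul, abs_of_pos (H.pos x), ← mul_assoc] at h1
    exact le_of_mul_le_mul_right h1 (H.pos x)
  refine ⟨f, f₁, f₂, hfd, hf₁d, fun _ => rfl, hfc, fun x => (hf₁b x).trans ?_, fun x => ?_⟩
  · exact mul_le_mul_of_nonneg_left (tailRatioBound_le φ K x) hL
  · have h1 : |φ x * f₁ x| ≤ (1 + c) * B := by
      rw [abs_mul]
      calc |φ x| * |f₁ x| ≤ |φ x| * ((1 + c) * B * M x) :=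
            mul_le_mul_of_nonneg_left (hf₁b x) (abs_nonneg _)
        _ = (1 + c) * B * (|φ x| * M x) := by ring
        _ ≤ (1 + c) * B * 1 :=
            mul_le_mul_of_nonneg_left (abs_mul_tailRatioBound_le φ K x) hL
        _ = _ := mul_one _
    have h2 : f₂ x = φ x * f₁ x + (φ' x * f x + η' x) := by simp only [hf₂]; ring
    rw [h2]
    refine (abs_add_le _ _).trans ?_
    linarith [hHb x]

end LogConcaveWeight

/-- Second-order Taylor bound for a function with bounded second derivative. -/
lemma sub_sub_mul_le_of_deriv_le {f f₁ f₂ : ℝ → ℝ} {L : ℝ} (hf : ∀ x, HasDerivAt f (f₁ x) x)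
    (hf₁ : ∀ x, HasDerivAt f₁ (f₂ x) x) (hL : ∀ x, f₂ x ≤ L) (x y : ℝ) :
    f y - f x - f₁ x * (y - x) ≤ L / 2 * (y - x) ^ 2 := by
  set ψ := fun t => L / 2 * t ^ 2 - f t with hψ
  set ψ₁ := fun t => L * t - f₁ t with hψ₁
  have hd : ∀ t, HasDerivAt ψ (ψ₁ t) t := fun t =>
    (((hasDerivAt_pow 2 t).const_mul (L / 2)).sub (hf t)).congr_deriv
      (by simp only [hψ₁]; push_cast; ring)
  have hd₁ : ∀ t, HasDerivAt ψ₁ (L - f₂ t) t := fun t =>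
    (((hasDerivAt_id' t).const_mul L).sub (hf₁ t)).congr_deriv (by ring)
  have hm : Monotone ψ₁ := monotone_of_deriv_nonneg (fun t => (hd₁ t).differentiableAt)
    fun t => by rw [(hd₁ t).deriv]; linarith [hL t]
  have hc : Continuous ψ := continuous_iff_continuousAt.2 fun t => (hd t).continuousAt
  have key : ψ₁ x * (y - x) ≤ ψ y - ψ x := by
    rcases lt_trichotomy x y with h | h | h
    · obtain ⟨z, hz, hz'⟩ := exists_hasDerivAt_eq_slope ψ ψ₁ h hc.continuousOn fun t _ => hd t
      rw [eq_div_iff (by linarith)] at hz'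
      rw [← hz']
      exact mul_le_mul_of_nonneg_right (hm hz.1.le) (by linarith)
    · simp [h]
    · obtain ⟨z, hz, hz'⟩ := exists_hasDerivAt_eq_slope ψ ψ₁ h hc.continuousOn fun t _ => hd t
      rw [eq_div_iff (by linarith)] at hz'
      have := mul_le_mul_of_nonneg_right (hm hz.2.le) (show 0 ≤ x - y by linarith)
      linarith
  simp only [hψ, hψ₁] at key
  linarith

lemma abs_sub_sub_mul_le_of_abs_deriv_le {f f₁ f₂ : ℝ → ℝ} {L : ℝ}
    (hf : ∀ x, HasDerivAt f (f₁ x) x) (hf₁ : ∀ x, HasDerivAt f₁ (f₂ x) x)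
    (hL : ∀ x, |f₂ x| ≤ L) (x y : ℝ) :
    |f y - f x - f₁ x * (y - x)| ≤ L / 2 * (y - x) ^ 2 := by
  have h1 := sub_sub_mul_le_of_deriv_le hf hf₁ (fun x => (abs_le.1 (hL x)).2) x y
  have h2 := sub_sub_mul_le_of_deriv_le (fun x => (hf x).neg) (fun x => (hf₁ x).neg)
    (L := L) (fun x => by linarith [(abs_le.1 (hL x)).1]) x y
  simp only [Pi.neg_apply] at h2
  exact abs_le.2 ⟨by linarith, h1⟩

section ExchangeablePair

variable {Ω : Type*} [MeasurableSpace Ω] {μ : Measure Ω} {W W' : Ω → ℝ}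

lemma two_mul_integral_mul_sub (hW : Measurable W) (hW' : Measurable W')
    (hexch : μ.map (fun ω => (W ω, W' ω)) = μ.map (fun ω => (W' ω, W ω)))
    (hWi : Integrable W μ) (hWi' : Integrable W' μ) {f : ℝ → ℝ} (hf : Measurable f) {C : ℝ}
    (hC : ∀ x, |f x| ≤ C) :
    2 * ∫ ω, f (W ω) * (W ω - W' ω) ∂μ = ∫ ω, (W ω - W' ω) * (f (W ω) - f (W' ω)) ∂μ := by
  have hF : Measurable fun p : ℝ × ℝ => f p.1 * (p.1 - p.2) :=
    (hf.comp measurable_fst).mul (measurable_fst.sub measurable_snd)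
  have h1 := integral_map (μ := μ) (hW.prodMk hW').aemeasurable
    (f := fun p : ℝ × ℝ => f p.1 * (p.1 - p.2)) hF.aestronglyMeasurable
  have h2 := integral_map (μ := μ) (hW'.prodMk hW).aemeasurable
    (f := fun p : ℝ × ℝ => f p.1 * (p.1 - p.2)) hF.aestronglyMeasurable
  rw [hexch, h2] at h1
  have hi : ∀ V : Ω → ℝ, Measurable V → Integrable (fun ω => f (V ω) * (W ω - W' ω)) μ :=
    fun V hV => (hWi.sub hWi').bdd_mul (c := C) (hf.comp hV).aestronglyMeasurable
      (ae_of_all _ fun ω => hC _)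
  have h3 : ∫ ω, (W ω - W' ω) * (f (W ω) - f (W' ω)) ∂μ
      = ∫ ω, f (W ω) * (W ω - W' ω) ∂μ - ∫ ω, f (W' ω) * (W ω - W' ω) ∂μ := by
    rw [← integral_sub (hi W hW) (hi W' hW')]
    exact integral_congr_ae (ae_of_all _ fun ω => by ring)
  have h4 : ∫ ω, f (W' ω) * (W' ω - W ω) ∂μ = -∫ ω, f (W' ω) * (W ω - W' ω) ∂μ := by
    rw [← integral_neg]
    exact integral_congr_ae (ae_of_all _ fun ω => by ring)
  simp only at h1
  rw [h3]
  linarith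

lemma integral_comp_mul_condExp [IsFiniteMeasure μ] (hW : Measurable W) {f : ℝ → ℝ} (hf : Measurable f) {C : ℝ}
    (hC : ∀ x, |f x| ≤ C) {X : Ω → ℝ} (hX : Integrable X μ) :
    ∫ ω, f (W ω) * (μ[X | MeasurableSpace.comap W (borel ℝ)]) ω ∂μ
      = ∫ ω, f (W ω) * X ω ∂μ := by
  have hm : MeasurableSpace.comap W (borel ℝ) ≤ ‹MeasurableSpace Ω› := hW.comap_le
  have hfW : StronglyMeasurable[MeasurableSpace.comap W (borel ℝ)] fun ω => f (W ω) :=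
    (hf.comp (comap_measurable W)).stronglyMeasurable
  have h1 := condExp_stronglyMeasurable_mul_of_bound hm hfW hX C (ae_of_all _ fun ω => hC _)
  rw [← integral_condExp hm (f := fun ω => f (W ω) * X ω)]
  exact integral_congr_ae h1.symm

/-- The bound of Stein's method of exchangeable pairs in terms of a solution `f` of the Stein
equation `f' - c₀ g f = η`. -/
lemma abs_integral_stein_le [IsFiniteMeasure μ] (hW : Measurable W) (hW' : Measurable W')
    (hexch : μ.map (fun ω => (W ω, W' ω)) = μ.map (fun ω => (W' ω, W ω)))
    (hWi : Integrable W μ) (hWi' : Integrable W' μ) {g r : ℝ → ℝ}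
    (hcond : μ[fun ω => W ω - W' ω | MeasurableSpace.comap W (borel ℝ)]
      =ᵐ[μ] fun ω => g (W ω) + r (W ω))
    (hΔ3 : Integrable (fun ω => |W ω - W' ω| ^ 3) μ)
    (hr : Integrable (fun ω => r (W ω)) μ)
    {c₀ : ℝ} (hc₀ : 0 ≤ c₀) {η f f₁ f₂ : ℝ → ℝ} {F₀ F₁ F₂ : ℝ}
    (hf : ∀ x, HasDerivAt f (f₁ x) x) (hf₁ : ∀ x, HasDerivAt f₁ (f₂ x) x)
    (hstein : ∀ x, f₁ x = c₀ * g x * f x + η x)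
    (hF₀ : ∀ x, |f x| ≤ F₀) (hF₁ : ∀ x, |f₁ x| ≤ F₁) (hF₂ : ∀ x, |f₂ x| ≤ F₂) :
    |∫ ω, η (W ω) ∂μ|
      ≤ F₁ * ∫ ω, |1 - c₀ / 2 * (μ[fun ω' => (W ω' - W' ω') ^ 2
          | MeasurableSpace.comap W (borel ℝ)]) ω| ∂μ
        + c₀ * F₂ / 4 * ∫ ω, |W ω - W' ω| ^ 3 ∂μ
        + c₀ * F₀ * ∫ ω, |r (W ω)| ∂μ := by
  set D := μ[fun ω' => (W ω' - W' ω') ^ 2 | MeasurableSpace.comap W (borel ℝ)] with hD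
  have hfm : Measurable f :=
    (continuous_iff_continuousAt.2 fun x => (hf x).continuousAt).measurable
  have hf₁m : Measurable f₁ :=
    (continuous_iff_continuousAt.2 fun x => (hf₁ x).continuousAt).measurable
  have hΔ : Integrable (fun ω => W ω - W' ω) μ := hWi.sub hWi'
  have hΔm : Measurable fun ω => W ω - W' ω := hW.sub hW'
  have hΔ2 : Integrable (fun ω => (W ω - W' ω) ^ 2) μ := by
    refine Integrable.mono' ((integrable_const (1:ℝ)).add hΔ3)
      (hΔm.pow_const 2).aestronglyMeasurable (ae_of_all _ fun ω => ?_)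
    rw [Real.norm_eq_abs, abs_pow]
    simp only [Pi.add_apply]
    have h0 := abs_nonneg (W ω - W' ω)
    rcases le_total |W ω - W' ω| 1 with h | h
    · have : |W ω - W' ω| ^ 2 ≤ 1 := pow_le_one₀ h0 h
      have := pow_nonneg h0 3
      linarith
    · have : |W ω - W' ω| ^ 2 ≤ |W ω - W' ω| ^ 3 := pow_le_pow_right₀ h (by norm_num)
      linarith
  have hgi : Integrable (fun ω => g (W ω)) μ :=
    ((integrable_condExp.congr hcond).sub hr).congr (ae_of_all _ fun ω => by simp)
  have hfb : ∀ {X : Ω → ℝ}, Integrable X μ → Integrable (fun ω => f (W ω) * X ω) μ := fun hX =>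
    hX.bdd_mul (c := F₀) (hfm.comp hW).aestronglyMeasurable (ae_of_all _ fun ω => hF₀ _)
  have hf₁b : ∀ {X : Ω → ℝ}, Integrable X μ → Integrable (fun ω => f₁ (W ω) * X ω) μ := fun hX =>
    hX.bdd_mul (c := F₁) (hf₁m.comp hW).aestronglyMeasurable (ae_of_all _ fun ω => hF₁ _)
  have hDi : Integrable D μ := integrable_condExp
  have hI₁ : ∫ ω, f (W ω) * (W ω - W' ω) ∂μ
      = ∫ ω, f (W ω) * g (W ω) ∂μ + ∫ ω, f (W ω) * r (W ω) ∂μ := by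
    rw [← integral_comp_mul_condExp hW hfm hF₀ hΔ, ← integral_add (hfb hgi) (hfb hr)]
    refine integral_congr_ae ?_
    filter_upwards [hcond] with ω hω
    rw [hω]; ring
  have hI₂ := integral_comp_mul_condExp hW hf₁m hF₁ hΔ2
  rw [← hD] at hI₂
  have hI₃ := two_mul_integral_mul_sub hW hW' hexch hWi hWi' hfm hF₀
  set R := fun ω => (W ω - W' ω) * (f (W' ω) - f (W ω) - f₁ (W ω) * (W' ω - W ω)) with hR
  have hRb : ∀ ω, |R ω| ≤ F₂ / 2 * |W ω - W' ω| ^ 3 := fun ω => by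
    rw [hR, abs_mul]
    calc _ ≤ |W ω - W' ω| * (F₂ / 2 * (W' ω - W ω) ^ 2) :=
          mul_le_mul_of_nonneg_left (abs_sub_sub_mul_le_of_abs_deriv_le hf hf₁ hF₂ _ _)
            (abs_nonneg _)
      _ = _ := by rw [← sq_abs (W' ω - W ω), abs_sub_comm (W' ω)]; ring
  have hRi : Integrable R μ := by
    refine Integrable.mono' (hΔ3.const_mul (F₂ / 2)) (Measurable.aestronglyMeasurable ?_)
      (ae_of_all _ hRb)
    exact hΔm.mul (((hfm.comp hW').sub (hfm.comp hW)).sub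
      ((hf₁m.comp hW).mul (hW'.sub hW)))
  have hI₄ : ∫ ω, (W ω - W' ω) * (f (W ω) - f (W' ω)) ∂μ
      = ∫ ω, f₁ (W ω) * (W ω - W' ω) ^ 2 ∂μ - ∫ ω, R ω ∂μ := by
    rw [← integral_sub (hf₁b hΔ2) hRi]
    exact integral_congr_ae (ae_of_all _ fun ω => by simp only [hR]; ring)
  have hone : Integrable (fun ω => f₁ (W ω)) μ := by
    simpa using hf₁b (integrable_const (1:ℝ))
  have hI₅ : ∫ ω, η (W ω) ∂μ = ∫ ω, f₁ (W ω) ∂μ - c₀ * ∫ ω, f (W ω) * g (W ω) ∂μ := by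
    rw [← integral_const_mul, ← integral_sub hone ((hfb hgi).const_mul c₀)]
    exact integral_congr_ae (ae_of_all _ fun ω => by simp only [hstein]; ring)
  have hTi : Integrable (fun ω => 1 - c₀ / 2 * D ω) μ :=
    (integrable_const 1).sub (hDi.const_mul _)
  have hI₆ : ∫ ω, f₁ (W ω) * (1 - c₀ / 2 * D ω) ∂μ
      = ∫ ω, f₁ (W ω) ∂μ - c₀ / 2 * ∫ ω, f₁ (W ω) * D ω ∂μ := by
    rw [← integral_const_mul, ← integral_sub hone ((hf₁b hDi).const_mul _)]
    exact integral_congr_ae (ae_of_all _ fun ω => by ring)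
  have hsum : ∫ ω, η (W ω) ∂μ = ∫ ω, f₁ (W ω) * (1 - c₀ / 2 * D ω) ∂μ
      + c₀ / 2 * ∫ ω, R ω ∂μ + c₀ * ∫ ω, f (W ω) * r (W ω) ∂μ := by
    rw [hI₅, hI₆, hI₂]
    linear_combination c₀ * hI₁ - c₀ / 2 * hI₃ - c₀ / 2 * hI₄
  have hb₁ : |∫ ω, f₁ (W ω) * (1 - c₀ / 2 * D ω) ∂μ| ≤ F₁ * ∫ ω, |1 - c₀ / 2 * D ω| ∂μ := by
    rw [← integral_const_mul]
    refine abs_integral_le_integral_abs.trans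
      (integral_mono (hf₁b hTi).abs (hTi.abs.const_mul _) fun ω => ?_)
    simp only [abs_mul]
    exact mul_le_mul_of_nonneg_right (hF₁ _) (abs_nonneg _)
  have hb₂ : |∫ ω, R ω ∂μ| ≤ F₂ / 2 * ∫ ω, |W ω - W' ω| ^ 3 ∂μ := by
    rw [← integral_const_mul]
    exact abs_integral_le_integral_abs.trans (integral_mono hRi.abs (hΔ3.const_mul _) hRb)
  have hb₃ : |∫ ω, f (W ω) * r (W ω) ∂μ| ≤ F₀ * ∫ ω, |r (W ω)| ∂μ := by
    rw [← integral_const_mul]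
    refine abs_integral_le_integral_abs.trans
      (integral_mono (hfb hr).abs (hr.abs.const_mul _) fun ω => ?_)
    simp only [abs_mul]
    exact mul_le_mul_of_nonneg_right (hF₀ _) (abs_nonneg _)
  rw [hsum]
  refine (abs_add_three _ _ _).trans ?_
  rw [abs_mul (c₀ / 2), abs_mul c₀, abs_of_nonneg hc₀, abs_of_nonneg (by positivity : 0 ≤ c₀ / 2)]
  have h2 := mul_le_mul_of_nonneg_left hb₂ (by positivity : 0 ≤ c₀ / 2)
  have h3 := mul_le_mul_of_nonneg_left hb₃ hc₀
  linarith

lemma continuous_of_abs_sub_le {h : ℝ → ℝ} {B : ℝ} (hh : ∀ x y, |h y - h x| ≤ B * |y - x|) :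
    Continuous h := by
  have hB : 0 ≤ B := by simpa using (abs_nonneg _).trans (hh 0 1)
  refine (LipschitzWith.of_dist_le_mul (K := ⟨B, hB⟩) fun x y => ?_).continuous
  exact hh y x

lemma abs_le_of_abs_sub_le {h : ℝ → ℝ} {B : ℝ} (hh : ∀ x y, |h y - h x| ≤ B * |y - x|) (t : ℝ) :
    |h t| ≤ B * |t| + |h 0| := by
  have h1 := hh 0 t
  rw [sub_zero] at h1
  linarith [abs_sub_abs_le_abs_sub (h t) (h 0)]

lemma abs_sub_le_of_abs_deriv_le {h h' : ℝ → ℝ} {B : ℝ} (hh : ∀ x, HasDerivAt h (h' x) x)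
    (hB : ∀ x, |h' x| ≤ B) (x y : ℝ) : |h y - h x| ≤ B * |y - x| :=
  convex_univ.norm_image_sub_le_of_norm_hasDerivWithin_le
    (fun t _ => (hh t).hasDerivWithinAt) (fun t _ => hB t) (mem_univ x) (mem_univ y)

lemma integrable_comp_of_abs_sub_le [IsFiniteMeasure μ] (hWi : Integrable W μ) {h : ℝ → ℝ}
    {B : ℝ} (hh : ∀ x y, |h y - h x| ≤ B * |y - x|) : Integrable (fun ω => h (W ω)) μ := by
  refine Integrable.mono' ((hWi.abs.const_mul B).add (integrable_const |h 0|))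
    ((continuous_of_abs_sub_le hh).comp_aestronglyMeasurable hWi.aestronglyMeasurable)
    (ae_of_all _ fun ω => abs_le_of_abs_sub_le hh _)

/-- A Lipschitz function on the line is uniformly approximated by differentiable functions whose
derivative obeys the same bound. -/
lemma exists_hasDerivAt_abs_sub_le {h : ℝ → ℝ} {B : ℝ} (hh : ∀ x y, |h y - h x| ≤ B * |y - x|)
    {ε : ℝ} (hε : 0 < ε) :
    ∃ k k' : ℝ → ℝ, (∀ x, HasDerivAt k (k' x) x) ∧ (∀ x, |k' x| ≤ B) ∧
      ∀ x, |k x - h x| ≤ B * ε := by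
  have hB : 0 ≤ B := by simpa using (abs_nonneg _).trans (hh 0 1)
  have hc := continuous_of_abs_sub_le hh
  refine ⟨fun x => ε⁻¹ * ((∫ t in (0:ℝ)..(x + ε), h t) - ∫ t in (0:ℝ)..x, h t),
    fun x => ε⁻¹ * (h (x + ε) - h x), fun x => ?_, fun x => ?_, fun x => ?_⟩
  · exact (((hc.integral_hasStrictDerivAt 0 (x + ε)).hasDerivAt.comp_add_const x ε).sub
      (hc.integral_hasStrictDerivAt 0 x).hasDerivAt).const_mul _
  · have := hh x (x + ε)
    rw [add_sub_cancel_left, abs_of_pos hε] at this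
    rw [abs_mul, abs_of_pos (inv_pos.2 hε), inv_mul_le_iff₀ hε]
    linarith
  · have h1 : (∫ t in (0:ℝ)..(x + ε), h t) - ∫ t in (0:ℝ)..x, h t
        = (∫ t in x..(x + ε), (h t - h x)) + ε * h x := by
      rw [intervalIntegral.integral_interval_sub_left (hc.intervalIntegrable _ _)
        (hc.intervalIntegrable _ _), intervalIntegral.integral_sub (hc.intervalIntegrable _ _)
        intervalIntegrable_const]
      simp
    have h2 : |∫ t in x..(x + ε), (h t - h x)| ≤ B * ε * |x + ε - x| := by
      refine intervalIntegral.norm_integral_le_of_norm_le_const (f := fun t => h t - h x)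
        fun t ht => ?_
      rw [uIoc_of_le (by linarith)] at ht
      refine (hh x t).trans (mul_le_mul_of_nonneg_left ?_ hB)
      rw [abs_of_pos (by linarith [ht.1])]
      linarith [ht.2]
    rw [add_sub_cancel_left, abs_of_pos hε] at h2
    simp only
    rw [h1, mul_add, inv_mul_cancel_left₀ hε.ne', add_sub_cancel_right, abs_mul,
      abs_of_pos (inv_pos.2 hε), inv_mul_le_iff₀ hε]
    linarith

lemma LogConcaveWeight.abs_sub_integral_le {φ e : ℝ → ℝ} (H : LogConcaveWeight φ e) {h : ℝ → ℝ}
    {B : ℝ} (hh : ∀ x y, |h y - h x| ≤ B * |y - x|) (t : ℝ) :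
    |h t - (∫ s, e s)⁻¹ * ∫ s, h s * e s| ≤ B * (|t| + ∫ s, e s) := by
  have hB : 0 ≤ B := by simpa using (abs_nonneg _).trans (hh 0 1)
  have hK := H.integral_pos
  have hi := H.integrable_mul (continuous_of_abs_sub_le hh) (abs_le_of_abs_sub_le hh)
  have h1 : h t - (∫ s, e s)⁻¹ * ∫ s, h s * e s
      = (∫ s, e s)⁻¹ * ∫ s, (h t - h s) * e s := by
    have : ∫ s, (h t - h s) * e s = h t * (∫ s, e s) - ∫ s, h s * e s := by
      rw [← integral_const_mul, ← integral_sub (H.integrable.const_mul _) hi]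
      exact integral_congr_ae (ae_of_all _ fun s => by ring)
    rw [this]
    field_simp
  have hi' : Integrable fun s => (h t - h s) * e s :=
    ((H.integrable.const_mul (h t)).sub hi).congr
      (ae_of_all _ fun s => by simp only [Pi.sub_apply]; ring)
  have h2 : |∫ s, (h t - h s) * e s| ≤ ∫ s, (B * |t| * e s + B * (|s| * e s)) := by
    refine abs_integral_le_integral_abs.trans (integral_mono hi'.abs
      ((H.integrable.const_mul _).add (H.integrable_abs_mul.const_mul _)) fun s => ?_)
    simp only [abs_mul, abs_of_pos (H.pos s)]
    have h3 : |h t - h s| ≤ B * (|t| + |s|) :=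
      (hh s t).trans (mul_le_mul_of_nonneg_left (abs_sub t s) hB)
    nlinarith [H.pos s]
  rw [integral_add (H.integrable.const_mul _) (H.integrable_abs_mul.const_mul _),
    integral_const_mul, integral_const_mul] at h2
  have h4 := mul_le_mul_of_nonneg_left H.integral_abs_mul_le hB
  rw [h1, abs_mul, abs_of_pos (inv_pos.2 hK), inv_mul_le_iff₀ hK]
  linarith

section

variable [IsProbabilityMeasure μ] {g g' r e h : ℝ → ℝ} {c₀ c B : ℝ}

lemma abs_integral_comp_sub_le_of_hasDerivAt {h' : ℝ → ℝ} (hW : Measurable W)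
    (hW' : Measurable W')
    (hexch : μ.map (fun ω => (W ω, W' ω)) = μ.map (fun ω => (W' ω, W ω)))
    (hWi : Integrable W μ) (hWi' : Integrable W' μ) (hg : ∀ x, HasDerivAt g (g' x) x)
    (hcond : μ[fun ω => W ω - W' ω | MeasurableSpace.comap W (borel ℝ)]
      =ᵐ[μ] fun ω => g (W ω) + r (W ω))
    (hΔ3 : Integrable (fun ω => |W ω - W' ω| ^ 3) μ)
    (hr : Integrable (fun ω => r (W ω)) μ) (hc₀ : 0 ≤ c₀)
    (H : LogConcaveWeight (fun x => c₀ * g x) e)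
    (hc : ∀ x, LogConcaveWeight.tailRatioBound (fun x => c₀ * g x) (∫ t, e t) x
      * (|x| + 3 * ∫ t, e t) * max 1 |c₀ * g' x| ≤ c)
    (hh : ∀ x, HasDerivAt h (h' x) x) (hB : ∀ x, |h' x| ≤ B) :
    |(∫ ω, h (W ω) ∂μ) - (∫ t, e t)⁻¹ * ∫ t, h t * e t|
      ≤ B * ((1 + c) * (∫ t, e t)
            * ∫ ω, |1 - c₀ / 2 * (μ[fun ω' => (W ω' - W' ω') ^ 2
                | MeasurableSpace.comap W (borel ℝ)]) ω| ∂μ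
          + 1 / 2 * c₀ * (1 + c) * ∫ ω, |W ω - W' ω| ^ 3 ∂μ
          + c₀ * c * ∫ ω, |r (W ω)| ∂μ) := by
  have hlip := abs_sub_le_of_abs_deriv_le hh hB
  have hK := H.integral_pos
  set m := (∫ t, e t)⁻¹ * ∫ t, h t * e t with hm
  have h0 : ∫ t, (h t - m) * e t = 0 := by
    simp only [sub_mul]
    rw [integral_sub
      (H.integrable_mul (continuous_of_abs_sub_le hlip) (abs_le_of_abs_sub_le hlip))
      (H.integrable.const_mul _), integral_const_mul, hm]
    field_simp
    ring
  obtain ⟨f, f₁, f₂, hf, hf₁, hstein, hF₀, hF₁, hF₂⟩ := H.exists_stein_solution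
    (fun x => (hg x).const_mul c₀) (fun x => (hh x).sub_const m) hB
    (H.abs_sub_integral_le hlip) h0 hc
  have key := abs_integral_stein_le hW hW' hexch hWi hWi' hcond hΔ3 hr hc₀ hf hf₁ hstein
    hF₀ hF₁ hF₂
  have h1 : ∫ ω, (h (W ω) - m) ∂μ = (∫ ω, h (W ω) ∂μ) - m := by
    rw [integral_sub (integrable_comp_of_abs_sub_le hWi hlip) (integrable_const _)]
    simp
  rw [h1] at key
  refine key.trans_eq ?_
  ring

lemma abs_integral_comp_sub_le_of_abs_sub_le (hW : Measurable W)
    (hW' : Measurable W')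
    (hexch : μ.map (fun ω => (W ω, W' ω)) = μ.map (fun ω => (W' ω, W ω)))
    (hWi : Integrable W μ) (hWi' : Integrable W' μ) (hg : ∀ x, HasDerivAt g (g' x) x)
    (hcond : μ[fun ω => W ω - W' ω | MeasurableSpace.comap W (borel ℝ)]
      =ᵐ[μ] fun ω => g (W ω) + r (W ω))
    (hΔ3 : Integrable (fun ω => |W ω - W' ω| ^ 3) μ)
    (hr : Integrable (fun ω => r (W ω)) μ) (hc₀ : 0 ≤ c₀)
    (H : LogConcaveWeight (fun x => c₀ * g x) e)
    (hc : ∀ x, LogConcaveWeight.tailRatioBound (fun x => c₀ * g x) (∫ t, e t) x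
      * (|x| + 3 * ∫ t, e t) * max 1 |c₀ * g' x| ≤ c)
    (hh : ∀ x y, |h y - h x| ≤ B * |y - x|) :
    |(∫ ω, h (W ω) ∂μ) - (∫ t, e t)⁻¹ * ∫ t, h t * e t|
      ≤ B * ((1 + c) * (∫ t, e t)
            * ∫ ω, |1 - c₀ / 2 * (μ[fun ω' => (W ω' - W' ω') ^ 2
                | MeasurableSpace.comap W (borel ℝ)]) ω| ∂μ
          + 1 / 2 * c₀ * (1 + c) * ∫ ω, |W ω - W' ω| ^ 3 ∂μ
          + c₀ * c * ∫ ω, |r (W ω)| ∂μ) := by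
  have hB : 0 ≤ B := by simpa using (abs_nonneg _).trans (hh 0 1)
  have hK := H.integral_pos
  refine le_of_forall_pos_le_add fun δ hδ => ?_
  set ε := δ / (2 * B + 1) with hε
  have hε0 : 0 < ε := by positivity
  have hεδ : 2 * (B * ε) ≤ δ := by
    have : ε * (2 * B + 1) = δ := div_mul_cancel₀ _ (by positivity)
    linarith
  obtain ⟨k, k', hk, hk', hkh⟩ := exists_hasDerivAt_abs_sub_le hh hε0
  have hlip := abs_sub_le_of_abs_deriv_le hk hk'
  have key := abs_integral_comp_sub_le_of_hasDerivAt hW hW' hexch hWi hWi' hg hcond hΔ3 hr hc₀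
    H hc hk hk'
  have h1 : |(∫ ω, k (W ω) ∂μ) - ∫ ω, h (W ω) ∂μ| ≤ B * ε := by
    have hki := integrable_comp_of_abs_sub_le hWi hlip
    have hhi := integrable_comp_of_abs_sub_le hWi hh
    rw [← integral_sub hki hhi]
    refine abs_integral_le_integral_abs.trans ((integral_mono (hki.sub hhi).abs
      (integrable_const (B * ε)) fun ω => hkh (W ω)).trans_eq ?_)
    simp
  have h2 : |(∫ t, e t)⁻¹ * (∫ t, k t * e t) - (∫ t, e t)⁻¹ * ∫ t, h t * e t| ≤ B * ε := by
    have hki := H.integrable_mul (continuous_of_abs_sub_le hlip) (abs_le_of_abs_sub_le hlip)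
    have hhi := H.integrable_mul (continuous_of_abs_sub_le hh) (abs_le_of_abs_sub_le hh)
    rw [← mul_sub, abs_mul, abs_of_pos (inv_pos.2 hK), inv_mul_le_iff₀ hK,
      ← integral_sub hki hhi, mul_comm, ← integral_const_mul]
    refine abs_integral_le_integral_abs.trans (integral_mono (hki.sub hhi).abs
      (H.integrable.const_mul _) fun t => ?_)
    simp only [← sub_mul, abs_mul, abs_of_pos (H.pos t)]
    exact mul_le_mul_of_nonneg_right (hkh t) (H.pos t).le
  rw [abs_le] at *
  constructor <;> linarith [h1.1, h1.2, h2.1, h2.2, key.1, key.2]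

end

end ExchangeablePair

lemma logConcaveWeight_exp {g : ℝ → ℝ} (hg : Continuous g) (hmono : Monotone g) (h0 : g 0 = 0)
    {c₀ : ℝ} (hc₀ : 0 ≤ c₀)
    (hi : Integrable (fun t => Real.exp (-(c₀ * ∫ s in (0:ℝ)..t, g s)))) :
    LogConcaveWeight (fun x => c₀ * g x)
      (fun t => Real.exp (-(c₀ * ∫ s in (0:ℝ)..t, g s))) where
  mono := hmono.const_mul hc₀
  zero := by simp [h0]
  hasDerivAt := fun x =>
    ((hg.integral_hasStrictDerivAt 0 x).hasDerivAt.const_mul c₀).neg.exp.congr_deriv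
      (by simp only [Pi.neg_apply]; ring)
  pos := fun x => Real.exp_pos _
  one := by simp
  integrable := hi

/-- **Theorem 1.1(i)** (Chatterjee–Shao). Non-normal approximation by Stein's method of
exchangeable pairs: bound for smooth test functions under hypotheses (H1) and (H2). -/
theorem exchangeable_pair_nonnormal_approx_H2
    {Ω : Type*} [MeasurableSpace Ω] {μ : Measure Ω} [IsProbabilityMeasure μ]
    (W W' Y : Ω → ℝ) (hWmeas : Measurable W) (hW'meas : Measurable W')
    (hYmeas : Measurable Y)
    (hWint : Integrable W μ) (hW'int : Integrable W' μ)
    -- (W, W') is an exchangeable pair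
    (hexch : μ.map (fun ω => (W ω, W' ω)) = μ.map (fun ω => (W' ω, W ω)))
    -- E(W - W' | W) = g(W) + r(W), with g differentiable with derivative g'
    (g g' r : ℝ → ℝ) (hg' : ∀ x, HasDerivAt g (g' x) x)
    (hcond : μ[fun ω => W ω - W' ω | MeasurableSpace.comap W (borel ℝ)]
      =ᵐ[μ] fun ω => g (W ω) + r (W ω))
    -- the constants c₀ and c₁ and the density p(t) = c₁ exp(-c₀ G(t)), G(t) = ∫₀ᵗ g
    (c₀ c₁ c₂ : ℝ) (hc₀ : 0 < c₀) (hc₁pos : 0 < c₁)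
    (hpInt : Integrable (fun t => Real.exp (-(c₀ * ∫ s in (0:ℝ)..t, g s))))
    (hc₁ : c₁ = (∫ t : ℝ, Real.exp (-(c₀ * ∫ s in (0:ℝ)..t, g s)))⁻¹)
    -- Y has probability density p
    (hYdens : μ.map Y
      = volume.withDensity
          (fun t => ENNReal.ofReal (c₁ * Real.exp (-(c₀ * ∫ s in (0:ℝ)..t, g s)))))
    -- Hypothesis (H1)
    (hmono : Monotone g) (hgpos : ∀ t, 0 < t → 0 ≤ g t) (hgneg : ∀ t, t ≤ 0 → g t ≤ 0)
    -- Hypothesis (H2), with 1/|c₀ g(x)| read as +∞ when g(x) = 0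
    (hH2 : ∀ x, (if g x = 0 then 1 / c₁ else min (1 / c₁) (1 / |c₀ * g x|))
        * (|x| + 3 / c₁) * max 1 (c₀ * |g' x|) ≤ c₂)
    -- moment assumptions: E|Δ|³ < ∞ and E|r(W)| < ∞
    (hΔ3 : Integrable (fun ω => |W ω - W' ω| ^ 3) μ)
    (hrInt : Integrable (fun ω => r (W ω)) μ)
    -- h absolutely continuous with ‖h'‖ = sup |h'| ≤ B < ∞
    (h h' : ℝ → ℝ) (B : ℝ)
    (hhAC : ∀ x y : ℝ, h y - h x = ∫ t in x..y, h' t)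
    (hh'B : ∀ x, |h' x| ≤ B) :
    |(∫ ω, h (W ω) ∂μ) - ∫ ω, h (Y ω) ∂μ|
      ≤ B * ((1 + c₂) / c₁
            * ∫ ω, |1 - c₀ / 2
                * (μ[fun ω' => (W ω' - W' ω') ^ 2
                    | MeasurableSpace.comap W (borel ℝ)]) ω| ∂μ
          + 1 / 2 * c₀ * (1 + c₂) * ∫ ω, |W ω - W' ω| ^ 3 ∂μ
          + c₀ * c₂ * ∫ ω, |r (W ω)| ∂μ) := by
  have hgc : Continuous g := continuous_iff_continuousAt.2 fun x => (hg' x).continuousAt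
  have hg0 : g 0 = 0 := by
    refine le_antisymm (hgneg 0 le_rfl) ?_
    refine ge_of_tendsto (hgc.continuousWithinAt (s := Ioi 0) (x := 0)) ?_
    filter_upwards [self_mem_nhdsWithin] with t ht using hgpos t ht
  have hlip : ∀ x y, |h y - h x| ≤ B * |y - x| := fun x y => by
    rw [hhAC]
    exact intervalIntegral.norm_integral_le_of_norm_le_const (f := h') fun t _ => hh'B t
  have H := logConcaveWeight_exp hgc hmono hg0 hc₀.le hpInt
  set e := fun t => Real.exp (-(c₀ * ∫ s in (0:ℝ)..t, g s)) with he
  have hK : ∫ t, e t = 1 / c₁ := by rw [hc₁, one_div, inv_inv]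
  have hY : ∫ ω, h (Y ω) ∂μ = (∫ t, e t)⁻¹ * ∫ t, h t * e t := by
    rw [← integral_map hYmeas.aemeasurable (continuous_of_abs_sub_le hlip).aestronglyMeasurable, hYdens,
      integral_withDensity_eq_integral_toReal_smul
        (H.continuous.measurable.const_mul c₁).ennreal_ofReal
        (ae_of_all _ fun t => ENNReal.ofReal_lt_top), hK, one_div, inv_inv,
      ← integral_const_mul]
    refine integral_congr_ae (ae_of_all _ fun t => ?_)
    simp only [smul_eq_mul]
    rw [ENNReal.toReal_ofReal (mul_pos hc₁pos (H.pos t)).le]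
    ring
  have hc : ∀ x, LogConcaveWeight.tailRatioBound (fun x => c₀ * g x) (∫ t, e t) x
      * (|x| + 3 * ∫ t, e t) * max 1 |c₀ * g' x| ≤ c₂ := fun x => by
    have := hH2 x
    simp only [LogConcaveWeight.tailRatioBound, hK, mul_eq_zero, hc₀.ne', false_or, abs_mul,
      abs_of_pos hc₀, mul_one_div] at this ⊢
    exact this
  have key := abs_integral_comp_sub_le_of_abs_sub_le hWmeas hW'meas hexch hWint hW'int hg' hcond
    hΔ3 hrInt hc₀.le H hc hlip
  rw [← hY, hK, mul_one_div] at key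
  exact key
end

section
/- Let (W,W') be an exchangeable pair with E(W−W'|W) = g(W) + r(W) and Δ = W − W'. Assume hypotheses (H1) and (H3). Then for every absolutely continuous function h: ℝ → ℝ with ‖h'‖ := sup_x |h'(x)| < ∞, one has |E h(W) − E h(Y)| ≤ ‖h'‖·{ ((1+c₃)/c₁)·E|1 − (c₀/2)E(Δ²|W)| + (1/2)·c₀·(1+c₃)·E|Δ|³ + (c₀/c₁)·E[(|W| + 3/c₁)·|r(W)|] }. -/
open MeasureTheory

open Set Filter Topology

/-- `q` is a positive integrable solution of `q' = -k q` normalised by `q 0 = 1`, where `k` is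
monotone and vanishes at the origin. -/
structure IsSteinWeight (k q : ℝ → ℝ) : Prop where
  hasDerivAt : ∀ x, HasDerivAt q (-(k x * q x)) x
  pos : ∀ x, 0 < q x
  mono : Monotone k
  zero : k 0 = 0
  one : q 0 = 1
  integrable : Integrable q

theorem monotoneOn_Iic_of_hasDerivAt_nonneg {f f' : ℝ → ℝ} {b : ℝ}
    (hf : ∀ x, HasDerivAt f (f' x) x) (hnn : ∀ x ≤ b, 0 ≤ f' x) : MonotoneOn f (Iic b) :=
  monotoneOn_of_hasDerivWithinAt_nonneg (convex_Iic b)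
    (fun x _ => (hf x).continuousAt.continuousWithinAt)
    (fun x _ => (hf x).hasDerivWithinAt) (fun x hx => hnn x (mem_Iic.1 (interior_subset hx)))

theorem hasDerivAt_setIntegral_Iic {u : ℝ → ℝ} (hu : Continuous u) (hi : Integrable u) (x : ℝ) :
    HasDerivAt (fun y => ∫ t in Iic y, u t) (u x) x := by
  have h : (fun y => ∫ t in Iic y, u t) = fun y => (∫ t in (0 : ℝ)..y, u t) + ∫ t in Iic 0, u t := by
    funext y
    rw [← intervalIntegral.integral_Iic_sub_Iic hi.integrableOn hi.integrableOn]
    ring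
  rw [h]
  exact (hu.integral_hasStrictDerivAt 0 x).hasDerivAt.add_const _

theorem abs_sub_le_of_hasDerivAt {f f' : ℝ → ℝ} {L : ℝ} (hf : ∀ x, HasDerivAt f (f' x) x)
    (hL : ∀ x, |f' x| ≤ L) (x y : ℝ) : |f x - f y| ≤ L * |x - y| :=
  convex_univ.norm_image_sub_le_of_norm_hasDerivWithin_le
    (fun t _ => (hf t).hasDerivWithinAt) (fun t _ => hL t) (mem_univ y) (mem_univ x)

theorem abs_taylor_one_le {f f₁ f₂ : ℝ → ℝ} {K : ℝ} (hf : ∀ x, HasDerivAt f (f₁ x) x)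
    (hf₁ : ∀ x, HasDerivAt f₁ (f₂ x) x) (hK : ∀ x, |f₂ x| ≤ 2 * K) (x d : ℝ) :
    |f (x + d) - f x - d * f₁ x| ≤ K * d ^ 2 := by
  have hL := abs_sub_le_of_hasDerivAt hf₁ hK
  have hd : ∀ s, HasDerivAt (fun s => f (x + s * d) - f x - s * (d * f₁ x))
      (d * (f₁ (x + s * d) - f₁ x)) s := fun s => by
    have h1 : HasDerivAt (fun s => x + s * d) d s := by
      simpa using ((hasDerivAt_id s).mul_const d).const_add x
    refine ((((hf (x + s * d)).comp s h1).sub_const (f x)).sub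
      ((hasDerivAt_id s).mul_const (d * f₁ x))).congr_deriv ?_
    ring
  have hB : ∀ s, HasDerivAt (fun s => K * d ^ 2 * s ^ 2) (2 * K * d ^ 2 * s) s := fun s => by
    refine ((hasDerivAt_pow 2 s).const_mul (K * d ^ 2)).congr_deriv ?_
    norm_num
    ring
  have := image_norm_le_of_norm_deriv_right_le_deriv_boundary' (a := 0) (b := 1)
    (fun s _ => (hd s).continuousAt.continuousWithinAt) (fun s _ => (hd s).hasDerivWithinAt)
    (by simp) (fun s _ => (hB s).continuousAt.continuousWithinAt)
    (fun s _ => (hB s).hasDerivWithinAt) (fun s hs => by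
      have h2 := hL (x + s * d) x
      rw [add_sub_cancel_left, abs_mul, abs_of_nonneg hs.1] at h2
      rw [Real.norm_eq_abs, abs_mul, ← sq_abs d]
      nlinarith [mul_le_mul_of_nonneg_left h2 (abs_nonneg d)]) (right_mem_Icc.2 zero_le_one)
  simpa using this

namespace IsSteinWeight

variable {k q : ℝ → ℝ}

theorem reflect (hq : IsSteinWeight k q) :
    IsSteinWeight (fun x => -k (-x)) (fun x => q (-x)) where
  hasDerivAt x := by
    have := (hq.hasDerivAt (-x)).comp x (hasDerivAt_neg x)
    refine this.congr_deriv ?_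
    ring
  pos x := hq.pos _
  mono x y hxy := neg_le_neg (hq.mono (neg_le_neg hxy))
  zero := by simp [hq.zero]
  one := by simp [hq.one]
  integrable := hq.integrable.comp_neg

theorem continuous (hq : IsSteinWeight k q) : Continuous q :=
  continuous_iff_continuousAt.2 fun x => (hq.hasDerivAt x).continuousAt

theorem nonpos (hq : IsSteinWeight k q) {x : ℝ} (hx : x ≤ 0) : k x ≤ 0 :=
  hq.zero ▸ hq.mono hx

theorem hasDerivAt_leftTail (hq : IsSteinWeight k q) (x : ℝ) :
    HasDerivAt (fun y => ∫ t in Iic y, q t) (q x) x :=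
  hasDerivAt_setIntegral_Iic hq.continuous hq.integrable x

theorem leftTail_nonneg (hq : IsSteinWeight k q) (x : ℝ) : 0 ≤ ∫ t in Iic x, q t :=
  integral_nonneg fun t => (hq.pos t).le

theorem leftTail_le (hq : IsSteinWeight k q) (x : ℝ) : ∫ t in Iic x, q t ≤ ∫ t, q t :=
  setIntegral_le_integral hq.integrable (ae_of_all _ fun t => (hq.pos t).le)

theorem integral_pos (hq : IsSteinWeight k q) : 0 < ∫ t, q t := by
  rw [integral_pos_iff_support_of_nonneg (fun t => (hq.pos t).le) hq.integrable]
  have : Function.support q = univ := by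
    ext x; simp [(hq.pos x).ne']
  simp [this]

theorem neg_mul_leftTail_le (hq : IsSteinWeight k q) (x : ℝ) :
    -k x * ∫ t in Iic x, q t ≤ q x := by
  have hlim : Tendsto (fun a => -k x * ∫ t in a..x, q t) atBot (𝓝 (-k x * ∫ t in Iic x, q t)) :=
    (intervalIntegral_tendsto_integral_Iic x hq.integrable.integrableOn tendsto_id).const_mul _
  refine le_of_tendsto hlim ?_
  filter_upwards [eventually_le_atBot x] with a ha
  have hd : ∀ t, HasDerivAt (fun t => q t - -k x * ∫ s in a..t, q s)
      (-(k t * q t) - -k x * q t) t := fun t =>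
    (hq.hasDerivAt t).sub ((hq.continuous.integral_hasStrictDerivAt a t).hasDerivAt.const_mul _)
  have hm := monotoneOn_Iic_of_hasDerivAt_nonneg (b := x) hd (fun t ht => by
    nlinarith [mul_le_mul_of_nonneg_right (hq.mono ht) (hq.pos t).le])
  have := hm ha (mem_Iic.2 le_rfl) ha
  simp only [intervalIntegral.integral_same, mul_zero, sub_zero] at this
  linarith [hq.pos a]

theorem leftTail_le_mul (hq : IsSteinWeight k q) {x : ℝ} (hx : x ≤ 0) :
    ∫ t in Iic x, q t ≤ (∫ t, q t) * q x := by
  have hd : ∀ t, HasDerivAt (fun t => (∫ s in Iic t, q s) / q t)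
      ((q t * q t - (∫ s in Iic t, q s) * -(k t * q t)) / q t ^ 2) t := fun t =>
    (hq.hasDerivAt_leftTail t).div (hq.hasDerivAt t) (hq.pos t).ne'
  have hm := monotoneOn_Iic_of_hasDerivAt_nonneg (b := 0) hd (fun t ht => by
    refine div_nonneg ?_ (sq_nonneg _)
    nlinarith [mul_nonneg (hq.leftTail_nonneg t) (mul_nonneg (neg_nonneg.2 (hq.nonpos ht))
      (hq.pos t).le), mul_le_mul_of_nonneg_right (hq.neg_mul_leftTail_le t) (hq.pos t).le])
  have h0 := hm (mem_Iic.2 hx) (mem_Iic.2 le_rfl) hx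
  simp only [hq.one, div_one] at h0
  rw [← div_le_iff₀ (hq.pos x)]
  exact h0.trans (hq.leftTail_le 0)

theorem integral_abs_mul_le (hq : IsSteinWeight k q) {a x : ℝ} (hax : a ≤ x) (hx : x ≤ 0) :
    ∫ t in a..x, |t| * q t ≤ (|x| + ∫ t, q t) * ∫ t in Iic x, q t := by
  have hc : Continuous fun t => |t| * q t := continuous_abs.mul hq.continuous
  have hd : ∀ t, HasDerivAt
      (fun t => (-t + ∫ t, q t) * (∫ s in Iic t, q s) - ∫ s in a..t, |s| * q s)
      ((-1 * (∫ s in Iic t, q s) + (-t + ∫ t, q t) * q t) - |t| * q t) t := fun t =>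
    (((hasDerivAt_neg t).add_const _).mul (hq.hasDerivAt_leftTail t)).sub
      (hc.integral_hasStrictDerivAt a t).hasDerivAt
  have hm := monotoneOn_Iic_of_hasDerivAt_nonneg (b := 0) hd (fun t ht => by
    rw [abs_of_nonpos ht]
    nlinarith [hq.leftTail_le_mul ht])
  have := hm (mem_Iic.2 (hax.trans hx)) (mem_Iic.2 hx) hax
  have h2 : 0 ≤ (-a + ∫ t, q t) * (∫ s in Iic a, q s) :=
    mul_nonneg (by linarith [hq.integral_pos]) (hq.leftTail_nonneg a)
  simp only [intervalIntegral.integral_same, sub_zero] at this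
  rw [abs_of_nonpos hx]
  linarith

theorem integrableOn_abs_mul_Iic (hq : IsSteinWeight k q) :
    IntegrableOn (fun t => |t| * q t) (Iic 0) := by
  have hc : Continuous fun t => |t| * q t := continuous_abs.mul hq.continuous
  refine integrableOn_Iic_of_intervalIntegral_norm_bounded
    ((|0| + ∫ t, q t) * ∫ t in Iic 0, q t) 0 (l := atBot) (a := id)
    (fun i => hc.integrableOn_Ioc) tendsto_id ?_
  filter_upwards [eventually_le_atBot 0] with a ha
  have : ∀ t, ‖|t| * q t‖ = |t| * q t := fun t => by
    rw [Real.norm_eq_abs, abs_of_nonneg (mul_nonneg (abs_nonneg t) (hq.pos t).le)]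
  simp only [this]
  exact hq.integral_abs_mul_le ha le_rfl

theorem setIntegral_abs_mul_le (hq : IsSteinWeight k q) {x : ℝ} (hx : x ≤ 0) :
    ∫ t in Iic x, |t| * q t ≤ (|x| + ∫ t, q t) * ∫ t in Iic x, q t := by
  refine le_of_tendsto (intervalIntegral_tendsto_integral_Iic x
    (hq.integrableOn_abs_mul_Iic.mono_set (Iic_subset_Iic.2 hx)) tendsto_id) ?_
  filter_upwards [eventually_le_atBot x] with a ha
  exact hq.integral_abs_mul_le ha hx

theorem integral_reflect (q : ℝ → ℝ) : ∫ t, q (-t) = ∫ t, q t :=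
  integral_neg_eq_self q volume

theorem integrable_abs_mul (hq : IsSteinWeight k q) : Integrable (fun t => |t| * q t) := by
  have h1 := hq.integrableOn_abs_mul_Iic
  have h2 := hq.reflect.integrableOn_abs_mul_Iic
  have h3 : IntegrableOn (fun t => |t| * q t) (Ici 0) := by
    have := h2.comp_neg
    simpa using this
  rw [← integrableOn_univ, ← Iic_union_Ici (a := (0 : ℝ))]
  exact h1.union h3

theorem integral_abs_mul_le_sq (hq : IsSteinWeight k q) :
    ∫ t, |t| * q t ≤ (∫ t, q t) * ∫ t, q t := by
  have h1 := hq.setIntegral_abs_mul_le le_rfl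
  have h2 := hq.reflect.setIntegral_abs_mul_le le_rfl
  have e1 := integral_comp_neg_Iic 0 (fun t => |t| * q t)
  have e2 := integral_comp_neg_Iic 0 q
  have s1 := integral_add_compl measurableSet_Iic hq.integrable (s := Iic (0 : ℝ))
  have s2 := integral_add_compl measurableSet_Iic hq.integrable_abs_mul (s := Iic (0 : ℝ))
  simp only [compl_Iic, abs_neg, neg_zero, abs_zero, zero_add, integral_reflect] at *
  rw [e1, e2] at h2
  have s3 := congrArg ((∫ t, q t) * ·) s1
  simp only [mul_add] at s3
  linarith

/-- Comparison of a function `V` with the tail of `q`: if `V' = H q` with `|H| ≤ K` and `V` is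
`O((|x| + D) q)`, then `|V| ≤ K ∫_{-∞}^x q`. -/
theorem abs_le_mul_leftTail (hq : IsSteinWeight k q) {V H : ℝ → ℝ} {K C D : ℝ}
    (hV : ∀ x, HasDerivAt V (H x * q x) x) (hH : ∀ x ≤ 0, |H x| ≤ K)
    (hVb : ∀ x ≤ 0, |V x| ≤ C * (|x| + D) * q x) {x : ℝ} (hx : x ≤ 0) :
    |V x| ≤ K * ∫ t in Iic x, q t := by
  have hK : 0 ≤ K := (abs_nonneg _).trans (hH 0 le_rfl)
  have hint : Integrable fun t => C * (|t| + D) * q t := by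
    have := (hq.integrable_abs_mul.add (hq.integrable.const_mul D)).const_mul C
    refine this.congr (ae_of_all _ fun t => ?_)
    simp only [Pi.add_apply]
    ring
  refine le_of_forall_pos_le_add fun ε hε => ?_
  obtain ⟨a, hax, ha⟩ : ∃ a ≤ x, |V a| ≤ ε := by
    by_contra! hcon
    have hc : IntegrableOn (fun _ : ℝ => ε) (Iic x) := by
      refine (hint.integrableOn (s := Iic x)).mono' aestronglyMeasurable_const ?_
      refine (ae_restrict_iff' measurableSet_Iic).2 (ae_of_all _ fun t ht => ?_)
      rw [Real.norm_eq_abs, abs_of_pos hε]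
      exact (hcon t ht).le.trans (hVb t (le_trans ht hx))
    rw [integrableOn_const_iff] at hc
    simp [hε.ne'] at hc
  have m1 := monotoneOn_Iic_of_hasDerivAt_nonneg (b := x)
    (fun t => ((hq.hasDerivAt_leftTail t).const_mul K).sub (hV t)) (fun t ht => by
      nlinarith [mul_le_mul_of_nonneg_right (abs_le.1 (hH t (ht.trans hx))).2 (hq.pos t).le]) hax
      (mem_Iic.2 le_rfl) hax
  have m2 := monotoneOn_Iic_of_hasDerivAt_nonneg (b := x)
    (fun t => ((hq.hasDerivAt_leftTail t).const_mul K).add (hV t)) (fun t ht => by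
      nlinarith [mul_le_mul_of_nonneg_right (abs_le.1 (hH t (ht.trans hx))).1 (hq.pos t).le]) hax
      (mem_Iic.2 le_rfl) hax
  simp only [Pi.sub_apply, Pi.add_apply] at m1 m2
  have := mul_nonneg hK (hq.leftTail_nonneg a)
  obtain ⟨a1, a2⟩ := abs_le.1 ha
  rw [abs_le]
  constructor <;> linarith

theorem integrable_mul_of_lipschitz (hq : IsSteinWeight k q) {h : ℝ → ℝ} {B : ℝ}
    (hB : ∀ x y, |h x - h y| ≤ B * |x - y|) (hc : Continuous h) :
    Integrable fun t => h t * q t := by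
  refine ((hq.integrable_abs_mul.const_mul B).add (hq.integrable.const_mul |h 0|)).mono'
    (hc.mul hq.continuous).aestronglyMeasurable (ae_of_all _ fun t => ?_)
  have h1 := hB t 0
  have h2 : |h t| ≤ B * |t| + |h 0| := by
    have := abs_add_le (h t - h 0) (h 0)
    simp only [sub_add_cancel, sub_zero] at this h1
    linarith
  rw [Real.norm_eq_abs, abs_mul, abs_of_pos (hq.pos t)]
  simp only [Pi.add_apply]
  nlinarith [mul_le_mul_of_nonneg_right h2 (hq.pos t).le]

theorem abs_sub_mean_le (hq : IsSteinWeight k q) {h : ℝ → ℝ} {B m : ℝ}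
    (hB : ∀ x y, |h x - h y| ≤ B * |x - y|) (hc : Continuous h)
    (hm : m * ∫ t, q t = ∫ t, h t * q t) (x : ℝ) :
    |h x - m| ≤ B * (|x| + ∫ t, q t) := by
  have hM := hq.integral_pos
  have hB0 : 0 ≤ B := by simpa using (abs_nonneg _).trans (hB 1 0)
  have hhi := hq.integrable_mul_of_lipschitz hB hc
  have e : (h x - m) * ∫ t, q t = ∫ t, (h x - h t) * q t := by
    simp only [sub_mul]
    rw [integral_sub (hq.integrable.const_mul _) hhi, integral_const_mul, hm]
  have hb : |∫ t, (h x - h t) * q t| ≤ ∫ t, (B * |x| * q t + B * (|t| * q t)) := by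
    refine norm_integral_le_of_norm_le (f := fun t => (h x - h t) * q t)
      ((hq.integrable.const_mul _).add (hq.integrable_abs_mul.const_mul _))
      (ae_of_all _ fun t => ?_)
    rw [Real.norm_eq_abs, abs_mul, abs_of_pos (hq.pos t)]
    have h2 : |h x - h t| ≤ B * (|x| + |t|) :=
      (hB x t).trans (mul_le_mul_of_nonneg_left (abs_sub x t) hB0)
    nlinarith [mul_le_mul_of_nonneg_right h2 (hq.pos t).le]
  rw [integral_add (hq.integrable.const_mul _) (hq.integrable_abs_mul.const_mul _),
    integral_const_mul, integral_const_mul, ← e, abs_mul, abs_of_pos hM] at hb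
  have h3 := mul_le_mul_of_nonneg_left hq.integral_abs_mul_le_sq hB0
  refine le_of_mul_le_mul_right ?_ hM
  linarith

theorem abs_setIntegral_le (hq : IsSteinWeight k q) {u : ℝ → ℝ} {B : ℝ} (hB : 0 ≤ B)
    (hu : ∀ t, |u t| ≤ B * (|t| + ∫ t, q t)) {x : ℝ} (hx : x ≤ 0) :
    |∫ t in Iic x, u t * q t| ≤ B * (|x| + 2 * ∫ t, q t) * ∫ t in Iic x, q t := by
  have hi := hq.integrable_abs_mul.integrableOn (s := Iic x)
  have hi' := hq.integrable.integrableOn (s := Iic x)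
  have hb : |∫ t in Iic x, u t * q t| ≤
      ∫ t in Iic x, (B * (|t| * q t) + B * (∫ t, q t) * q t) := by
    refine norm_integral_le_of_norm_le (f := fun t => u t * q t)
      ((hi.const_mul _).add (hi'.const_mul _)) (ae_of_all _ fun t => ?_)
    rw [Real.norm_eq_abs, abs_mul, abs_of_pos (hq.pos t)]
    nlinarith [mul_le_mul_of_nonneg_right (hu t) (hq.pos t).le]
  rw [integral_add (hi.const_mul _) (hi'.const_mul _),
    integral_const_mul, integral_const_mul] at hb
  have h3 := mul_le_mul_of_nonneg_left (hq.setIntegral_abs_mul_le hx) hB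
  linarith

/-- Bounds on the left half-line for a solution `U / q` of the Stein equation
`f' = h - m + k f`, and for its first two derivatives. -/
theorem stein_bounds_left (hq : IsSteinWeight k q) {U h h' k' : ℝ → ℝ} {B m c : ℝ}
    (hk' : ∀ x, HasDerivAt k (k' x) x) (hh' : ∀ x, HasDerivAt h (h' x) x)
    (hh'B : ∀ x, |h' x| ≤ B) (hhm : ∀ t, |h t - m| ≤ B * (|t| + ∫ t, q t))
    (hc : ∀ x ρ, 0 ≤ ρ → ρ ≤ ∫ t, q t → |k x| * ρ ≤ 1 →
      ρ * (|x| + 2 * ∫ t, q t) * |k' x| ≤ c)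
    (hU : ∀ x, HasDerivAt U ((h x - m) * q x) x)
    (hUb : ∀ x ≤ 0, |U x| ≤ B * (|x| + 2 * ∫ t, q t) * ∫ t in Iic x, q t)
    {x : ℝ} (hx : x ≤ 0) :
    |U x / q x| ≤ B * (∫ t, q t) * (|x| + 2 * ∫ t, q t) ∧
    |h x - m + k x * (U x / q x)| ≤ B * (1 + c) * ∫ t, q t ∧
    |h' x + k' x * (U x / q x) + k x * (h x - m + k x * (U x / q x))| ≤ 2 * (B * (1 + c)) := by
  have hB : 0 ≤ B := (abs_nonneg _).trans (hh'B 0)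
  have hM := hq.integral_pos
  set M := ∫ t, q t
  set F : ℝ → ℝ := fun x => ∫ t in Iic x, q t
  have ρ0 : ∀ x, 0 ≤ F x / q x := fun x => div_nonneg (hq.leftTail_nonneg x) (hq.pos x).le
  have ρM : ∀ x ≤ 0, F x / q x ≤ M := fun x hx => by
    rw [div_le_iff₀ (hq.pos x)]; exact hq.leftTail_le_mul hx
  have ρk : ∀ x ≤ 0, |k x| * (F x / q x) ≤ 1 := fun x hx => by
    rw [abs_of_nonpos (hq.nonpos hx), ← mul_div_assoc, div_le_one (hq.pos x)]
    exact hq.neg_mul_leftTail_le x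
  have Uq : ∀ x ≤ 0, |U x / q x| ≤ B * (|x| + 2 * M) * (F x / q x) := fun x hx => by
    rw [abs_div, abs_of_pos (hq.pos x), ← mul_div_assoc]
    exact div_le_div_of_nonneg_right (hUb x hx) (hq.pos x).le
  have xM : ∀ x, 0 ≤ B * (|x| + 2 * M) := fun x =>
    mul_nonneg hB (by linarith [abs_nonneg x])
  have hH : ∀ x ≤ 0, |h' x + k' x * (U x / q x)| ≤ B * (1 + c) := fun x hx => by
    have h1 := mul_le_mul_of_nonneg_left (Uq x hx) (abs_nonneg (k' x))
    have h2 := mul_le_mul_of_nonneg_left (hc x _ (ρ0 x) (ρM x hx) (ρk x hx)) hB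
    have h3 := abs_add_le (h' x) (k' x * (U x / q x))
    rw [abs_mul] at h3
    linarith [hh'B x]
  have hV : ∀ x, HasDerivAt (fun x => (h x - m) * q x + k x * U x)
      ((h' x + k' x * (U x / q x)) * q x) x := fun x => by
    refine ((((hh' x).sub_const m).mul (hq.hasDerivAt x)).add
      ((hk' x).mul (hU x))).congr_deriv ?_
    have := (hq.pos x).ne'
    field_simp
    ring
  have hVq : ∀ x, (h x - m) * q x + k x * U x = (h x - m + k x * (U x / q x)) * q x := fun x => by
    have := (hq.pos x).ne'
    field_simp
  have hf1 : ∀ x ≤ 0, |h x - m + k x * (U x / q x)| ≤ B * (1 + c) * (F x / q x) := fun x hx => by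
    have hVb : ∀ x ≤ 0, |(h x - m) * q x + k x * U x| ≤ (2 * B) * (|x| + 2 * M) * q x :=
      fun x hx => by
        rw [hVq, abs_mul, abs_of_pos (hq.pos x)]
        refine mul_le_mul_of_nonneg_right ?_ (hq.pos x).le
        have h3 := abs_add_le (h x - m) (k x * (U x / q x))
        rw [abs_mul] at h3
        have h1 := mul_le_mul_of_nonneg_left (Uq x hx) (abs_nonneg (k x))
        have h2 := mul_le_mul_of_nonneg_left (ρk x hx) (xM x)
        have h4 := hhm x
        have h5 := mul_nonneg hB hM.le
        linarith
    have := hq.abs_le_mul_leftTail hV hH hVb hx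
    rw [hVq, abs_mul, abs_of_pos (hq.pos x)] at this
    rw [← mul_div_assoc (B * (1 + c)), le_div_iff₀ (hq.pos x)]
    exact this
  have hK : 0 ≤ B * (1 + c) := (abs_nonneg _).trans (hH 0 le_rfl)
  refine ⟨?_, ?_, ?_⟩
  · have := mul_le_mul_of_nonneg_left (ρM x hx) (xM x)
    linarith [Uq x hx]
  · exact (hf1 x hx).trans (mul_le_mul_of_nonneg_left (ρM x hx) hK)
  · have h1 := mul_le_mul_of_nonneg_left (hf1 x hx) (abs_nonneg (k x))
    have h2 := mul_le_mul_of_nonneg_left (ρk x hx) hK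
    have h3 := abs_add_le (h' x + k' x * (U x / q x)) (k x * (h x - m + k x * (U x / q x)))
    rw [abs_mul (k x)] at h3
    linarith [hH x hx]

theorem exists_stein_solution (hq : IsSteinWeight k q) {h h' k' : ℝ → ℝ} {B m c : ℝ}
    (hk' : ∀ x, HasDerivAt k (k' x) x) (hh' : ∀ x, HasDerivAt h (h' x) x)
    (hh'B : ∀ x, |h' x| ≤ B)
    (hm : m * ∫ t, q t = ∫ t, h t * q t)
    (hc : ∀ x ρ, 0 ≤ ρ → ρ ≤ ∫ t, q t → |k x| * ρ ≤ 1 →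
      ρ * (|x| + 2 * ∫ t, q t) * |k' x| ≤ c) :
    ∃ f f₁ f₂ : ℝ → ℝ, (∀ x, HasDerivAt f (f₁ x) x) ∧ (∀ x, HasDerivAt f₁ (f₂ x) x) ∧
      (∀ x, f₁ x = h x - m + k x * f x) ∧
      (∀ x, |f x| ≤ B * (∫ t, q t) * (|x| + 2 * ∫ t, q t)) ∧
      (∀ x, |f₁ x| ≤ B * (1 + c) * ∫ t, q t) ∧ (∀ x, |f₂ x| ≤ 2 * (B * (1 + c))) := by
  have hB : 0 ≤ B := (abs_nonneg _).trans (hh'B 0)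
  have hcont : Continuous h := continuous_iff_continuousAt.2 fun x => (hh' x).continuousAt
  have hhB := abs_sub_le_of_hasDerivAt hh' hh'B
  have hhm := hq.abs_sub_mean_le hhB hcont hm
  have hhi := hq.integrable_mul_of_lipschitz hhB hcont
  have hui : Integrable fun t => (h t - m) * q t := by
    simp only [sub_mul]; exact hhi.sub (hq.integrable.const_mul m)
  have hu0 : ∫ t, (h t - m) * q t = 0 := by
    simp only [sub_mul]
    rw [integral_sub hhi (hq.integrable.const_mul m), integral_const_mul, hm, sub_self]
  set U : ℝ → ℝ := fun x => ∫ t in Iic x, (h t - m) * q t with hUdef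
  have hU : ∀ x, HasDerivAt U ((h x - m) * q x) x := fun x =>
    hasDerivAt_setIntegral_Iic ((hcont.sub continuous_const).mul hq.continuous) hui x
  have hUneg : ∀ x, -U (-x) = ∫ t in Iic x, (h (-t) - m) * q (-t) := fun x => by
    rw [integral_comp_neg_Iic x fun t => (h t - m) * q t]
    have := integral_add_compl (measurableSet_Iic (a := -x)) hui
    rw [compl_Iic, hu0] at this
    simp only [hUdef]
    linarith
  have left := fun x (hx : x ≤ 0) => hq.stein_bounds_left hk' hh' hh'B hhm hc hU
    (fun x hx => hq.abs_setIntegral_le hB hhm hx) hx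
  have hM : ∫ t, q (-t) = ∫ t, q t := integral_reflect q
  have right := fun x (hx : x ≤ 0) => hq.reflect.stein_bounds_left
    (U := fun x => -U (-x)) (h := fun x => h (-x)) (h' := fun x => -h' (-x))
    (k' := fun x => k' (-x)) (B := B) (m := m) (c := c)
    (fun x => ((hk' (-x)).comp x (hasDerivAt_neg x)).neg.congr_deriv (by ring))
    (fun x => ((hh' (-x)).comp x (hasDerivAt_neg x)).congr_deriv (by ring))
    (fun x => by rw [abs_neg]; exact hh'B _)
    (fun t => by rw [hM, ← abs_neg t]; exact hhm (-t))
    (fun x ρ h0 h1 h2 => by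
      rw [hM] at h1 ⊢
      rw [abs_neg] at h2
      rw [← abs_neg x]
      exact hc (-x) ρ h0 h1 h2)
    (fun x => ((hU (-x)).comp x (hasDerivAt_neg x)).neg.congr_deriv (by ring))
    (fun x hx => by
      rw [hUneg]
      exact hq.reflect.abs_setIntegral_le hB
        (fun t => by rw [hM, ← abs_neg t]; exact hhm (-t)) hx) hx
  have key : ∀ x, |U x / q x| ≤ B * (∫ t, q t) * (|x| + 2 * ∫ t, q t) ∧
      |h x - m + k x * (U x / q x)| ≤ B * (1 + c) * ∫ t, q t ∧
      |h' x + k' x * (U x / q x) + k x * (h x - m + k x * (U x / q x))|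
        ≤ 2 * (B * (1 + c)) := fun x => by
    rcases le_total x 0 with hx | hx
    · exact left x hx
    · have := right (-x) (by linarith)
      simp only [neg_neg, hM, neg_div, abs_neg, neg_mul_neg] at this
      refine ⟨this.1, this.2.1, ?_⟩
      rw [← abs_neg]
      convert this.2.2 using 2
      ring
  have hf : ∀ x, HasDerivAt (fun x => U x / q x) (h x - m + k x * (U x / q x)) x := fun x => by
    refine ((hU x).div (hq.hasDerivAt x) (hq.pos x).ne').congr_deriv ?_
    have := (hq.pos x).ne'
    field_simp
    ring
  exact ⟨fun x => U x / q x, fun x => h x - m + k x * (U x / q x), _, hf,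
    fun x => ((hh' x).sub_const m).add ((hk' x).mul (hf x)), fun x => rfl,
    fun x => (key x).1, fun x => (key x).2.1, fun x => by
      rw [← add_assoc]; exact (key x).2.2⟩

end IsSteinWeight

section Exchangeable

variable {Ω : Type*} [MeasurableSpace Ω] {μ : Measure Ω} {W W' : Ω → ℝ}

theorem integral_exchange (hW : Measurable W) (hW' : Measurable W')
    (hexch : μ.map (fun ω => (W ω, W' ω)) = μ.map (fun ω => (W' ω, W ω)))
    {ψ : ℝ × ℝ → ℝ} (hψ : Measurable ψ) :
    ∫ ω, ψ (W ω, W' ω) ∂μ = ∫ ω, ψ (W' ω, W ω) ∂μ := by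
  have h1 := integral_map (μ := μ) (hW.prodMk hW').aemeasurable
    hψ.aestronglyMeasurable (f := ψ)
  have h2 := integral_map (μ := μ) (hW'.prodMk hW).aemeasurable
    hψ.aestronglyMeasurable (f := ψ)
  rw [← h1, ← h2, hexch]

variable [IsProbabilityMeasure μ]

theorem integral_comp_mul_condExp_s1 (hW : Measurable W) {φ : ℝ → ℝ} {Z : Ω → ℝ}
    (hφ : Measurable φ) (hφZ : Integrable (fun ω => φ (W ω) * Z ω) μ) (hZ : Integrable Z μ) :
    ∫ ω, φ (W ω) * (μ[Z | MeasurableSpace.comap W (borel ℝ)]) ω ∂μ = ∫ ω, φ (W ω) * Z ω ∂μ := by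
  have hm : MeasurableSpace.comap W (borel ℝ) ≤ ‹MeasurableSpace Ω› := hW.comap_le
  have hs : StronglyMeasurable[MeasurableSpace.comap W (borel ℝ)] (fun ω => φ (W ω)) :=
    (hφ.comp (comap_measurable W)).stronglyMeasurable
  have h1 := condExp_mul_of_stronglyMeasurable_left (μ := μ) hs hφZ hZ
  exact (integral_congr_ae h1).symm.trans (integral_condExp hm)

/-- The basic identity of exchangeable pairs, for bounded test functions. -/
theorem integral_mul_condExp_of_bounded (hW : Measurable W) (hW' : Measurable W')
    (hWi : Integrable W μ) (hW'i : Integrable W' μ)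
    (hexch : μ.map (fun ω => (W ω, W' ω)) = μ.map (fun ω => (W' ω, W ω)))
    {ξ : Ω → ℝ} (hξ : μ[fun ω => W ω - W' ω | MeasurableSpace.comap W (borel ℝ)] =ᵐ[μ] ξ)
    {φ : ℝ → ℝ} (hφ : Measurable φ) {C : ℝ} (hC : ∀ x, |φ x| ≤ C) :
    ∫ ω, φ (W ω) * ξ ω ∂μ = 1 / 2 * ∫ ω, (W ω - W' ω) * (φ (W ω) - φ (W' ω)) ∂μ := by
  have hΔ : Integrable (fun ω => W ω - W' ω) μ := hWi.sub hW'i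
  have i1 : Integrable (fun ω => φ (W ω) * (W ω - W' ω)) μ :=
    hΔ.bdd_mul (hφ.comp hW).aestronglyMeasurable (ae_of_all _ fun ω => hC (W ω))
  have i2 : Integrable (fun ω => φ (W' ω) * (W ω - W' ω)) μ :=
    hΔ.bdd_mul (hφ.comp hW').aestronglyMeasurable (ae_of_all _ fun ω => hC (W' ω))
  have e1 : ∫ ω, φ (W ω) * ξ ω ∂μ = ∫ ω, φ (W ω) * (W ω - W' ω) ∂μ := by
    rw [← integral_comp_mul_condExp_s1 hW hφ i1 hΔ]
    exact integral_congr_ae (hξ.symm.mono fun ω h => congrArg (φ (W ω) * ·) h)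
  have e2 : ∫ ω, φ (W' ω) * (W ω - W' ω) ∂μ = -∫ ω, φ (W ω) * (W ω - W' ω) ∂μ := by
    rw [integral_exchange hW hW' hexch (ψ := fun p => φ p.2 * (p.1 - p.2)) (by fun_prop),
      ← integral_neg]
    exact integral_congr_ae (ae_of_all _ fun ω => by ring)
  have e3 : ∫ ω, (W ω - W' ω) * (φ (W ω) - φ (W' ω)) ∂μ =
      ∫ ω, φ (W ω) * (W ω - W' ω) ∂μ - ∫ ω, φ (W' ω) * (W ω - W' ω) ∂μ := by
    rw [← integral_sub i1 i2]
    exact integral_congr_ae (ae_of_all _ fun ω => by ring)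
  rw [e1, e3, e2]
  ring

/-- The basic identity of exchangeable pairs, for Lipschitz test functions. -/
theorem integral_mul_condExp_of_lipschitz (hW : Measurable W) (hW' : Measurable W')
    (hWi : Integrable W μ) (hW'i : Integrable W' μ)
    (hexch : μ.map (fun ω => (W ω, W' ω)) = μ.map (fun ω => (W' ω, W ω)))
    {ξ : Ω → ℝ} (hξ : μ[fun ω => W ω - W' ω | MeasurableSpace.comap W (borel ℝ)] =ᵐ[μ] ξ)
    (hΔ2 : Integrable (fun ω => (W ω - W' ω) ^ 2) μ)
    {f : ℝ → ℝ} {L : ℝ} (hf : Continuous f) (hL : ∀ x y, |f x - f y| ≤ L * |x - y|)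
    (hfξ : Integrable (fun ω => f (W ω) * ξ ω) μ) :
    ∫ ω, f (W ω) * ξ ω ∂μ = 1 / 2 * ∫ ω, (W ω - W' ω) * (f (W ω) - f (W' ω)) ∂μ := by
  set φ : ℕ → ℝ → ℝ := fun n x => max (-(n : ℝ)) (min n (f x)) with hφ
  have hφc : ∀ n, Continuous (φ n) := fun n => by fun_prop
  have hφn : ∀ n x, |φ n x| ≤ n := fun n x => by
    have : (0 : ℝ) ≤ n := Nat.cast_nonneg n
    exact abs_le.2 ⟨le_max_left _ _, max_le (by linarith) (min_le_left _ _)⟩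
  have hφf : ∀ n x, |φ n x| ≤ |f x| := fun n x => by
    have : (0 : ℝ) ≤ n := Nat.cast_nonneg n
    refine abs_le.2 ⟨le_max_of_le_right (le_min ?_ (neg_abs_le _)),
      max_le ?_ ((min_le_right _ _).trans (le_abs_self _))⟩ <;>
    linarith [abs_nonneg (f x)]
  have hφL : ∀ n x y, |φ n x - φ n y| ≤ |f x - f y| := fun n x y => by
    refine (abs_max_sub_max_le_max _ _ _ _).trans ?_
    rw [sub_self, abs_zero]
    refine max_le (abs_nonneg _) ((abs_min_sub_min_le_max _ _ _ _).trans ?_)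
    rw [sub_self, abs_zero]
    exact max_le (abs_nonneg _) le_rfl
  have hlim : ∀ x, Tendsto (fun n => φ n x) atTop (𝓝 (f x)) := fun x => by
    refine tendsto_const_nhds.congr' ?_
    filter_upwards [eventually_ge_atTop ⌈|f x|⌉₊] with n hn
    have h1 : |f x| ≤ n := Nat.ceil_le.1 hn
    obtain ⟨h2, h3⟩ := abs_le.1 h1
    simp only [hφ]
    rw [min_eq_right h3, max_eq_right h2]
  have hξm : AEStronglyMeasurable ξ μ := integrable_condExp.aestronglyMeasurable.congr hξ
  have t1 : Tendsto (fun n => ∫ ω, φ n (W ω) * ξ ω ∂μ) atTop (𝓝 (∫ ω, f (W ω) * ξ ω ∂μ)) := by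
    refine tendsto_integral_of_dominated_convergence (fun ω => ‖f (W ω) * ξ ω‖)
      (fun n => ((hφc n).measurable.comp hW).aestronglyMeasurable.mul hξm) hfξ.norm
      (fun n => ae_of_all _ fun ω => ?_) (ae_of_all _ fun ω => (hlim _).mul_const _)
    rw [norm_mul, norm_mul]
    exact mul_le_mul_of_nonneg_right (hφf n _) (norm_nonneg _)
  have t2 : Tendsto (fun n => ∫ ω, (W ω - W' ω) * (φ n (W ω) - φ n (W' ω)) ∂μ) atTop
      (𝓝 (∫ ω, (W ω - W' ω) * (f (W ω) - f (W' ω)) ∂μ)) := by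
    refine tendsto_integral_of_dominated_convergence (fun ω => L * (W ω - W' ω) ^ 2)
      (fun n => ((hW.sub hW').mul (((hφc n).measurable.comp hW).sub
        ((hφc n).measurable.comp hW'))).aestronglyMeasurable) (hΔ2.const_mul L)
      (fun n => ae_of_all _ fun ω => ?_)
      (ae_of_all _ fun ω => ((hlim _).sub (hlim _)).const_mul _)
    rw [norm_mul, Real.norm_eq_abs, Real.norm_eq_abs, ← sq_abs (W ω - W' ω)]
    nlinarith [mul_le_mul_of_nonneg_left ((hφL n (W ω) (W' ω)).trans (hL _ _))
      (abs_nonneg (W ω - W' ω))]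
  refine tendsto_nhds_unique t1 ((t2.const_mul (1 / 2)).congr fun n => ?_)
  exact (integral_mul_condExp_of_bounded hW hW' hWi hW'i hexch hξ (hφc n).measurable (hφn n)).symm

theorem stein_exchangeable_bound (hW : Measurable W) (hW' : Measurable W')
    (hWi : Integrable W μ) (hW'i : Integrable W' μ)
    (hexch : μ.map (fun ω => (W ω, W' ω)) = μ.map (fun ω => (W' ω, W ω)))
    {g r : ℝ → ℝ} (hg : Measurable g)
    (hcond : μ[fun ω => W ω - W' ω | MeasurableSpace.comap W (borel ℝ)]
      =ᵐ[μ] fun ω => g (W ω) + r (W ω))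
    {c₀ A D L K : ℝ} (hc₀ : 0 < c₀)
    (hΔ3 : Integrable (fun ω => |W ω - W' ω| ^ 3) μ)
    (hrInt : Integrable (fun ω => (|W ω| + D) * |r (W ω)|) μ)
    {f f₁ f₂ u : ℝ → ℝ} (hf : ∀ x, HasDerivAt f (f₁ x) x) (hf₁ : ∀ x, HasDerivAt f₁ (f₂ x) x)
    (hfu : ∀ x, f₁ x = u x + c₀ * g x * f x) (hfA : ∀ x, |f x| ≤ A * (|x| + D))
    (hfL : ∀ x, |f₁ x| ≤ L) (hfK : ∀ x, |f₂ x| ≤ 2 * K)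
    (hu : Integrable (fun ω => u (W ω)) μ) :
    |∫ ω, u (W ω) ∂μ| ≤
      L * ∫ ω, |1 - c₀ / 2 * (μ[fun ω' => (W ω' - W' ω') ^ 2
          | MeasurableSpace.comap W (borel ℝ)]) ω| ∂μ
        + c₀ / 2 * K * ∫ ω, |W ω - W' ω| ^ 3 ∂μ
        + c₀ * A * ∫ ω, (|W ω| + D) * |r (W ω)| ∂μ := by
  have hfc : Continuous f := continuous_iff_continuousAt.2 fun x => (hf x).continuousAt
  have hf₁c : Continuous f₁ := continuous_iff_continuousAt.2 fun x => (hf₁ x).continuousAt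
  have hΔ2 : Integrable (fun ω => (W ω - W' ω) ^ 2) μ := by
    refine ((integrable_const (1 : ℝ)).add hΔ3).mono'
      ((hW.sub hW').pow_const 2).aestronglyMeasurable (ae_of_all _ fun ω => ?_)
    rw [Real.norm_eq_abs, abs_of_nonneg (sq_nonneg _), ← sq_abs]
    simp only [Pi.add_apply]
    have := abs_nonneg (W ω - W' ω)
    rcases le_total (|W ω - W' ω|) 1 with h1 | h1
    · nlinarith [pow_nonneg this 3]
    · nlinarith [mul_nonneg (sq_nonneg (|W ω - W' ω|)) (sub_nonneg.2 h1)]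
  set S : Ω → ℝ := μ[fun ω' => (W ω' - W' ω') ^ 2 | MeasurableSpace.comap W (borel ℝ)]
  have hSi : Integrable S μ := integrable_condExp
  have hgW : AEStronglyMeasurable (fun ω => g (W ω)) μ := (hg.comp hW).aestronglyMeasurable
  have hrW : AEStronglyMeasurable (fun ω => r (W ω)) μ := by
    refine ((integrable_condExp.aestronglyMeasurable.congr hcond).sub hgW).congr
      (ae_of_all _ fun ω => ?_)
    simp
  have hfW : AEStronglyMeasurable (fun ω => f (W ω)) μ :=
    (hfc.measurable.comp hW).aestronglyMeasurable
  have hf₁W : AEStronglyMeasurable (fun ω => f₁ (W ω)) μ :=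
    (hf₁c.measurable.comp hW).aestronglyMeasurable
  have hfr_le : ∀ ω, ‖f (W ω) * r (W ω)‖ ≤ A * ((|W ω| + D) * |r (W ω)|) := fun ω => by
    rw [norm_mul, Real.norm_eq_abs, Real.norm_eq_abs]
    nlinarith [mul_le_mul_of_nonneg_right (hfA (W ω)) (abs_nonneg (r (W ω)))]
  have hfr : Integrable (fun ω => f (W ω) * r (W ω)) μ :=
    (hrInt.const_mul A).mono' (hfW.mul hrW) (ae_of_all _ hfr_le)
  have hf₁i : Integrable (fun ω => f₁ (W ω)) μ :=
    (integrable_const L).mono' hf₁W (ae_of_all _ fun ω => hfL _)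
  have hfg : Integrable (fun ω => f (W ω) * g (W ω)) μ := by
    refine ((hf₁i.sub hu).const_mul c₀⁻¹).congr (ae_of_all _ fun ω => ?_)
    simp only [Pi.sub_apply, hfu (W ω)]
    field_simp
    ring
  have hfξ : Integrable (fun ω => f (W ω) * (g (W ω) + r (W ω))) μ := by
    simp only [mul_add]; exact hfg.add hfr
  have key := integral_mul_condExp_of_lipschitz hW hW' hWi hW'i hexch hcond hΔ2 hfc
    (abs_sub_le_of_hasDerivAt hf hfL) hfξ
  have hf₁S : Integrable (fun ω => f₁ (W ω) * S ω) μ :=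
    hSi.bdd_mul hf₁W (ae_of_all _ fun ω => hfL _)
  have hf₁Δ : Integrable (fun ω => f₁ (W ω) * (W ω - W' ω) ^ 2) μ :=
    hΔ2.bdd_mul hf₁W (ae_of_all _ fun ω => hfL _)
  have pull : ∫ ω, f₁ (W ω) * S ω ∂μ = ∫ ω, f₁ (W ω) * (W ω - W' ω) ^ 2 ∂μ :=
    integral_comp_mul_condExp_s1 hW hf₁c.measurable hf₁Δ hΔ2
  have hΔf : Integrable (fun ω => (W ω - W' ω) * (f (W ω) - f (W' ω))) μ := by
    refine (hΔ2.const_mul L).mono' ((hW.sub hW').mul ((hfc.measurable.comp hW).sub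
        (hfc.measurable.comp hW'))).aestronglyMeasurable (ae_of_all _ fun ω => ?_)
    rw [norm_mul, Real.norm_eq_abs, Real.norm_eq_abs, ← sq_abs (W ω - W' ω)]
    nlinarith [mul_le_mul_of_nonneg_left (abs_sub_le_of_hasDerivAt hf hfL (W ω) (W' ω))
      (abs_nonneg (W ω - W' ω))]
  have e1 : ∫ ω, u (W ω) ∂μ =
      ∫ ω, f₁ (W ω) * (1 - c₀ / 2 * S ω) ∂μ
      + c₀ / 2 * ∫ ω, (f₁ (W ω) * (W ω - W' ω) ^ 2 - (W ω - W' ω) * (f (W ω) - f (W' ω))) ∂μ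
      + c₀ * ∫ ω, f (W ω) * r (W ω) ∂μ := by
    have a1 : ∫ ω, u (W ω) ∂μ = ∫ ω, f₁ (W ω) ∂μ
        - c₀ * ∫ ω, f (W ω) * (g (W ω) + r (W ω)) ∂μ + c₀ * ∫ ω, f (W ω) * r (W ω) ∂μ := by
      have hi : Integrable (fun ω => f₁ (W ω) - c₀ * (f (W ω) * (g (W ω) + r (W ω)))) μ :=
        hf₁i.sub (hfξ.const_mul c₀)
      rw [← integral_const_mul, ← integral_const_mul, ← integral_sub hf₁i (hfξ.const_mul c₀),
        ← integral_add hi (hfr.const_mul c₀)]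
      refine integral_congr_ae (ae_of_all _ fun ω => ?_)
      simp only [hfu (W ω)]
      ring
    have a2 : ∫ ω, f₁ (W ω) * (1 - c₀ / 2 * S ω) ∂μ =
        ∫ ω, f₁ (W ω) ∂μ - c₀ / 2 * ∫ ω, f₁ (W ω) * S ω ∂μ := by
      rw [← integral_const_mul, ← integral_sub hf₁i (hf₁S.const_mul _)]
      exact integral_congr_ae (ae_of_all _ fun ω => by ring)
    rw [a1, a2, integral_sub hf₁Δ hΔf, key, pull]
    ring
  have b1 : |∫ ω, f₁ (W ω) * (1 - c₀ / 2 * S ω) ∂μ| ≤ L * ∫ ω, |1 - c₀ / 2 * S ω| ∂μ := by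
    rw [← integral_const_mul]
    refine norm_integral_le_of_norm_le (f := fun ω => f₁ (W ω) * (1 - c₀ / 2 * S ω))
      ((((integrable_const (1 : ℝ)).sub (hSi.const_mul (c₀ / 2))).abs).const_mul L)
      (ae_of_all _ fun ω => ?_)
    rw [norm_mul]
    exact mul_le_mul_of_nonneg_right (hfL _) (abs_nonneg _)
  have b2 : |∫ ω, (f₁ (W ω) * (W ω - W' ω) ^ 2 - (W ω - W' ω) * (f (W ω) - f (W' ω))) ∂μ|
      ≤ K * ∫ ω, |W ω - W' ω| ^ 3 ∂μ := by
    rw [← integral_const_mul, ← Real.norm_eq_abs]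
    refine norm_integral_le_of_norm_le (hΔ3.const_mul K) (ae_of_all _ fun ω => ?_)
    have := abs_taylor_one_le hf hf₁ hfK (W ω) (-(W ω - W' ω))
    rw [show W ω + -(W ω - W' ω) = W' ω by ring] at this
    rw [Real.norm_eq_abs, show f₁ (W ω) * (W ω - W' ω) ^ 2 - (W ω - W' ω) * (f (W ω) - f (W' ω))
      = (W ω - W' ω) * (f (W' ω) - f (W ω) - -(W ω - W' ω) * f₁ (W ω)) by ring, abs_mul]
    rw [neg_sq, ← sq_abs] at this
    nlinarith [mul_le_mul_of_nonneg_left this (abs_nonneg (W ω - W' ω))]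
  have b3 : |∫ ω, f (W ω) * r (W ω) ∂μ| ≤ A * ∫ ω, (|W ω| + D) * |r (W ω)| ∂μ := by
    rw [← integral_const_mul]
    exact norm_integral_le_of_norm_le (hrInt.const_mul A) (ae_of_all _ hfr_le)
  have h2 : 0 ≤ c₀ / 2 := by linarith
  rw [e1]
  refine (abs_add_three _ _ _).trans ?_
  rw [abs_mul, abs_mul, abs_of_nonneg h2, abs_of_pos hc₀]
  have d2 := mul_le_mul_of_nonneg_left b2 h2
  have d3 := mul_le_mul_of_nonneg_left b3 hc₀.le
  linarith

end Exchangeable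

theorem exists_smooth_approx {h : ℝ → ℝ} {B ε : ℝ} (hε : 0 < ε) (hB0 : 0 ≤ B)
    (hc : Continuous h) (hB : ∀ x y, |h x - h y| ≤ B * |x - y|) :
    ∃ s s' : ℝ → ℝ, (∀ x, HasDerivAt s (s' x) x) ∧ (∀ x, |s' x| ≤ B) ∧
      ∀ x, |s x - h x| ≤ B * ε := by
  have hP : ∀ x, HasDerivAt (fun x => ∫ t in (0 : ℝ)..x, h t) (h x) x := fun x =>
    (hc.integral_hasStrictDerivAt 0 x).hasDerivAt
  refine ⟨fun x => ((∫ t in (0 : ℝ)..x + ε, h t) - ∫ t in (0 : ℝ)..x, h t) / ε,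
    fun x => (h (x + ε) - h x) / ε,
    fun x => (((hP (x + ε)).comp_add_const x ε).sub (hP x)).div_const ε, fun x => ?_, fun x => ?_⟩
  · have := hB (x + ε) x
    rw [add_sub_cancel_left, abs_of_pos hε] at this
    rwa [abs_div, abs_of_pos hε, div_le_iff₀ hε]
  · have e : ((∫ t in (0 : ℝ)..x + ε, h t) - ∫ t in (0 : ℝ)..x, h t) / ε - h x =
        (∫ t in x..x + ε, (h t - h x)) / ε := by
      rw [intervalIntegral.integral_interval_sub_left (hc.intervalIntegrable _ _)
        (hc.intervalIntegrable _ _), intervalIntegral.integral_sub (hc.intervalIntegrable _ _)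
        intervalIntegrable_const, intervalIntegral.integral_const, add_sub_cancel_left, smul_eq_mul]
      field_simp
    have hb : ‖∫ t in x..x + ε, (h t - h x)‖ ≤ B * ε * |x + ε - x| := by
      refine intervalIntegral.norm_integral_le_of_norm_le_const fun t ht => ?_
      rw [uIoc_of_le (by linarith)] at ht
      refine (hB t x).trans (mul_le_mul_of_nonneg_left ?_ hB0)
      rw [abs_of_pos (by linarith [ht.1])]
      linarith [ht.2]
    rw [add_sub_cancel_left, abs_of_pos hε, Real.norm_eq_abs] at hb
    rwa [e, abs_div, abs_of_pos hε, div_le_iff₀ hε]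

theorem integral_comp_of_map_eq_withDensity {Ω : Type*} [MeasurableSpace Ω] {μ : Measure Ω}
    {Y : Ω → ℝ} (hY : Measurable Y) {p : ℝ → ℝ} (hp : Continuous p) (hp0 : ∀ t, 0 ≤ p t)
    (hYp : μ.map Y = volume.withDensity fun t => ENNReal.ofReal (p t))
    {h : ℝ → ℝ} (hh : Continuous h) (hi : Integrable fun t => h t * p t) :
    Integrable (fun ω => h (Y ω)) μ ∧ ∫ ω, h (Y ω) ∂μ = ∫ t, h t * p t := by
  have hm : Measurable fun t => ENNReal.ofReal (p t) := hp.measurable.ennreal_ofReal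
  have hfin : ∀ᵐ t ∂(volume : Measure ℝ), ENNReal.ofReal (p t) < ⊤ :=
    ae_of_all _ fun t => ENNReal.ofReal_lt_top
  have he : ∀ t, (ENNReal.ofReal (p t)).toReal • h t = h t * p t := fun t => by
    rw [ENNReal.toReal_ofReal (hp0 t), smul_eq_mul, mul_comm]
  constructor
  · have : Integrable h (μ.map Y) := by
      rw [hYp, integrable_withDensity_iff_integrable_smul' hm hfin]
      simpa only [he] using hi
    exact this.comp_measurable hY
  · rw [← integral_map hY.aemeasurable hh.aestronglyMeasurable (f := h), hYp,
      integral_withDensity_eq_integral_toReal_smul hm hfin]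
    simp only [he]

theorem isSteinWeight_exp {g : ℝ → ℝ} {c : ℝ} (hc : 0 ≤ c) (hgc : Continuous g)
    (hmono : Monotone g) (hg0 : g 0 = 0)
    (hint : Integrable fun t => Real.exp (-(c * ∫ s in (0:ℝ)..t, g s))) :
    IsSteinWeight (fun x => c * g x) fun t => Real.exp (-(c * ∫ s in (0:ℝ)..t, g s)) where
  hasDerivAt x := by
    refine (((hgc.integral_hasStrictDerivAt 0 x).hasDerivAt.const_mul c).neg.exp).congr_deriv ?_
    simp only [Pi.neg_apply]
    ring
  pos x := Real.exp_pos _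
  mono := hmono.const_mul hc
  zero := by simp [hg0]
  one := by simp
  integrable := hint

/-- **Theorem 1.1(ii)** (Chatterjee–Shao). Non-normal approximation by Stein's method of
exchangeable pairs: bound for smooth test functions under hypotheses (H1) and (H3). -/
theorem exchangeable_pair_nonnormal_approx_H3
    {Ω : Type*} [MeasurableSpace Ω] {μ : Measure Ω} [IsProbabilityMeasure μ]
    (W W' Y : Ω → ℝ) (hWmeas : Measurable W) (hW'meas : Measurable W')
    (hYmeas : Measurable Y)
    (hWint : Integrable W μ) (hW'int : Integrable W' μ)
    -- (W, W') is an exchangeable pair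
    (hexch : μ.map (fun ω => (W ω, W' ω)) = μ.map (fun ω => (W' ω, W ω)))
    -- E(W - W' | W) = g(W) + r(W), with g differentiable with derivative g'
    (g g' r : ℝ → ℝ) (hg' : ∀ x, HasDerivAt g (g' x) x)
    (hcond : μ[fun ω => W ω - W' ω | MeasurableSpace.comap W (borel ℝ)]
      =ᵐ[μ] fun ω => g (W ω) + r (W ω))
    -- the constants c₀ and c₁ and the density p(t) = c₁ exp(-c₀ G(t)), G(t) = ∫₀ᵗ g
    (c₀ c₁ c₃ : ℝ) (hc₀ : 0 < c₀) (hc₁pos : 0 < c₁)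
    (hpInt : Integrable (fun t => Real.exp (-(c₀ * ∫ s in (0:ℝ)..t, g s))))
    (hc₁ : c₁ = (∫ t : ℝ, Real.exp (-(c₀ * ∫ s in (0:ℝ)..t, g s)))⁻¹)
    -- Y has probability density p
    (hYdens : μ.map Y
      = volume.withDensity
          (fun t => ENNReal.ofReal (c₁ * Real.exp (-(c₀ * ∫ s in (0:ℝ)..t, g s)))))
    -- Hypothesis (H1)
    (hmono : Monotone g) (hgpos : ∀ t, 0 < t → 0 ≤ g t) (hgneg : ∀ t, t ≤ 0 → g t ≤ 0)
    -- Hypothesis (H3), with 1/|c₀ g(x)| read as +∞ when g(x) = 0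
    (hH3 : ∀ x, (if g x = 0 then 1 / c₁ else min (1 / c₁) (1 / |c₀ * g x|))
        * (|x| + 3 / c₁) * (c₀ * |g' x|) ≤ c₃)
    -- moment assumptions: E|Δ|³ < ∞ and E((|W| + 3/c₁)|r(W)|) < ∞
    (hΔ3 : Integrable (fun ω => |W ω - W' ω| ^ 3) μ)
    (hrInt : Integrable (fun ω => (|W ω| + 3 / c₁) * |r (W ω)|) μ)
    -- h absolutely continuous with ‖h'‖ = sup |h'| ≤ B < ∞
    (h h' : ℝ → ℝ) (B : ℝ)
    (hhAC : ∀ x y : ℝ, h y - h x = ∫ t in x..y, h' t)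
    (hh'B : ∀ x, |h' x| ≤ B) :
    |(∫ ω, h (W ω) ∂μ) - ∫ ω, h (Y ω) ∂μ|
      ≤ B * ((1 + c₃) / c₁
            * ∫ ω, |1 - c₀ / 2
                * (μ[fun ω' => (W ω' - W' ω') ^ 2
                    | MeasurableSpace.comap W (borel ℝ)]) ω| ∂μ
          + 1 / 2 * c₀ * (1 + c₃) * ∫ ω, |W ω - W' ω| ^ 3 ∂μ
          + c₀ / c₁ * ∫ ω, (|W ω| + 3 / c₁) * |r (W ω)| ∂μ) := by
  have hB0 : 0 ≤ B := (abs_nonneg _).trans (hh'B 0)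
  have hLip : ∀ x y, |h x - h y| ≤ B * |x - y| := fun x y => by
    rw [hhAC y x, ← Real.norm_eq_abs]
    exact intervalIntegral.norm_integral_le_of_norm_le_const fun t _ => hh'B t
  have hhc : Continuous h := (LipschitzWith.of_dist_le_mul (K := ⟨B, hB0⟩) hLip).continuous
  have hgc : Continuous g := continuous_iff_continuousAt.2 fun x => (hg' x).continuousAt
  have hg0 : g 0 = 0 := by
    refine le_antisymm (hgneg 0 le_rfl) (ge_of_tendsto
      (hgc.continuousWithinAt (s := Ioi 0) (x := 0)) ?_)
    filter_upwards [self_mem_nhdsWithin] with t ht using hgpos t ht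
  have hq := isSteinWeight_exp hc₀.le hgc hmono hg0 hpInt
  set q : ℝ → ℝ := fun t => Real.exp (-(c₀ * ∫ s in (0:ℝ)..t, g s))
  have hM : ∫ t, q t = 1 / c₁ := by rw [hc₁, one_div, inv_inv]
  have hc : ∀ x ρ, 0 ≤ ρ → ρ ≤ ∫ t, q t → |c₀ * g x| * ρ ≤ 1 →
      ρ * (|x| + 2 * ∫ t, q t) * |c₀ * g' x| ≤ c₃ := fun x ρ h0 h1 h2 => by
    rw [hM] at h1 ⊢
    have hM0 : 0 ≤ 1 / c₁ := h0.trans h1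
    have hρ : ρ ≤ if g x = 0 then 1 / c₁ else min (1 / c₁) (1 / |c₀ * g x|) := by
      split_ifs with hgx
      · exact h1
      · refine le_min h1 ?_
        rw [le_div_iff₀ (abs_pos.2 (mul_ne_zero hc₀.ne' hgx)), mul_comm]
        exact h2
    refine le_trans ?_ (hH3 x)
    rw [abs_mul, abs_of_pos hc₀]
    refine mul_le_mul_of_nonneg_right ?_ (mul_nonneg hc₀.le (abs_nonneg _))
    refine mul_le_mul hρ ?_ (add_nonneg (abs_nonneg _) (by linarith)) (h0.trans hρ)
    rw [show 3 / c₁ = 3 * (1 / c₁) by ring]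
    linarith
  have hYlaw : ∀ s : ℝ → ℝ, Continuous s → (∀ x y, |s x - s y| ≤ B * |x - y|) →
      Integrable (fun ω => s (Y ω)) μ ∧ ∫ ω, s (Y ω) ∂μ = c₁ * ∫ t, s t * q t :=
    fun s hsc hsL => by
      have hi := hq.integrable_mul_of_lipschitz hsL hsc
      have e : ∀ t, s t * (c₁ * q t) = c₁ * (s t * q t) := fun t => by ring
      have := integral_comp_of_map_eq_withDensity hYmeas (hq.continuous.const_mul c₁)
        (fun t => mul_nonneg hc₁pos.le (hq.pos t).le) hYdens hsc
        (by simpa only [e] using hi.const_mul c₁)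
      simpa only [e, integral_const_mul] using this
  have hWs : ∀ s : ℝ → ℝ, Continuous s → (∀ x y, |s x - s y| ≤ B * |x - y|) →
      Integrable (fun ω => s (W ω)) μ := fun s hsc hsL => by
    refine ((hWint.abs.const_mul B).add (integrable_const |s 0|)).mono'
      (hsc.measurable.comp hWmeas).aestronglyMeasurable (ae_of_all _ fun ω => ?_)
    have h1 := hsL (W ω) 0
    have h2 := abs_add_le (s (W ω) - s 0) (s 0)
    simp only [sub_add_cancel, sub_zero] at h1 h2
    simp only [Pi.add_apply, Real.norm_eq_abs]
    linarith
  set R := B * ((1 + c₃) / c₁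
            * ∫ ω, |1 - c₀ / 2
                * (μ[fun ω' => (W ω' - W' ω') ^ 2
                    | MeasurableSpace.comap W (borel ℝ)]) ω| ∂μ
          + 1 / 2 * c₀ * (1 + c₃) * ∫ ω, |W ω - W' ω| ^ 3 ∂μ
          + c₀ / c₁ * ∫ ω, (|W ω| + 3 / c₁) * |r (W ω)| ∂μ) with hR
  have smooth : ∀ s s' : ℝ → ℝ, (∀ x, HasDerivAt s (s' x) x) → (∀ x, |s' x| ≤ B) →
      |(∫ ω, s (W ω) ∂μ) - ∫ ω, s (Y ω) ∂μ| ≤ R := fun s s' hs hs'B => by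
    have hsc : Continuous s := continuous_iff_continuousAt.2 fun x => (hs x).continuousAt
    have hsL := abs_sub_le_of_hasDerivAt hs hs'B
    have hsW := hWs s hsc hsL
    obtain ⟨-, hsY⟩ := hYlaw s hsc hsL
    obtain ⟨f, f₁, f₂, hf, hf₁, hfu, hfA, hfL, hfK⟩ := hq.exists_stein_solution
      (m := ∫ ω, s (Y ω) ∂μ) (c := c₃) (fun x => (hg' x).const_mul c₀) hs hs'B
      (by rw [hsY, hM]; field_simp) hc
    have hM0 : 0 < 1 / c₁ := one_div_pos.2 hc₁pos
    have := stein_exchangeable_bound hWmeas hW'meas hWint hW'int hexch hgc.measurable hcond hc₀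
      (A := B * (1 / c₁)) (D := 3 / c₁) hΔ3 hrInt hf hf₁
      (u := fun x => s x - ∫ ω, s (Y ω) ∂μ) hfu
      (fun x => (hfA x).trans (by
        rw [hM]
        refine mul_le_mul_of_nonneg_left ?_ (mul_nonneg hB0 hM0.le)
        rw [show 3 / c₁ = 3 * (1 / c₁) by ring]
        linarith)) hfL hfK (hsW.sub (integrable_const _))
    rw [integral_sub hsW (integrable_const _), integral_const, probReal_univ, one_smul, hM] at this
    refine this.trans (le_of_eq ?_)
    rw [hR]
    ring
  refine le_of_forall_pos_le_add fun ε hε => ?_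
  obtain ⟨s, s', hs, hs'B, hsh⟩ := exists_smooth_approx
    (ε := ε / (2 * (B + 1))) (by positivity) hB0 hhc hLip
  have hδ : B * (ε / (2 * (B + 1))) ≤ ε / 2 := by
    rw [← mul_div_assoc, div_le_div_iff₀ (by linarith) two_pos]
    nlinarith
  have hsc : Continuous s := continuous_iff_continuousAt.2 fun x => (hs x).continuousAt
  have hsL := abs_sub_le_of_hasDerivAt hs hs'B
  have close : ∀ Z : Ω → ℝ, Integrable (fun ω => s (Z ω)) μ → Integrable (fun ω => h (Z ω)) μ →
      |(∫ ω, s (Z ω) ∂μ) - ∫ ω, h (Z ω) ∂μ| ≤ ε / 2 := fun Z h1 h2 => by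
    rw [← integral_sub h1 h2]
    have := norm_integral_le_of_norm_le_const (μ := μ) (f := fun ω => s (Z ω) - h (Z ω))
      (ae_of_all _ fun ω => (hsh (Z ω)).trans hδ)
    simpa using this
  have c1 := abs_le.1 (close W (hWs s hsc hsL) (hWs h hhc hLip))
  have c2 := abs_le.1 (close Y (hYlaw s hsc hsL).1 (hYlaw h hhc hLip).1)
  have c3 := abs_le.1 (smooth s s' hs hs'B)
  rw [abs_le]
  constructor <;> linarith [c1.1, c1.2, c2.1, c2.2, c3.1, c3.2]
end

section
/- Let (W,W') be an exchangeable pair with E(W−W'|W) = g(W) + r(W), Δ = W − W', and assume |W − W'| ≤ δ for a constant δ. If hypotheses (H1) and (H3) are satisfied, then for every z ∈ ℝ, |P(W ≤ z) − P(Y ≤ z)| ≤ 3·E|1 − (c₀/2)E(Δ²|W)| + c₁·max(1, c₃)·δ + 2·c₀·E|r(W)|/c₁ + δ³·c₀·{ (2 + c₃/2)·E|c₀ g(W)| + c₁ c₃/2 }. -/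
open MeasureTheory

/-- `p` is a positive probability density on `ℝ` with distribution function `F` and logarithmic
derivative `-h`, where `h` is non-decreasing, vanishes at `0` and has derivative `h'`. -/
structure IsSteinDensity (h h' p F : ℝ → ℝ) : Prop where
  monotone : Monotone h
  map_zero : h 0 = 0
  hasDerivAt : ∀ x, HasDerivAt h (h' x) x
  pos : ∀ x, 0 < p x
  hasDerivAt_density : ∀ x, HasDerivAt p (-(h x * p x)) x
  hasDerivAt_cdf : ∀ x, HasDerivAt F (p x) x
  tendsto_atBot : Filter.Tendsto F Filter.atBot (nhds 0)
  tendsto_atTop : Filter.Tendsto F Filter.atTop (nhds 1)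

/-- The solution `f` of the Stein equation `f' - h f = 1_{(-∞, z]} - F z`. -/
noncomputable def steinSolution (p F : ℝ → ℝ) (z x : ℝ) : ℝ :=
  (F (min x z) - F z * F x) / p x

/-- The right derivative of `steinSolution p F z`. -/
noncomputable def steinRightDeriv (h p F : ℝ → ℝ) (z x : ℝ) : ℝ :=
  h x * steinSolution p F z x + (if x < z then 1 else 0) - F z

namespace IsSteinDensity

variable {h h' p F : ℝ → ℝ}

lemma monotone_cdf (H : IsSteinDensity h h' p F) : Monotone F :=
  monotone_of_deriv_nonneg (fun x => (H.hasDerivAt_cdf x).differentiableAt)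
    fun x => (H.hasDerivAt_cdf x).deriv ▸ (H.pos x).le

lemma cdf_nonneg (H : IsSteinDensity h h' p F) (x : ℝ) : 0 ≤ F x :=
  H.monotone_cdf.le_of_tendsto H.tendsto_atBot x

lemma cdf_le_one (H : IsSteinDensity h h' p F) (x : ℝ) : F x ≤ 1 :=
  H.monotone_cdf.ge_of_tendsto H.tendsto_atTop x

/-- For fixed `x`, the function `y ↦ p y + h x * F y` is maximal at `y = x`. -/
lemma density_add_le (H : IsSteinDensity h h' p F) (x y : ℝ) :
    p y + h x * F y ≤ p x + h x * F x := by
  have hd (y : ℝ) : HasDerivAt (fun y => p y + h x * F y) (p y * (h x - h y)) y :=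
    ((H.hasDerivAt_density y).add ((H.hasDerivAt_cdf y).const_mul (h x))).congr_deriv (by ring)
  have hc : Continuous fun y => p y + h x * F y :=
    continuous_iff_continuousAt.2 fun y => (hd y).continuousAt
  rcases le_total y x with hy | hy
  · refine monotoneOn_of_deriv_nonneg (convex_Iic x) hc.continuousOn
      (fun y _ => (hd y).differentiableAt.differentiableWithinAt) (fun y hy => ?_) hy
      (Set.mem_Iic.2 le_rfl) hy
    rw [interior_Iic] at hy
    rw [(hd y).deriv]
    exact mul_nonneg (H.pos y).le (sub_nonneg.2 (H.monotone (le_of_lt hy)))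
  · refine antitoneOn_of_deriv_nonpos (convex_Ici x) hc.continuousOn
      (fun y _ => (hd y).differentiableAt.differentiableWithinAt) (fun y hy => ?_)
      (Set.mem_Ici.2 le_rfl) hy hy
    rw [interior_Ici] at hy
    rw [(hd y).deriv]
    exact mul_nonpos_of_nonneg_of_nonpos (H.pos y).le (sub_nonpos.2 (H.monotone (le_of_lt hy)))

lemma density_le (H : IsSteinDensity h h' p F) (x : ℝ) : p x ≤ p 0 := by
  simpa [H.map_zero] using H.density_add_le 0 x

lemma cdf_sub_le (H : IsSteinDensity h h' p F) {x y : ℝ} (hxy : x ≤ y) :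
    F y - F x ≤ p 0 * (y - x) :=
  convex_univ.image_sub_le_mul_sub_of_deriv_le
    (fun x _ => (H.hasDerivAt_cdf x).continuousAt.continuousWithinAt)
    (fun x _ => (H.hasDerivAt_cdf x).differentiableAt.differentiableWithinAt)
    (fun x _ => (H.hasDerivAt_cdf x).deriv ▸ H.density_le x) x trivial y trivial hxy

lemma mul_one_sub_cdf_le (H : IsSteinDensity h h' p F) (x : ℝ) : h x * (1 - F x) ≤ p x := by
  have : h x * 1 ≤ p x + h x * F x :=
    le_of_tendsto (H.tendsto_atTop.const_mul (h x)) (.of_forall fun y => by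
      linarith [H.density_add_le x y, H.pos y])
  linarith

lemma neg_mul_cdf_le (H : IsSteinDensity h h' p F) (x : ℝ) : -h x * F x ≤ p x := by
  have : h x * 0 ≤ p x + h x * F x :=
    le_of_tendsto (H.tendsto_atBot.const_mul (h x)) (.of_forall fun y => by
      linarith [H.density_add_le x y, H.pos y])
  linarith

lemma abs_mul_cdf_le (H : IsSteinDensity h h' p F) (x : ℝ) :
    |h x| * (F x * (1 - F x)) ≤ p x := by
  have h0 := H.cdf_nonneg x
  have h1 := H.cdf_le_one x
  have hp := H.pos x
  rcases abs_cases (h x) with ⟨he, _⟩ | ⟨he, _⟩ <;> rw [he]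
  · nlinarith [H.mul_one_sub_cdf_le x]
  · nlinarith [H.neg_mul_cdf_le x]

lemma density_zero_mul_cdf_le (H : IsSteinDensity h h' p F) (x : ℝ) :
    p 0 * (F x * (1 - F x)) ≤ p x := by
  have h0 := H.cdf_nonneg x
  have h1 := H.cdf_le_one x
  have hp := H.pos x
  have hp0 := H.pos 0
  have hx := H.density_add_le x 0
  have z0 := H.cdf_nonneg 0
  have z1 := H.cdf_le_one 0
  rcases le_total 0 x with hx0 | hx0
  · have hh : 0 ≤ h x := H.map_zero ▸ H.monotone hx0
    suffices p 0 * (1 - F x) ≤ p x by nlinarith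
    rcases le_total (p 0) (h x) with hc | hc
    · nlinarith [H.mul_one_sub_cdf_le x]
    · nlinarith [H.monotone_cdf hx0]
  · have hh : h x ≤ 0 := H.map_zero ▸ H.monotone hx0
    suffices p 0 * F x ≤ p x by nlinarith
    rcases le_total (p 0) (-h x) with hc | hc
    · nlinarith [H.neg_mul_cdf_le x]
    · nlinarith [H.monotone_cdf hx0]

lemma steinSolution_nonneg (H : IsSteinDensity h h' p F) (z x : ℝ) :
    0 ≤ steinSolution p F z x := by
  refine div_nonneg ?_ (H.pos x).le
  have := H.cdf_nonneg x
  have := H.cdf_le_one x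
  have := H.cdf_nonneg z
  have := H.cdf_le_one z
  rcases le_total x z with hx | hx <;> simp only [hx, min_eq_left, min_eq_right] <;> nlinarith

lemma mul_steinSolution_le (H : IsSteinDensity h h' p F) {a x : ℝ} (ha : 0 ≤ a)
    (hax : a * (F x * (1 - F x)) ≤ p x) (z : ℝ) : a * steinSolution p F z x ≤ 1 := by
  rw [steinSolution, ← mul_div_assoc, div_le_one (H.pos x)]
  refine (mul_le_mul_of_nonneg_left ?_ ha).trans hax
  have := H.cdf_nonneg x
  have := H.cdf_le_one x
  rcases le_total x z with hx | hx <;> simp only [hx, min_eq_left, min_eq_right] <;>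
    nlinarith [H.monotone_cdf hx]

lemma max_mul_steinSolution_le (H : IsSteinDensity h h' p F) (z x : ℝ) :
    max (p 0) |h x| * steinSolution p F z x ≤ 1 := by
  rcases max_choice (p 0) |h x| with hm | hm <;> rw [hm]
  · exact H.mul_steinSolution_le (H.pos 0).le (H.density_zero_mul_cdf_le x) z
  · exact H.mul_steinSolution_le (abs_nonneg _) (H.abs_mul_cdf_le x) z

lemma abs_steinSolution_le (H : IsSteinDensity h h' p F) (z x : ℝ) :
    |steinSolution p F z x| ≤ 1 / p 0 := by
  rw [abs_of_nonneg (H.steinSolution_nonneg z x), le_div_iff₀' (H.pos 0)]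
  exact H.mul_steinSolution_le (H.pos 0).le (H.density_zero_mul_cdf_le x) z

lemma abs_mul_steinSolution_le (H : IsSteinDensity h h' p F) (z x : ℝ) :
    |h x * steinSolution p F z x| ≤ 1 := by
  rw [abs_mul, abs_of_nonneg (H.steinSolution_nonneg z x)]
  exact H.mul_steinSolution_le (abs_nonneg _) (H.abs_mul_cdf_le x) z

lemma continuous_steinSolution (H : IsSteinDensity h h' p F) (z : ℝ) :
    Continuous (steinSolution p F z) := by
  have hF : Continuous F := continuous_iff_continuousAt.2 fun x => (H.hasDerivAt_cdf x).continuousAt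
  have hp : Continuous p :=
    continuous_iff_continuousAt.2 fun x => (H.hasDerivAt_density x).continuousAt
  unfold steinSolution
  exact ((hF.comp (continuous_id.min continuous_const)).sub (hF.const_mul _)).div hp
    fun x => (H.pos x).ne'

lemma hasDerivWithinAt_steinSolution (H : IsSteinDensity h h' p F) (z x : ℝ) :
    HasDerivWithinAt (steinSolution p F z) (steinRightDeriv h p F z x) (Set.Ici x) x := by
  have hmin : HasDerivWithinAt (fun y => F (min y z)) (if x < z then p x else 0) (Set.Ici x) x := by
    split_ifs with hx
    · refine ((H.hasDerivAt_cdf x).congr_of_eventuallyEq ?_).hasDerivWithinAt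
      filter_upwards [Iio_mem_nhds hx] with y hy
      rw [min_eq_left (le_of_lt hy)]
    · refine (hasDerivWithinAt_const x _ (F z)).congr (fun y hy => ?_) ?_
      · rw [min_eq_right ((not_lt.1 hx).trans hy)]
      · rw [min_eq_right (not_lt.1 hx)]
  refine ((hmin.sub ((H.hasDerivAt_cdf x).const_mul (F z)).hasDerivWithinAt).div
    (H.hasDerivAt_density x).hasDerivWithinAt (H.pos x).ne').congr_deriv ?_
  have := (H.pos x).ne'
  unfold steinRightDeriv steinSolution
  split_ifs <;> simp only [Pi.sub_apply] <;> field_simp <;> ring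

lemma abs_steinRightDeriv_le (H : IsSteinDensity h h' p F) (z x : ℝ) :
    |steinRightDeriv h p F z x| ≤ 2 := by
  have h0 := H.cdf_nonneg z
  have h1 := H.cdf_le_one z
  have h2 := abs_le.1 (H.abs_mul_steinSolution_le z x)
  unfold steinRightDeriv
  split_ifs <;> exact abs_le.2 ⟨by linarith, by linarith⟩

/-- The constant in the growth condition on `h'` is nonnegative. -/
lemma growth_nonneg (H : IsSteinDensity h h' p F) {c : ℝ}
    (hc : ∀ x, 3 * |h' x| ≤ c * p 0 * max (p 0) |h x|) : 0 ≤ c := by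
  by_contra! hneg
  have hp := H.pos 0
  nlinarith [hc 0, abs_nonneg (h' 0), mul_pos hp (lt_max_of_lt_left hp : 0 < max (p 0) |h 0|)]

/-- Under the growth condition on `h'`, the function `h` varies slowly at scale `δ`. -/
lemma abs_le_of_abs_sub_le (H : IsSteinDensity h h' p F) {c δ w x : ℝ}
    (hc : ∀ x, 3 * |h' x| ≤ c * p 0 * max (p 0) |h x|) (hδ : p 0 * δ ≤ 1)
    (hcδ : p 0 * c * δ ≤ 1) (hx : |x - w| ≤ δ) :
    |h x| ≤ 3 / 2 * |h w| + p 0 * c / 3 := by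
  have hp := H.pos 0
  have hδ0 : 0 ≤ δ := (abs_nonneg _).trans hx
  have hc0 := H.growth_nonneg hc
  have hcont : Continuous h := continuous_iff_continuousAt.2 fun x => (H.hasDerivAt x).continuousAt
  have mem {y : ℝ} : y ∈ Set.Icc (w - δ) (w + δ) ↔ |y - w| ≤ δ := by
    rw [Set.mem_Icc, abs_le]
    constructor <;> rintro ⟨_, _⟩ <;> constructor <;> linarith
  obtain ⟨y, hy, hmaxy⟩ := isCompact_Icc.exists_isMaxOn (s := Set.Icc (w - δ) (w + δ))
    ⟨x, mem.2 hx⟩ hcont.abs.continuousOn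
  refine (hmaxy (mem.2 hx)).trans ?_
  have hinc : |h y - h w| ≤ c * p 0 / 3 * max (p 0) |h y| * |y - w| :=
    (convex_Icc (w - δ) (w + δ)).norm_image_sub_le_of_norm_hasDerivWithin_le
      (fun u _ => (H.hasDerivAt u).hasDerivWithinAt)
      (fun u hu => by
        have h1 : max (p 0) |h u| ≤ max (p 0) |h y| := max_le_max le_rfl (hmaxy hu)
        have h2 := mul_le_mul_of_nonneg_left h1 (mul_nonneg hc0 hp.le)
        rw [Real.norm_eq_abs]
        linarith [hc u])
      (mem.2 (by simpa using hδ0)) hy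
  have htri : |h y| ≤ |h w| + |h y - h w| := by
    have := abs_add_le (h w) (h y - h w)
    rwa [add_sub_cancel] at this
  have hm0 : 0 ≤ max (p 0) |h y| := hp.le.trans (le_max_left _ _)
  have hinc2 : |h y - h w| ≤ c * p 0 / 3 * max (p 0) |h y| * δ :=
    hinc.trans (mul_le_mul_of_nonneg_left (mem.1 hy) (by positivity))
  have hw := abs_nonneg (h w)
  rcases max_choice (p 0) |h y| with hm | hm <;> rw [hm] at hinc2
  · have : c * p 0 / 3 * p 0 * δ ≤ p 0 * c / 3 := by
      have := mul_le_mul_of_nonneg_left hδ (by positivity : 0 ≤ p 0 * c / 3)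
      linarith
    linarith
  · have : c * p 0 / 3 * |h y| * δ ≤ |h y| / 3 := by
      have := mul_le_mul_of_nonneg_left hcδ (by positivity : 0 ≤ |h y| / 3)
      linarith
    have : 0 ≤ p 0 * c / 3 := by positivity
    linarith

lemma abs_mul_steinSolution_sub_le (H : IsSteinDensity h h' p F) {c δ w x y : ℝ} (z : ℝ)
    (hc : ∀ x, 3 * |h' x| ≤ c * p 0 * max (p 0) |h x|) (hδ : p 0 * δ ≤ 1)
    (hcδ : p 0 * c * δ ≤ 1) (hx : |x - w| ≤ δ) (hy : |y - w| ≤ δ) (hxy : x ≤ y) :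
    |h y * steinSolution p F z y - h x * steinSolution p F z x| ≤
      (3 * |h w| + p 0 * c) * (y - x) := by
  have hcont : Continuous h := continuous_iff_continuousAt.2 fun x => (H.hasDerivAt x).continuousAt
  have hderiv (u : ℝ) := (H.hasDerivAt u).hasDerivWithinAt.mul
    (H.hasDerivWithinAt_steinSolution z u)
  refine norm_image_sub_le_of_norm_deriv_right_le_segment
    (f := fun u => h u * steinSolution p F z u)
    (hcont.mul (H.continuous_steinSolution z)).continuousOn
    (fun u _ => hderiv u) (fun u hu => ?_) y ⟨hxy, le_rfl⟩
  have hu : |u - w| ≤ δ := by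
    rw [abs_le] at hx hy ⊢
    constructor <;> linarith [hu.1, hu.2]
  have h1 := H.abs_le_of_abs_sub_le hc hδ hcδ hu
  have h2 := H.abs_steinRightDeriv_le z u
  have h3 : |h u * steinRightDeriv h p F z u| ≤ (3 / 2 * |h w| + p 0 * c / 3) * 2 := by
    rw [abs_mul]
    exact mul_le_mul h1 h2 (abs_nonneg _) ((abs_nonneg _).trans h1)
  have hp := H.pos 0
  have hs := H.steinSolution_nonneg z u
  have h4 : |h' u * steinSolution p F z u| ≤ p 0 * c / 3 := by
    rw [abs_mul, abs_of_nonneg hs]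
    have hc0 := H.growth_nonneg hc
    have h5 := mul_le_mul_of_nonneg_right (hc u) hs
    have h6 := mul_le_mul_of_nonneg_left (H.max_mul_steinSolution_le z u) (mul_nonneg hc0 hp.le)
    linarith
  rw [Real.norm_eq_abs]
  refine (abs_add_le _ _).trans ?_
  linarith

/-- Two-sided expansion of the increment of the Stein solution over a step of length at
most `δ`. -/
lemma mul_steinSolution_sub_mem (H : IsSteinDensity h h' p F) {c δ w w' : ℝ} (z : ℝ)
    (hc : ∀ x, 3 * |h' x| ≤ c * p 0 * max (p 0) |h x|) (hδ : p 0 * δ ≤ 1)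
    (hcδ : p 0 * c * δ ≤ 1) (hw : |w - w'| ≤ δ) :
    (w - w') ^ 2 * (h w * steinSolution p F z w + (if w ≤ z - δ then 1 else 0) - F z) -
        δ ^ 3 * (3 * |h w| + p 0 * c) ≤
      (w - w') * (steinSolution p F z w - steinSolution p F z w') ∧
    (w - w') * (steinSolution p F z w - steinSolution p F z w') ≤
      (w - w') ^ 2 * (h w * steinSolution p F z w + (if w ≤ z + δ then 1 else 0) - F z) +
        δ ^ 3 * (3 * |h w| + p 0 * c) := by
  set f := steinSolution p F z with hf
  have hδ0 : 0 ≤ δ := (abs_nonneg _).trans hw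
  have hp := H.pos 0
  have hc0 := H.growth_nonneg hc
  set S := 3 * |h w| + p 0 * c
  have hS0 : 0 ≤ S := by positivity
  set l := h w * f w + (if w ≤ z - δ then 1 else 0) - F z with hl
  set u := h w * f w + (if w ≤ z + δ then 1 else 0) - F z with hu
  have hD {x : ℝ} (hx : |x - w| ≤ δ) (hxz : x < w + δ) : l - S * δ ≤ steinRightDeriv h p F z x ∧
      steinRightDeriv h p F z x ≤ u + S * δ := by
    have hvar : |h x * f x - h w * f w| ≤ S * δ := by
      rcases le_total x w with hxw | hxw
      · rw [abs_sub_comm]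
        refine (H.abs_mul_steinSolution_sub_le z hc hδ hcδ hx (by simpa using hδ0) hxw).trans ?_
        exact mul_le_mul_of_nonneg_left (by linarith [(abs_le.1 hx).1]) hS0
      · refine (H.abs_mul_steinSolution_sub_le z hc hδ hcδ (by simpa using hδ0) hx hxw).trans ?_
        exact mul_le_mul_of_nonneg_left (by linarith [(abs_le.1 hx).2]) hS0
    have h1 := abs_le.1 hvar
    have h2 := abs_le.1 hx
    simp only [steinRightDeriv, hl, hu, ← hf]
    constructor
    · split_ifs <;> linarith
    · split_ifs <;> linarith
  have key {a b : ℝ} (hab : a ≤ b) (hmem : ∀ x ∈ Set.Ico a b, |x - w| ≤ δ ∧ x < w + δ) :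
      (l - S * δ) * (b - a) ≤ f b - f a ∧ f b - f a ≤ (u + S * δ) * (b - a) := by
    have hcf := (H.continuous_steinSolution z).continuousOn (s := Set.Icc a b)
    have hdl (s x : ℝ) : HasDerivWithinAt (fun y => f a + s * (y - a)) s (Set.Ici x) x := by
      simpa using ((((hasDerivAt_id x).sub_const a).const_mul s).const_add (f a)).hasDerivWithinAt
    have hcl (s : ℝ) : ContinuousOn (fun y => f a + s * (y - a)) (Set.Icc a b) := by fun_prop
    have h1 := image_le_of_deriv_right_le_deriv_boundary (hcl (l - S * δ))
      (fun x _ => hdl (l - S * δ) x) (by simp [hf]) hcf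
      (fun x _ => H.hasDerivWithinAt_steinSolution z x)
      (fun x hx => (hD (hmem x hx).1 (hmem x hx).2).1) ⟨hab, le_rfl⟩
    have h2 := image_le_of_deriv_right_le_deriv_boundary hcf
      (fun x _ => H.hasDerivWithinAt_steinSolution z x) (by simp [hf]) (hcl (u + S * δ))
      (fun x _ => hdl (u + S * δ) x)
      (fun x hx => (hD (hmem x hx).1 (hmem x hx).2).2) ⟨hab, le_rfl⟩
    constructor <;> linarith
  have hw2 := abs_le.1 hw
  have hsq : (w - w') ^ 2 * (S * δ) ≤ δ ^ 3 * S := by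
    have := mul_le_mul_of_nonneg_right (sq_le_sq' hw2.1 hw2.2) (mul_nonneg hS0 hδ0)
    linarith
  rcases le_total w w' with hww | hww
  · obtain ⟨h1, h2⟩ := key hww fun x hx => by
      refine ⟨abs_le.2 ⟨?_, ?_⟩, ?_⟩ <;> linarith [hx.1, hx.2]
    have h3 := mul_le_mul_of_nonneg_right h1 (sub_nonneg.2 hww)
    have h4 := mul_le_mul_of_nonneg_right h2 (sub_nonneg.2 hww)
    constructor <;> linarith
  · obtain ⟨h1, h2⟩ := key hww fun x hx => by
      refine ⟨abs_le.2 ⟨?_, ?_⟩, ?_⟩ <;> linarith [hx.1, hx.2]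
    have h3 := mul_le_mul_of_nonneg_right h1 (sub_nonneg.2 hww)
    have h4 := mul_le_mul_of_nonneg_right h2 (sub_nonneg.2 hww)
    constructor <;> linarith

end IsSteinDensity

section Exchangeable

variable {Ω : Type*} [MeasurableSpace Ω] {μ : Measure Ω} {W W' : Ω → ℝ}

/-- The conditional expectation given `W` may be tested against bounded functions of `W`. -/
lemma integral_condExp_comap_mul [IsProbabilityMeasure μ] {X : Ω → ℝ} (hW : Measurable W)
    (hX : Integrable X μ) {f : ℝ → ℝ} {A : ℝ} (hf : Measurable f) (hfA : ∀ x, |f x| ≤ A) :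
    ∫ ω, μ[X | MeasurableSpace.comap W (borel ℝ)] ω * f (W ω) ∂μ = ∫ ω, X ω * f (W ω) ∂μ := by
  have hm : MeasurableSpace.comap W (borel ℝ) ≤ ‹MeasurableSpace Ω› := hW.comap_le
  have hfm : StronglyMeasurable[MeasurableSpace.comap W (borel ℝ)] fun ω => f (W ω) :=
    hf.stronglyMeasurable.comp_measurable (comap_measurable W)
  have hXf : Integrable (X * fun ω => f (W ω)) μ :=
    hX.mul_bdd (hf.comp hW).aestronglyMeasurable (.of_forall fun ω => hfA (W ω))
  exact (integral_congr_ae (condExp_mul_of_stronglyMeasurable_right hfm hXf hX)).symm.trans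
    (integral_condExp hm)

lemma integral_sub_mul_sub_of_exchangeable (hW : Measurable W) (hW' : Measurable W')
    (hWint : Integrable W μ) (hW'int : Integrable W' μ)
    (hexch : μ.map (fun ω => (W ω, W' ω)) = μ.map (fun ω => (W' ω, W ω)))
    {f : ℝ → ℝ} {A : ℝ} (hf : Measurable f) (hfA : ∀ x, |f x| ≤ A) :
    ∫ ω, (W ω - W' ω) * (f (W ω) - f (W' ω)) ∂μ = 2 * ∫ ω, (W ω - W' ω) * f (W ω) ∂μ := by
  have hint (U : Ω → ℝ) (hU : Measurable U) : Integrable (fun ω => (W ω - W' ω) * f (U ω)) μ :=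
    (hWint.sub hW'int).mul_bdd (hf.comp hU).aestronglyMeasurable (.of_forall fun ω => hfA (U ω))
  have hφ : Measurable fun q : ℝ × ℝ => (q.1 - q.2) * f q.1 := by fun_prop
  have hswap : ∫ ω, (W ω - W' ω) * f (W ω) ∂μ = ∫ ω, (W' ω - W ω) * f (W' ω) ∂μ := by
    have h1 := integral_map (μ := μ) (hW.prodMk hW').aemeasurable hφ.aestronglyMeasurable
    have h2 := integral_map (μ := μ) (hW'.prodMk hW).aemeasurable hφ.aestronglyMeasurable
    rw [← h1, hexch, h2]
  have hneg : ∫ ω, (W' ω - W ω) * f (W' ω) ∂μ = -∫ ω, (W ω - W' ω) * f (W' ω) ∂μ := by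
    rw [← integral_neg]
    exact integral_congr_ae (.of_forall fun ω => by ring)
  have hsub : ∫ ω, (W ω - W' ω) * (f (W ω) - f (W' ω)) ∂μ =
      ∫ ω, (W ω - W' ω) * f (W ω) ∂μ - ∫ ω, (W ω - W' ω) * f (W' ω) ∂μ := by
    rw [← integral_sub (hint W hW) (hint W' hW')]
    exact integral_congr_ae (.of_forall fun ω => by ring)
  linarith

/-- The exchangeable pair identity, combined with a pointwise lower bound on the increments of a
test function `f`. -/
lemma integral_le_of_sq_mul_le [IsProbabilityMeasure μ] (hW : Measurable W) (hW' : Measurable W')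
    (hWint : Integrable W μ) (hW'int : Integrable W' μ)
    (hexch : μ.map (fun ω => (W ω, W' ω)) = μ.map (fun ω => (W' ω, W ω)))
    {k : Ω → ℝ}
    (hcond : μ[fun ω => W ω - W' ω | MeasurableSpace.comap W (borel ℝ)] =ᵐ[μ] k)
    {δ c₀ : ℝ} (hδ : ∀ ω, |W ω - W' ω| ≤ δ) (hc₀ : 0 < c₀) {f ψ S : ℝ → ℝ} {A B : ℝ}
    (hf : Measurable f) (hfA : ∀ x, |f x| ≤ A) (hψ : Measurable ψ) (hψB : ∀ x, |ψ x| ≤ B)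
    (hS : Integrable (fun ω => S (W ω)) μ)
    (hle : ∀ w w', |w - w'| ≤ δ →
      (w - w') ^ 2 * ψ w ≤ (w - w') * (f w - f w') + δ ^ 3 * S w) :
    ∫ ω, ψ (W ω) ∂μ ≤ c₀ * ∫ ω, k ω * f (W ω) ∂μ +
      B * ∫ ω, |1 - c₀ / 2 * (μ[fun ω' => (W ω' - W' ω') ^ 2
        | MeasurableSpace.comap W (borel ℝ)]) ω| ∂μ + c₀ / 2 * δ ^ 3 * ∫ ω, S (W ω) ∂μ := by
  set V := μ[fun ω' => (W ω' - W' ω') ^ 2 | MeasurableSpace.comap W (borel ℝ)]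
  have hψW : AEStronglyMeasurable (fun ω => ψ (W ω)) μ := (hψ.comp hW).aestronglyMeasurable
  have hψb : ∀ᵐ ω ∂μ, ‖ψ (W ω)‖ ≤ B := .of_forall fun ω => hψB (W ω)
  have hsq : Integrable (fun ω => (W ω - W' ω) ^ 2) μ :=
    .of_bound ((hW.sub hW').pow_const 2).aestronglyMeasurable (δ ^ 2) (.of_forall fun ω => by
      rw [Real.norm_eq_abs, abs_pow]
      exact pow_le_pow_left₀ (abs_nonneg _) (hδ ω) 2)
  have hVint : Integrable V μ := integrable_condExp
  have hVψ : Integrable (fun ω => V ω * ψ (W ω)) μ := hVint.mul_bdd hψW hψb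
  have hD : Integrable (fun ω => 1 - c₀ / 2 * V ω) μ :=
    (integrable_const 1).sub (hVint.const_mul _)
  have hff : Integrable (fun ω => (W ω - W' ω) * (f (W ω) - f (W' ω))) μ := by
    refine (hWint.sub hW'int).mul_bdd (c := A + A)
      ((hf.comp hW).sub (hf.comp hW')).aestronglyMeasurable (.of_forall fun ω => ?_)
    exact (norm_sub_le _ _).trans (add_le_add (hfA _) (hfA _))
  have h1 : ∫ ω, ψ (W ω) ∂μ =
      ∫ ω, (1 - c₀ / 2 * V ω) * ψ (W ω) ∂μ + c₀ / 2 * ∫ ω, V ω * ψ (W ω) ∂μ := by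
    rw [← integral_const_mul, ← integral_add (hD.mul_bdd hψW hψb) (hVψ.const_mul _)]
    exact integral_congr_ae (.of_forall fun ω => by ring)
  have h2 : ∫ ω, (1 - c₀ / 2 * V ω) * ψ (W ω) ∂μ ≤ B * ∫ ω, |1 - c₀ / 2 * V ω| ∂μ := by
    rw [← integral_const_mul]
    refine integral_mono (hD.mul_bdd hψW hψb) (hD.abs.const_mul B) fun ω => ?_
    refine (le_abs_self _).trans ?_
    rw [abs_mul, mul_comm B]
    exact mul_le_mul_of_nonneg_left (hψB _) (abs_nonneg _)
  have h3 : ∫ ω, V ω * ψ (W ω) ∂μ ≤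
      ∫ ω, (W ω - W' ω) * (f (W ω) - f (W' ω)) ∂μ + δ ^ 3 * ∫ ω, S (W ω) ∂μ := by
    rw [integral_condExp_comap_mul hW hsq hψ hψB, ← integral_const_mul,
      ← integral_add hff (hS.const_mul _)]
    exact integral_mono (hsq.mul_bdd hψW hψb) (hff.add (hS.const_mul _))
      fun ω => hle _ _ (hδ ω)
  have h4 : ∫ ω, (W ω - W' ω) * f (W ω) ∂μ = ∫ ω, k ω * f (W ω) ∂μ := by
    refine (integral_condExp_comap_mul hW (hWint.sub hW'int) hf hfA).symm.trans ?_
    refine integral_congr_ae ?_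
    filter_upwards [hcond] with ω hω
    exact congrArg (· * f (W ω)) hω
  rw [integral_sub_mul_sub_of_exchangeable hW hW' hWint hW'int hexch hf hfA, h4] at h3
  have h5 := mul_le_mul_of_nonneg_left h3 (by positivity : 0 ≤ c₀ / 2)
  linarith

end Exchangeable

/-- The density `t ↦ c₁ exp (-c₀ ∫₀ᵗ g)` and the distribution function of its law satisfy
`IsSteinDensity`. -/
lemma isSteinDensity_exp {g g' : ℝ → ℝ} {c₀ c₁ : ℝ} (hg' : ∀ x, HasDerivAt g (g' x) x)
    (hc₀ : 0 < c₀) (hc₁ : 0 < c₁) (hmono : Monotone g) (hg0 : g 0 = 0)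
    (hpInt : Integrable (fun t => Real.exp (-(c₀ * ∫ s in (0:ℝ)..t, g s))))
    {ν : Measure ℝ} [IsProbabilityMeasure ν]
    (hν : ν = volume.withDensity
      (fun t => ENNReal.ofReal (c₁ * Real.exp (-(c₀ * ∫ s in (0:ℝ)..t, g s))))) :
    IsSteinDensity (fun x => c₀ * g x) (fun x => c₀ * g' x)
      (fun t => c₁ * Real.exp (-(c₀ * ∫ s in (0:ℝ)..t, g s))) (fun x => ν.real (Set.Iic x)) := by
  set p := fun t => c₁ * Real.exp (-(c₀ * ∫ s in (0:ℝ)..t, g s)) with hp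
  have hgc : Continuous g := continuous_iff_continuousAt.2 fun x => (hg' x).continuousAt
  have hdp (x : ℝ) : HasDerivAt p (-(c₀ * g x * p x)) x :=
    ((((hgc.integral_hasStrictDerivAt 0 x).hasDerivAt.const_mul c₀).neg.exp).const_mul
      c₁).congr_deriv (by simp only [hp, Pi.neg_apply]; ring)
  have hpc : Continuous p := continuous_iff_continuousAt.2 fun x => (hdp x).continuousAt
  have hpi : Integrable p := hpInt.const_mul c₁
  have hp0 (x : ℝ) : 0 < p x := by positivity
  have hF (x : ℝ) : ν.real (Set.Iic x) = (∫ t in Set.Iic 0, p t) + ∫ t in (0:ℝ)..x, p t := by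
    rw [← intervalIntegral.integral_Iic_sub_Iic hpi.integrableOn hpi.integrableOn,
      add_sub_cancel, measureReal_def, hν, withDensity_apply _ measurableSet_Iic,
      ← ofReal_integral_eq_lintegral_ofReal hpi.integrableOn (.of_forall fun t => (hp0 t).le),
      ENNReal.toReal_ofReal (integral_nonneg fun t => (hp0 t).le)]
  refine ⟨fun x y hxy => mul_le_mul_of_nonneg_left (hmono hxy) hc₀.le, by simp [hg0],
    fun x => (hg' x).const_mul c₀, hp0, hdp, fun x => ?_, ?_, ?_⟩
  · simp only [hF]
    exact (hpc.integral_hasStrictDerivAt 0 x).hasDerivAt.const_add _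
  · exact (ProbabilityTheory.tendsto_cdf_atBot ν).congr (ProbabilityTheory.cdf_eq_real ν)
  · exact (ProbabilityTheory.tendsto_cdf_atTop ν).congr (ProbabilityTheory.cdf_eq_real ν)

/-- **Theorem 1.2** (Chatterjee–Shao). Berry–Esseen type bound for non-normal approximation by
Stein's method of exchangeable pairs, when |W - W'| ≤ δ, under hypotheses (H1) and (H3). -/
theorem exchangeable_pair_nonnormal_berry_esseen
    {Ω : Type*} [MeasurableSpace Ω] {μ : Measure Ω} [IsProbabilityMeasure μ]
    (W W' Y : Ω → ℝ) (hWmeas : Measurable W) (hW'meas : Measurable W')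
    (hYmeas : Measurable Y)
    (hWint : Integrable W μ) (hW'int : Integrable W' μ)
    -- (W, W') is an exchangeable pair
    (hexch : μ.map (fun ω => (W ω, W' ω)) = μ.map (fun ω => (W' ω, W ω)))
    -- E(W - W' | W) = g(W) + r(W), with g differentiable with derivative g'
    (g g' r : ℝ → ℝ) (hg' : ∀ x, HasDerivAt g (g' x) x)
    (hcond : μ[fun ω => W ω - W' ω | MeasurableSpace.comap W (borel ℝ)]
      =ᵐ[μ] fun ω => g (W ω) + r (W ω))
    -- |W - W'| ≤ δ
    (δ : ℝ) (hδ : ∀ ω, |W ω - W' ω| ≤ δ)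
    -- the constants c₀ and c₁ and the density p(t) = c₁ exp(-c₀ G(t)), G(t) = ∫₀ᵗ g
    (c₀ c₁ c₃ : ℝ) (hc₀ : 0 < c₀) (hc₁pos : 0 < c₁)
    (hpInt : Integrable (fun t => Real.exp (-(c₀ * ∫ s in (0:ℝ)..t, g s))))
    (hc₁ : c₁ = (∫ t : ℝ, Real.exp (-(c₀ * ∫ s in (0:ℝ)..t, g s)))⁻¹)
    -- Y has probability density p
    (hYdens : μ.map Y
      = volume.withDensity
          (fun t => ENNReal.ofReal (c₁ * Real.exp (-(c₀ * ∫ s in (0:ℝ)..t, g s)))))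
    -- Hypothesis (H1)
    (hmono : Monotone g) (hgpos : ∀ t, 0 < t → 0 ≤ g t) (hgneg : ∀ t, t ≤ 0 → g t ≤ 0)
    -- Hypothesis (H3), with 1/|c₀ g(x)| read as +∞ when g(x) = 0
    (hH3 : ∀ x, (if g x = 0 then 1 / c₁ else min (1 / c₁) (1 / |c₀ * g x|))
        * (|x| + 3 / c₁) * (c₀ * |g' x|) ≤ c₃)
    -- moment assumptions: E|g(W)| < ∞ and E|r(W)| < ∞
    (hgInt : Integrable (fun ω => g (W ω)) μ)
    (hrInt : Integrable (fun ω => r (W ω)) μ)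
    (z : ℝ) :
    |(μ {ω | W ω ≤ z}).toReal - (μ {ω | Y ω ≤ z}).toReal|
      ≤ 3 * ∫ ω, |1 - c₀ / 2
            * (μ[fun ω' => (W ω' - W' ω') ^ 2
                | MeasurableSpace.comap W (borel ℝ)]) ω| ∂μ
        + c₁ * max 1 c₃ * δ
        + 2 * c₀ * (∫ ω, |r (W ω)| ∂μ) / c₁
        + δ ^ 3 * c₀ * ((2 + c₃ / 2) * (∫ ω, |c₀ * g (W ω)| ∂μ) + c₁ * c₃ / 2) := by
  have hgc : Continuous g := continuous_iff_continuousAt.2 fun x => (hg' x).continuousAt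
  have hg0 : g 0 = 0 := by
    refine le_antisymm (hgneg 0 le_rfl) (ge_of_tendsto (hgc.continuousWithinAt (s := Set.Ioi 0)) ?_)
    filter_upwards [self_mem_nhdsWithin] with t ht using hgpos t ht
  have : IsProbabilityMeasure (μ.map Y) := Measure.isProbabilityMeasure_map hYmeas.aemeasurable
  set p := fun t => c₁ * Real.exp (-(c₀ * ∫ s in (0:ℝ)..t, g s)) with hp
  set F := fun x => (μ.map Y).real (Set.Iic x) with hF
  have H : IsSteinDensity (fun x => c₀ * g x) (fun x => c₀ * g' x) p F :=
    isSteinDensity_exp hg' hc₀ hc₁pos hmono hg0 hpInt hYdens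
  have hp0 : p 0 = c₁ := by simp [hp]
  have hFz : (μ {ω | Y ω ≤ z}).toReal = F z := by
    simp only [hF, measureReal_def]
    rw [Measure.map_apply hYmeas measurableSet_Iic]
    rfl
  have hmeasW (y : ℝ) : MeasurableSet {ω | W ω ≤ y} := measurableSet_le hWmeas measurable_const
  have hδ0 : 0 ≤ δ := by
    obtain ⟨ω⟩ := nonempty_of_isProbabilityMeasure μ
    exact (abs_nonneg _).trans (hδ ω)
  have hc₃ : 0 ≤ c₃ := by
    refine le_trans ?_ (hH3 0)
    split_ifs
    positivity
  rw [hFz]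
  set V := μ[fun ω' => (W ω' - W' ω') ^ 2 | MeasurableSpace.comap W (borel ℝ)]
  have hI1 : 0 ≤ ∫ ω, |1 - c₀ / 2 * V ω| ∂μ := integral_nonneg fun ω => abs_nonneg _
  have hI2 : 0 ≤ ∫ ω, |r (W ω)| ∂μ := integral_nonneg fun ω => abs_nonneg _
  have hI3 : 0 ≤ ∫ ω, |c₀ * g (W ω)| ∂μ := integral_nonneg fun ω => abs_nonneg _
  have hrnn : 0 ≤ 2 * c₀ * (∫ ω, |r (W ω)| ∂μ) / c₁ := by positivity
  have hdnn : 0 ≤ δ ^ 3 * c₀ * ((2 + c₃ / 2) * (∫ ω, |c₀ * g (W ω)| ∂μ) + c₁ * c₃ / 2) := by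
    positivity
  rcases le_total 1 (c₁ * max 1 c₃ * δ) with hbig | hsmall
  · have h1 : |(μ {ω | W ω ≤ z}).toReal - F z| ≤ 1 := by
      have h2 : (μ {ω | W ω ≤ z}).toReal ≤ 1 := measureReal_le_one
      have h3 : 0 ≤ (μ {ω | W ω ≤ z}).toReal := ENNReal.toReal_nonneg
      rw [abs_le]
      constructor <;> linarith [H.cdf_nonneg z, H.cdf_le_one z]
    linarith
  have hmax1 : c₁ * δ ≤ c₁ * max 1 c₃ * δ := by
    refine mul_le_mul_of_nonneg_right ?_ hδ0
    exact le_mul_of_one_le_right hc₁pos.le (le_max_left _ _)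
  have hδ1 : p 0 * δ ≤ 1 := hp0 ▸ hmax1.trans hsmall
  have hδ3 : p 0 * c₃ * δ ≤ 1 := by
    rw [hp0]
    refine le_trans ?_ hsmall
    gcongr
    exact le_max_right _ _
  have hgrowth (x : ℝ) : 3 * |c₀ * g' x| ≤ c₃ * p 0 * max (p 0) |c₀ * g x| := by
    rw [hp0, abs_mul, abs_of_pos hc₀]
    have hm : 0 < max c₁ |c₀ * g x| := lt_max_of_lt_left hc₁pos
    have h1 : (if g x = 0 then 1 / c₁ else min (1 / c₁) (1 / |c₀ * g x|)) =
        1 / max c₁ |c₀ * g x| := by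
      split_ifs with hgx
      · simp [hgx, hc₁pos.le]
      · have : 0 < |c₀ * g x| := abs_pos.2 (mul_ne_zero hc₀.ne' hgx)
        rcases le_total c₁ |c₀ * g x| with hle | hle
        · rw [max_eq_right hle, min_eq_right (one_div_le_one_div_of_le hc₁pos hle)]
        · rw [max_eq_left hle, min_eq_left (one_div_le_one_div_of_le this hle)]
    have h2 := hH3 x
    rw [h1] at h2
    have h3 : 1 / max c₁ |c₀ * g x| * (3 / c₁) * (c₀ * |g' x|) ≤ c₃ := by
      refine le_trans ?_ h2
      gcongr
      linarith [abs_nonneg x]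
    calc 3 * (c₀ * |g' x|) = 1 / max c₁ |c₀ * g x| * (3 / c₁) * (c₀ * |g' x|) *
          (c₁ * max c₁ |c₀ * g x|) := by field_simp
      _ ≤ c₃ * (c₁ * max c₁ |c₀ * g x|) := by gcongr
      _ = c₃ * c₁ * max c₁ |c₀ * g x| := by ring
  set S := fun w => 3 * |c₀ * g w| + p 0 * c₃ with hS
  have hhint : Integrable (fun ω => |c₀ * g (W ω)|) μ := (hgInt.const_mul c₀).abs
  have hSint : Integrable (fun ω => S (W ω)) μ := (hhint.const_mul 3).add (integrable_const _)
  have hSval : ∫ ω, S (W ω) ∂μ = 3 * (∫ ω, |c₀ * g (W ω)| ∂μ) + c₁ * c₃ := by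
    simp only [hS]
    rw [integral_add (hhint.const_mul 3) (integrable_const _), integral_const_mul]
    simp [hp0]
  have hrem : c₀ / 2 * δ ^ 3 * ∫ ω, S (W ω) ∂μ ≤
      δ ^ 3 * c₀ * ((2 + c₃ / 2) * (∫ ω, |c₀ * g (W ω)| ∂μ) + c₁ * c₃ / 2) := by
    rw [hSval]
    have : 0 ≤ δ ^ 3 * c₀ * ((1 / 2 + c₃ / 2) * ∫ ω, |c₀ * g (W ω)| ∂μ) := by positivity
    linarith
  have hfm (u : ℝ) : Measurable (steinSolution p F u) := (H.continuous_steinSolution u).measurable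
  set ψ := fun u y w => c₀ * g w * steinSolution p F u w + (if w ≤ y then 1 else 0) - F u with hψ
  have hψm (u y : ℝ) : Measurable (ψ u y) :=
    (((measurable_const.mul hgc.measurable).mul (hfm u)).add
      (Measurable.ite measurableSet_Iic measurable_const measurable_const)).sub measurable_const
  have hψB (u y w : ℝ) : |ψ u y w| ≤ 2 := by
    have h1 := abs_le.1 (H.abs_mul_steinSolution_le u w)
    have h2 := H.cdf_nonneg u
    have h3 := H.cdf_le_one u
    simp only [hψ]
    rw [abs_le]
    split_ifs <;> constructor <;> linarith
  have hbdd {k : Ω → ℝ} (hk : Integrable k μ) (u : ℝ) :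
      Integrable (fun ω => k ω * steinSolution p F u (W ω)) μ :=
    hk.mul_bdd ((hfm u).comp hWmeas).aestronglyMeasurable
      (.of_forall fun ω => H.abs_steinSolution_le u (W ω))
  have hψint (u y : ℝ) : ∫ ω, ψ u y (W ω) ∂μ =
      ∫ ω, c₀ * g (W ω) * steinSolution p F u (W ω) ∂μ + (μ {ω | W ω ≤ y}).toReal - F u := by
    have hind : Integrable (fun ω => if W ω ≤ y then (1 : ℝ) else 0) μ :=
      (integrable_const 1).indicator (hmeasW y)
    have hindv : ∫ ω, (if W ω ≤ y then (1 : ℝ) else 0) ∂μ = (μ {ω | W ω ≤ y}).toReal :=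
      integral_indicator_one (hmeasW y)
    have hsum := (hbdd (hgInt.const_mul c₀) u).add hind
    simp only [Pi.add_def] at hsum
    simp only [hψ]
    rw [integral_sub hsum (integrable_const _),
      integral_add (hbdd (hgInt.const_mul c₀) u) hind, hindv]
    simp
  have hkf (u : ℝ) : c₀ * ∫ ω, (g (W ω) + r (W ω)) * steinSolution p F u (W ω) ∂μ =
      ∫ ω, c₀ * g (W ω) * steinSolution p F u (W ω) ∂μ +
        c₀ * ∫ ω, r (W ω) * steinSolution p F u (W ω) ∂μ := by
    rw [← integral_const_mul, ← integral_const_mul,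
      ← integral_add (hbdd (hgInt.const_mul c₀) u) ((hbdd hrInt u).const_mul c₀)]
    exact integral_congr_ae (.of_forall fun ω => by ring)
  have hrf (u : ℝ) : |c₀ * ∫ ω, r (W ω) * steinSolution p F u (W ω) ∂μ| ≤
      2 * c₀ * (∫ ω, |r (W ω)| ∂μ) / c₁ := by
    have h1 : |∫ ω, r (W ω) * steinSolution p F u (W ω) ∂μ| ≤ (∫ ω, |r (W ω)| ∂μ) * (1 / c₁) := by
      rw [← integral_mul_const]
      refine abs_integral_le_integral_abs.trans
        (integral_mono (hbdd hrInt u).abs (hrInt.abs.mul_const _) fun ω => ?_)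
      simp only [abs_mul]
      exact mul_le_mul_of_nonneg_left (hp0 ▸ H.abs_steinSolution_le u (W ω)) (abs_nonneg _)
    rw [abs_mul, abs_of_pos hc₀]
    calc c₀ * |∫ ω, r (W ω) * steinSolution p F u (W ω) ∂μ|
        ≤ c₀ * ((∫ ω, |r (W ω)| ∂μ) * (1 / c₁)) := by gcongr
      _ = c₀ * (∫ ω, |r (W ω)| ∂μ) / c₁ := by ring
      _ ≤ 2 * c₀ * (∫ ω, |r (W ω)| ∂μ) / c₁ := by gcongr; linarith
  have hupper (u : ℝ) : (μ {ω | W ω ≤ u - δ}).toReal - F u ≤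
      2 * (∫ ω, |1 - c₀ / 2 * V ω| ∂μ) + 2 * c₀ * (∫ ω, |r (W ω)| ∂μ) / c₁ +
        c₀ / 2 * δ ^ 3 * ∫ ω, S (W ω) ∂μ := by
    have h1 := integral_le_of_sq_mul_le hWmeas hW'meas hWint hW'int hexch hcond hδ hc₀
      (hfm u) (H.abs_steinSolution_le u) (hψm u (u - δ)) (hψB u (u - δ)) hSint
      fun w w' hww => by
        linarith [(H.mul_steinSolution_sub_mem u hgrowth hδ1 hδ3 hww).1]
    rw [hψint, hkf] at h1
    linarith [(abs_le.1 (hrf u)).2]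
  have hlower (u : ℝ) : F u - (μ {ω | W ω ≤ u + δ}).toReal ≤
      2 * (∫ ω, |1 - c₀ / 2 * V ω| ∂μ) + 2 * c₀ * (∫ ω, |r (W ω)| ∂μ) / c₁ +
        c₀ / 2 * δ ^ 3 * ∫ ω, S (W ω) ∂μ := by
    have h1 := integral_le_of_sq_mul_le hWmeas hW'meas hWint hW'int hexch hcond hδ hc₀
      (f := fun x => -steinSolution p F u x) (ψ := fun x => -ψ u (u + δ) x)
      (hfm u).neg (fun x => (abs_neg _).trans_le (H.abs_steinSolution_le u x))
      (hψm u (u + δ)).neg (fun x => (abs_neg _).trans_le (hψB u (u + δ) x)) hSint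
      fun w w' hww => by
        linarith [(H.mul_steinSolution_sub_mem u hgrowth hδ1 hδ3 hww).2]
    simp only [mul_neg, integral_neg] at h1
    rw [hψint, hkf] at h1
    linarith [(abs_le.1 (hrf u)).1]
  have hup := hupper (z + δ)
  have hlo := hlower (z - δ)
  rw [add_sub_cancel_right] at hup
  rw [sub_add_cancel] at hlo
  have hF1 := H.cdf_sub_le (show z ≤ z + δ by linarith)
  have hF2 := H.cdf_sub_le (show z - δ ≤ z by linarith)
  rw [hp0, add_sub_cancel_left] at hF1
  rw [hp0, sub_sub_cancel] at hF2
  rw [abs_le]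
  constructor <;> linarith
end

section
/- There exists an absolute constant c such that the following holds: for every positive integer n, if W is distributed as W(σ) = n^{−3/4} Σ_{i=1}^n σ_i under the Curie-Weiss measure at critical temperature T = 1, and Y is a random variable with density p(w) = c₁ e^{−w⁴/12} where c₁ = 2^{1/2}/(3^{1/4} Γ(1/4)), then for all z ∈ ℝ, |P(W ≤ z) − P(Y ≤ z)| ≤ c·n^{−1/2}. -/
open MeasureTheory Finset

lemma log_one_sub_sub_log_one_add_le {x : ℝ} (h0 : 0 ≤ x) (h1 : x < 1) :
    Real.log (1 - x) - Real.log (1 + x) ≤ -(2 * x + 2 * x ^ 3 / 3) := by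
  have h := Real.hasSum_log_sub_log_of_abs_lt_one (abs_lt.2 ⟨by linarith, h1⟩)
  have h2 := sum_le_hasSum (Finset.range 2) (fun k _ => by positivity) h
  norm_num [Finset.sum_range_succ] at h2
  linarith

lemma le_log_one_sub_sub_log_one_add {x : ℝ} (h0 : 0 ≤ x) (h1 : x ≤ 1 / 2) :
    -(2 * x + 2 * x ^ 3 / 3 + x ^ 5) ≤ Real.log (1 - x) - Real.log (1 + x) := by
  let g : ℝ → ℝ := fun y => 2 * y + 2 * y ^ 3 / 3 + y ^ 5 + (Real.log (1 - y) - Real.log (1 + y))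
  have hd : ∀ y ∈ Set.Icc (0 : ℝ) (1 / 2),
      HasDerivAt g (2 + 2 * y ^ 2 + 5 * y ^ 4 + (-1 / (1 - y) - 1 / (1 + y))) y := by
    rintro y ⟨hy0, hy1⟩
    have e1 : HasDerivAt (fun y : ℝ => Real.log (1 - y)) (-1 / (1 - y)) y :=
      ((hasDerivAt_id y).const_sub 1).log (by simp only [id]; linarith)
    have e2 : HasDerivAt (fun y : ℝ => Real.log (1 + y)) (1 / (1 + y)) y :=
      ((hasDerivAt_id y).const_add 1).log (by simp only [id]; linarith)
    have e3 : HasDerivAt (fun y : ℝ => 2 * y + 2 * y ^ 3 / 3 + y ^ 5)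
        (2 + 2 * y ^ 2 + 5 * y ^ 4) y := by
      have := (((hasDerivAt_id y).const_mul 2).add
        ((((hasDerivAt_id y).pow 3).const_mul 2).div_const 3)).add ((hasDerivAt_id y).pow 5)
      refine this.congr_deriv ?_
      simp only [id]; norm_num; ring
    exact e3.add (e1.sub e2)
  have hm : MonotoneOn g (Set.Icc 0 (1 / 2)) := by
    refine monotoneOn_of_deriv_nonneg (convex_Icc _ _)
      (fun y hy => (hd y hy).continuousAt.continuousWithinAt)
      (fun y hy => (hd y (interior_subset hy)).differentiableAt.differentiableWithinAt) ?_
    intro y hy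
    have hy' := interior_subset hy
    rw [(hd y hy').deriv]
    obtain ⟨hy0, hy1⟩ := hy'
    have p1 : 0 < 1 - y := by linarith
    have p2 : 0 < 1 + y := by linarith
    have : 2 + 2 * y ^ 2 + 5 * y ^ 4 + (-1 / (1 - y) - 1 / (1 + y))
        = y ^ 4 * (3 - 5 * y ^ 2) / ((1 - y) * (1 + y)) := by
      field_simp; ring
    rw [this]
    have : 0 ≤ 3 - 5 * y ^ 2 := by nlinarith
    positivity
  have := hm (Set.left_mem_Icc.2 (by norm_num)) ⟨h0, h1⟩ h0
  simp only [g] at this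
  norm_num at this
  linarith

/-- The magnetization of a configuration of `n` spins, `k` of which are up. -/
noncomputable def mag (n k : ℕ) : ℝ := 2 * k - n

/-- The unnormalized Curie-Weiss weight of the event that `k` of `n` spins are up. -/
noncomputable def weight (n k : ℕ) : ℝ := n.choose k * Real.exp (mag n k ^ 2 / (2 * n))

/-- The main part of the logarithm of the weight of magnetization `s`. -/
noncomputable def energy (n s : ℝ) : ℝ :=
  s ^ 2 / (2 * n * (n + 1)) - (s ^ 4 - 2 * s ^ 2) / (12 * (n + 1) ^ 3)

/-- The logarithm of the weight after removal of its main part. -/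
noncomputable def resid (n k : ℕ) : ℝ := Real.log (weight n k) - energy n (mag n k)

lemma weight_pos {n k : ℕ} (hk : k ≤ n) : 0 < weight n k :=
  mul_pos (by exact_mod_cast Nat.choose_pos hk) (Real.exp_pos _)

lemma mag_symm {n k : ℕ} (hk : k ≤ n) : mag n (n - k) = -mag n k := by
  simp only [mag, Nat.cast_sub hk]; ring

lemma resid_symm {n k : ℕ} (hk : k ≤ n) : resid n (n - k) = resid n k := by
  simp only [resid, weight, energy, mag_symm hk, Nat.choose_symm hk, neg_sq,
    (show Even 4 by decide).neg_pow]

lemma resid_succ {n k : ℕ} (hk : k < n) {x : ℝ} (hx : x = (mag n k + 1) / (n + 1)) :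
    resid n (k + 1) - resid n k
      = Real.log (1 - x) - Real.log (1 + x) + (2 * x + 2 * x ^ 3 / 3) := by
  have hn : (0 : ℝ) < n := by exact_mod_cast (by omega : 0 < n)
  have hkn : (k : ℝ) < n := by exact_mod_cast hk
  have hN : (0 : ℝ) < n + 1 := by linarith
  have hk0 : (0 : ℝ) ≤ k := by positivity
  have e1 : 1 - x = (n - k) * (2 / (n + 1)) := by
    rw [hx]; unfold mag; field_simp; ring
  have e2 : 1 + x = (k + 1) * (2 / (n + 1)) := by
    rw [hx]; unfold mag; field_simp; ring
  have hc : (n.choose (k + 1) : ℝ) * (k + 1) = n.choose k * (n - k) := by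
    have := Nat.choose_succ_right_eq n k
    rw [← Nat.cast_sub hk.le]
    exact_mod_cast this
  have c0 : (0 : ℝ) < n.choose k := by exact_mod_cast Nat.choose_pos hk.le
  have c1 : (0 : ℝ) < n.choose (k + 1) := by exact_mod_cast Nat.choose_pos hk
  have hl := congrArg Real.log hc
  rw [Real.log_mul c1.ne' (by linarith), Real.log_mul c0.ne' (by linarith)] at hl
  rw [e1, e2, Real.log_mul (by linarith) (by positivity), Real.log_mul (by linarith) (by positivity)]
  unfold resid weight
  rw [Real.log_mul c1.ne' (Real.exp_pos _).ne', Real.log_mul c0.ne' (Real.exp_pos _).ne',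
    Real.log_exp, Real.log_exp]
  have : mag n (k + 1) ^ 2 / (2 * n) - mag n k ^ 2 / (2 * n)
      - (energy n (mag n (k + 1)) - energy n (mag n k)) = 2 * x + 2 * x ^ 3 / 3 := by
    have hm : mag n (k + 1) = mag n k + 2 := by unfold mag; push_cast; ring
    rw [hm, hx]; unfold energy; field_simp; ring
  linarith

lemma resid_bounds_of_half_le {n k : ℕ} (hk : (n + 1) / 2 ≤ k) (hkn : k ≤ n) :
    resid n k ≤ resid n ((n + 1) / 2) ∧
      (mag n k ≤ n / 2 → -(mag n k ^ 6 / (n + 1) ^ 5) ≤ resid n k - resid n ((n + 1) / 2)) := by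
  induction k, hk using Nat.le_induction with
  | base => exact ⟨le_rfl, fun _ => by rw [sub_self]; exact neg_nonpos.2 (by positivity)⟩
  | succ k hk ih =>
    obtain ⟨ih1, ih2⟩ := ih (by omega)
    have hN : (0 : ℝ) < n + 1 := by positivity
    have hs := resid_succ (show k < n by omega) rfl
    have hm : mag n (k + 1) = mag n k + 2 := by unfold mag; push_cast; ring
    have hm0 : 0 ≤ mag n k := by
      have : (n : ℝ) ≤ 2 * k := by exact_mod_cast (by omega : n ≤ 2 * k)
      unfold mag; linarith
    have hm1 : mag n k + 1 < n + 1 := by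
      have : (k : ℝ) + 1 ≤ n := by exact_mod_cast hkn
      unfold mag; linarith
    have hx0 : 0 ≤ (mag n k + 1) / (n + 1 : ℝ) := by positivity
    have hx1 : (mag n k + 1) / (n + 1 : ℝ) < 1 := (div_lt_one hN).2 hm1
    refine ⟨?_, fun h => ?_⟩
    · have := log_one_sub_sub_log_one_add_le hx0 hx1
      linarith
    · have h2 := ih2 (by linarith)
      have h3 := le_log_one_sub_sub_log_one_add hx0 (by rw [div_le_iff₀ hN]; linarith)
      have h4 : mag n k ^ 6 / (n + 1 : ℝ) ^ 5 + ((mag n k + 1) / (n + 1 : ℝ)) ^ 5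
          ≤ mag n (k + 1) ^ 6 / (n + 1 : ℝ) ^ 5 := by
        rw [hm, div_pow, ← add_div]
        gcongr
        have : 0 ≤ (mag n k + 2) ^ 6 - (mag n k ^ 6 + (mag n k + 1) ^ 5) := by
          ring_nf; positivity
        linarith
      linarith

lemma resid_bounds {n k : ℕ} (hkn : k ≤ n) :
    resid n k ≤ resid n ((n + 1) / 2) ∧
      (|mag n k| ≤ n / 2 →
        -(mag n k ^ 6 / (n + 1) ^ 5) ≤ resid n k - resid n ((n + 1) / 2)) := by
  rcases le_or_gt ((n + 1) / 2) k with h | h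
  · have := resid_bounds_of_half_le h hkn
    exact ⟨this.1, fun h' => this.2 ((le_abs_self _).trans h')⟩
  · have := resid_bounds_of_half_le (show (n + 1) / 2 ≤ n - k by omega) (Nat.sub_le n k)
    rw [resid_symm hkn, mag_symm hkn, (show Even 6 by decide).neg_pow] at this
    exact ⟨this.1, fun h' => this.2 ((neg_le_abs _).trans h')⟩

lemma abs_exp_sub_exp_le (a b : ℝ) :
    |Real.exp a - Real.exp b| ≤ |a - b| * max (Real.exp a) (Real.exp b) := by
  wlog h : b ≤ a generalizing a b
  · rw [abs_sub_comm, abs_sub_comm a, max_comm]; exact this b a (le_of_not_ge h)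
  rw [abs_of_nonneg (sub_nonneg.2 (Real.exp_le_exp.2 h)), abs_of_nonneg (sub_nonneg.2 h),
    max_eq_left (Real.exp_le_exp.2 h)]
  have h1 := Real.add_one_le_exp (b - a)
  have h2 : Real.exp b = Real.exp a * Real.exp (b - a) := by rw [← Real.exp_add]; ring_nf
  rw [h2]
  nlinarith [Real.exp_pos a]

lemma energy_scaled {r : ℝ} (hr : 1 ≤ r) (a : ℝ) :
    0 ≤ energy (r ^ 4) (r ^ 3 * a) + a ^ 4 / 12 ∧
    energy (r ^ 4) (r ^ 3 * a) + a ^ 4 / 12 ≤ (a ^ 2 + a ^ 4) / r ^ 2 ∧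
    energy (r ^ 4) (r ^ 3 * a) ≤ a ^ 2 - a ^ 4 / 96 := by
  have hr0 : 0 < r := by linarith
  set N := r ^ 4 + 1 with hN
  have hr4 : 1 ≤ r ^ 4 := one_le_pow₀ hr
  have hNpos : 0 < N := by positivity
  have e : energy (r ^ 4) (r ^ 3 * a)
      = a ^ 2 * (r ^ 2 / (2 * N) + r ^ 6 / (6 * N ^ 3)) - a ^ 4 / 12 * (r ^ 4 / N) ^ 3 := by
    unfold energy; rw [← hN]; field_simp; ring
  have p1 : r ^ 2 / (2 * N) ≤ 1 / r ^ 2 / 2 := by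
    rw [div_div, div_le_div_iff₀ (by positivity) (by positivity), hN]; nlinarith
  have p2 : r ^ 6 / (6 * N ^ 3) ≤ 1 / r ^ 2 / 6 := by
    rw [div_div, div_le_div_iff₀ (by positivity) (by positivity)]
    have : r ^ 6 * r ^ 2 ≤ N ^ 3 := by
      calc r ^ 6 * r ^ 2 = (r ^ 4) ^ 2 := by ring
        _ ≤ N ^ 2 := by gcongr; linarith
        _ ≤ N ^ 3 := pow_le_pow_right₀ (by linarith) (by norm_num)
    linarith
  have hq : r ^ 4 / N = 1 - 1 / N := by rw [hN]; field_simp; ring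
  have hN1 : 1 / N ≤ 1 / 2 := by
    apply one_div_le_one_div_of_le <;> linarith
  have hN0 : 0 ≤ 1 / N := by positivity
  have hN2 : 1 / N ≤ 1 / r ^ 2 := by
    apply one_div_le_one_div_of_le (by positivity)
    nlinarith [one_le_pow₀ hr (n := 2), sq_nonneg (r ^ 2)]
  have hr2 : 1 / r ^ 2 ≤ 1 := (div_le_one (by positivity)).2 (one_le_pow₀ hr)
  have q1 : (r ^ 4 / N) ^ 3 ≤ 1 := pow_le_one₀ (by positivity) (by rw [hq]; linarith)
  have q2 : 1 - 3 * (1 / N) ≤ (r ^ 4 / N) ^ 3 := by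
    rw [hq]; have := one_add_mul_le_pow (a := -(1 / N)) (by linarith) 3
    push_cast at this; rw [← sub_eq_add_neg] at this; linarith
  have q3 : 1 / 8 ≤ (r ^ 4 / N) ^ 3 := by
    have : (1 / 2 : ℝ) ^ 3 ≤ (r ^ 4 / N) ^ 3 := by
      have : 1 / 2 ≤ r ^ 4 / N := by rw [hq]; linarith
      gcongr
    linarith
  have hp : 0 ≤ r ^ 2 / (2 * N) + r ^ 6 / (6 * N ^ 3) := by positivity
  rw [e]
  have a2 := sq_nonneg a
  have a4 : 0 ≤ a ^ 4 := by positivity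
  refine ⟨?_, ?_, ?_⟩
  · nlinarith [mul_nonneg a2 hp, mul_nonneg a4 (sub_nonneg.2 q1)]
  · have h1 : a ^ 2 * (r ^ 2 / (2 * N) + r ^ 6 / (6 * N ^ 3)) ≤ a ^ 2 * (1 / r ^ 2) := by
      gcongr; nlinarith
    have h2 : a ^ 4 * (1 - (r ^ 4 / N) ^ 3) ≤ a ^ 4 * (3 * (1 / r ^ 2)) := by
      gcongr; linarith
    have h3 : 0 ≤ a ^ 4 * (1 / r ^ 2) := by positivity
    rw [div_eq_mul_one_div (a ^ 2 + a ^ 4)]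
    linarith
  · have h1 : a ^ 2 * (r ^ 2 / (2 * N) + r ^ 6 / (6 * N ^ 3)) ≤ a ^ 2 * 1 := by
      gcongr; linarith
    have h2 : a ^ 4 * (1 / 8) ≤ a ^ 4 * (r ^ 4 / N) ^ 3 := by gcongr
    linarith

lemma exp_neg_pow_four_le (w : ℝ) :
    Real.exp (-w ^ 4 / 12) ≤ Real.exp 60 * Real.exp (-|w|) := by
  rw [← Real.exp_add, Real.exp_le_exp, ← (show Even 4 by decide).pow_abs w]
  nlinarith [sq_nonneg (|w| ^ 2 - 1), sq_nonneg (|w| - 3)]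

lemma abs_exp_energy_sub_le {r s w m : ℝ} (hr : 1 ≤ r) (hs : |r ^ 3 * w - s| ≤ 1) (hm : m ≤ 0)
    (hm' : |s| ≤ r ^ 4 / 2 → -(s ^ 6 / (r ^ 4 + 1) ^ 5) ≤ m) :
    Real.exp (m + energy (r ^ 4) s) ≤ Real.exp 60 * Real.exp (-|w|) ∧
    |Real.exp (m + energy (r ^ 4) s) - Real.exp (-w ^ 4 / 12)|
      ≤ 4 * Real.exp 60 * ((|w| + 1) ^ 6 * Real.exp (-|w|)) / r ^ 2 := by
  have hr0 : 0 < r := by linarith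
  have hr3 : 1 ≤ r ^ 3 := one_le_pow₀ hr
  have hr2 : 1 ≤ r ^ 2 := one_le_pow₀ hr
  obtain ⟨a, rfl⟩ : ∃ a, s = r ^ 3 * a := ⟨s / r ^ 3, by field_simp⟩
  have hwa : |w - a| ≤ 1 / r ^ 3 := by
    rw [← mul_sub, abs_mul, abs_of_pos (show 0 < r ^ 3 by positivity)] at hs
    rwa [le_div_iff₀ (by positivity), mul_comm]
  have hwa2 : |w - a| ≤ 1 / r ^ 2 := hwa.trans
    (one_div_le_one_div_of_le (by positivity) (pow_le_pow_right₀ hr (by norm_num)))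
  have hwa1 : |w - a| ≤ 1 := hwa2.trans ((div_le_one (by positivity)).2 hr2)
  obtain ⟨u1, u2, u3⟩ := energy_scaled hr a
  set E := energy (r ^ 4) (r ^ 3 * a)
  set y := |w| + 1 with hy
  have hw0 := abs_nonneg w
  have ha0 := abs_nonneg a
  have hay : |a| ≤ y := by
    have := abs_sub_abs_le_abs_sub a w; rw [abs_sub_comm] at this; linarith
  have hwy : |w| ≤ y := by linarith
  have hwa' : |w| ≤ |a| + 1 := by
    have := abs_sub_abs_le_abs_sub w a; linarith
  have hy1 : 1 ≤ y := by linarith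
  have hf : Real.exp (m + E) ≤ Real.exp 60 * Real.exp (-|w|) := by
    rw [← Real.exp_add, Real.exp_le_exp]
    have h2 : a ^ 2 = |a| ^ 2 := (sq_abs a).symm
    have h4 : a ^ 4 = |a| ^ 4 := by rw [(show Even 4 by decide).pow_abs]
    rw [h2, h4] at u3
    nlinarith [sq_nonneg (|a| ^ 2 - 72), sq_nonneg (|a| - 1)]
  have hq := exp_neg_pow_four_le w
  refine ⟨hf, ?_⟩
  have hmax := max_le hf hq
  by_cases hb : |r ^ 3 * a| ≤ r ^ 4 / 2
  · have hmb := hm' hb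
    have k1 : (r ^ 3 * a) ^ 6 / (r ^ 4 + 1) ^ 5 ≤ a ^ 6 / r ^ 2 := by
      rw [div_le_div_iff₀ (by positivity) (by positivity)]
      have : (r ^ 4) ^ 5 ≤ (r ^ 4 + 1) ^ 5 := by gcongr; linarith
      calc (r ^ 3 * a) ^ 6 * r ^ 2 = a ^ 6 * (r ^ 4) ^ 5 := by ring
        _ ≤ _ := by gcongr
    have d1 : a ^ 6 ≤ y ^ 6 := by
      rw [← (show Even 6 by decide).pow_abs a]; gcongr
    have d2 : a ^ 2 ≤ y ^ 6 := by
      rw [← (show Even 2 by decide).pow_abs a]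
      calc |a| ^ 2 ≤ y ^ 2 := by gcongr
        _ ≤ y ^ 6 := pow_le_pow_right₀ hy1 (by norm_num)
    have d4 : a ^ 4 ≤ y ^ 6 := by
      rw [← (show Even 4 by decide).pow_abs a]
      calc |a| ^ 4 ≤ y ^ 4 := by gcongr
        _ ≤ y ^ 6 := pow_le_pow_right₀ hy1 (by norm_num)
    have k2 : |w ^ 4 - a ^ 4| ≤ 4 * y ^ 6 / r ^ 2 := by
      have : w ^ 4 - a ^ 4 = (w - a) * ((w + a) * (w ^ 2 + a ^ 2)) := by ring
      rw [this, abs_mul, abs_mul, abs_of_nonneg (show 0 ≤ w ^ 2 + a ^ 2 by positivity),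
        ← sq_abs w, ← sq_abs a]
      calc |w - a| * (|w + a| * (|w| ^ 2 + |a| ^ 2))
          ≤ 1 / r ^ 2 * ((y + y) * (y ^ 2 + y ^ 2)) := by
            gcongr
            exact (abs_add_le _ _).trans (by linarith)
        _ = 4 * y ^ 3 / r ^ 2 := by ring
        _ ≤ _ := by gcongr 4 * ?_ / _; exact pow_le_pow_right₀ hy1 (by norm_num)
    have k3 : |m + E - -w ^ 4 / 12| ≤ 4 * y ^ 6 / r ^ 2 := by
      have g1 : a ^ 6 / r ^ 2 ≤ y ^ 6 / r ^ 2 := by gcongr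
      have g2 : (a ^ 2 + a ^ 4) / r ^ 2 ≤ (y ^ 6 + y ^ 6) / r ^ 2 := by gcongr
      have g3 : 0 ≤ y ^ 6 / r ^ 2 := by positivity
      rw [add_div, add_div] at g2
      rw [add_div] at u2
      rw [mul_div_assoc] at k2 ⊢
      obtain ⟨k2a, k2b⟩ := abs_le.1 k2
      rw [abs_le]; constructor <;> linarith
    calc _ ≤ _ := abs_exp_sub_exp_le _ _
      _ ≤ 4 * y ^ 6 / r ^ 2 * (Real.exp 60 * Real.exp (-|w|)) := by gcongr
      _ = _ := by ring
  · push Not at hb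
    rw [abs_mul, abs_of_pos (show 0 < r ^ 3 by positivity)] at hb
    have hya : r ≤ 2 * y := by
      have : r / 2 < |a| := by
        have : r ^ 3 * (r / 2) < r ^ 3 * |a| := by linarith
        exact lt_of_mul_lt_mul_left this (by positivity)
      linarith
    have h1 : 1 ≤ 4 * y ^ 6 / r ^ 2 := by
      rw [le_div_iff₀ (by positivity), one_mul]
      calc r ^ 2 ≤ (2 * y) ^ 2 := by gcongr
        _ = 4 * y ^ 2 := by ring
        _ ≤ 4 * y ^ 6 := by gcongr 4 * ?_; exact pow_le_pow_right₀ hy1 (by norm_num)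
    have h2 : |Real.exp (m + E) - Real.exp (-w ^ 4 / 12)| ≤ Real.exp 60 * Real.exp (-|w|) := by
      rw [abs_le]; constructor <;> linarith [Real.exp_pos (m + E), Real.exp_pos (-w ^ 4 / 12)]
    calc _ ≤ 1 * (Real.exp 60 * Real.exp (-|w|)) := by rw [one_mul]; exact h2
      _ ≤ 4 * y ^ 6 / r ^ 2 * (Real.exp 60 * Real.exp (-|w|)) := by gcongr
      _ = _ := by ring

lemma pow_six_mul_exp_neg_abs_le (w : ℝ) :
    (|w| + 1) ^ 6 * Real.exp (-|w|) ≤ 40320 * Real.exp 1 * (1 + w ^ 2)⁻¹ := by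
  have hw := abs_nonneg w
  have h := Real.pow_div_factorial_le_exp (|w| + 1) (by positivity) 8
  rw [div_le_iff₀ (by positivity), Real.exp_add] at h
  norm_num [Nat.factorial] at h
  rw [← div_eq_mul_inv, le_div_iff₀ (by positivity), Real.exp_neg, ← div_eq_mul_inv,
    div_mul_eq_mul_div, div_le_iff₀ (Real.exp_pos _)]
  have : 1 + w ^ 2 ≤ (|w| + 1) ^ 2 := by rw [← sq_abs w]; nlinarith
  calc (|w| + 1) ^ 6 * (1 + w ^ 2) ≤ (|w| + 1) ^ 6 * (|w| + 1) ^ 2 := by gcongr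
    _ = (|w| + 1) ^ 8 := by ring
    _ ≤ _ := by linarith

lemma abs_sum_sub_integral_le {c φ : ℕ → ℝ} {m : ℕ} {u h : ℝ → ℝ} (hc : Monotone c)
    (hu : Integrable u) (hh : Integrable h)
    (hin : ∀ k < m, ∀ w ∈ Set.Ioc (c k) (c (k + 1)), |φ k - u w| ≤ h w)
    (hout : ∀ w ∉ Set.Ioc (c 0) (c m), |u w| ≤ h w) :
    |∑ k ∈ range m, (c (k + 1) - c k) * φ k - ∫ w, u w| ≤ ∫ w, h w := by
  have hu' := intervalIntegral.sum_integral_adjacent_intervals (a := c) (n := m) (μ := volume)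
    (fun k _ => hu.intervalIntegrable)
  have hh' := intervalIntegral.sum_integral_adjacent_intervals (a := c) (n := m) (μ := volume)
    (fun k _ => hh.intervalIntegrable)
  have hS : MeasurableSet (Set.Ioc (c 0) (c m)) := measurableSet_Ioc
  rw [← integral_add_compl hS hu, ← integral_add_compl hS hh,
    ← intervalIntegral.integral_of_le (hc (Nat.zero_le m)),
    ← intervalIntegral.integral_of_le (hc (Nat.zero_le m)), ← hu', ← hh', ← sub_sub,
    ← Finset.sum_sub_distrib]
  refine (abs_sub _ _).trans (add_le_add ((Finset.abs_sum_le_sum_abs _ _).trans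
    (Finset.sum_le_sum fun k hk => ?_)) ?_)
  · have hle := hc (Nat.le_succ k)
    have : (c (k + 1) - c k) * φ k = ∫ _ in c k..c (k + 1), φ k := by simp
    rw [this, ← intervalIntegral.integral_sub (by simp) hu.intervalIntegrable]
    refine (intervalIntegral.abs_integral_le_integral_abs hle).trans ?_
    rw [intervalIntegral.integral_of_le hle, intervalIntegral.integral_of_le hle]
    refine setIntegral_mono_on ?_ hh.integrableOn measurableSet_Ioc
      (hin k (Finset.mem_range.1 hk))
    exact ((integrableOn_const (by simp)).sub hu.integrableOn).abs
  · refine (abs_integral_le_integral_abs).trans ?_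
    exact setIntegral_mono_on hu.integrableOn.abs hh.integrableOn hS.compl hout

/-- The weights, normalized so as to approximate `exp (-w ^ 4 / 12)`. -/
noncomputable def nweight (n k : ℕ) : ℝ :=
  weight n k * Real.exp (-resid n ((n + 1) / 2))

lemma nweight_eq {n k : ℕ} (hk : k ≤ n) :
    nweight n k = Real.exp (resid n k - resid n ((n + 1) / 2) + energy n (mag n k)) := by
  rw [nweight, ← Real.exp_log (weight_pos hk), ← Real.exp_add]
  congr 1
  unfold resid; ring

lemma exists_nweight_bound : ∃ K : ℝ, 1 ≤ K ∧ ∀ (n : ℕ) (r : ℝ), 1 ≤ r → r ^ 4 = n →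
    (∀ k ≤ n, ∀ w : ℝ, |r ^ 3 * w - mag n k| ≤ 1 → nweight n k ≤ K ∧
      |nweight n k - Real.exp (-w ^ 4 / 12)| ≤ K / r ^ 2 * (1 + w ^ 2)⁻¹) ∧
    ∀ w : ℝ, r ≤ |w| → Real.exp (-w ^ 4 / 12) ≤ K / r ^ 2 * (1 + w ^ 2)⁻¹ := by
  refine ⟨4 * Real.exp 60 * (40320 * Real.exp 1), ?_, fun n r hr hn => ⟨fun k hk w hw => ?_,
    fun w hw => ?_⟩⟩
  · have h1 := Real.one_le_exp (show (0 : ℝ) ≤ 60 by norm_num)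
    have h2 := Real.one_le_exp (show (0 : ℝ) ≤ 1 by norm_num)
    nlinarith
  · obtain ⟨b1, b2⟩ := resid_bounds hk
    rw [← hn] at b2
    obtain ⟨c1, c2⟩ := abs_exp_energy_sub_le hr hw (sub_nonpos.2 b1) b2
    rw [nweight_eq hk, ← hn]
    refine ⟨c1.trans ?_, c2.trans ?_⟩
    · have h2 := Real.one_le_exp (show (0 : ℝ) ≤ 1 by norm_num)
      have h3 : Real.exp (-|w|) ≤ 1 := Real.exp_le_one_iff.2 (neg_nonpos.2 (abs_nonneg w))
      have h4 := Real.exp_pos 60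
      nlinarith
    · have := mul_le_mul_of_nonneg_left (pow_six_mul_exp_neg_abs_le w)
        (show 0 ≤ 4 * Real.exp 60 / r ^ 2 by positivity)
      calc _ = _ := by ring
        _ ≤ _ := this
        _ = _ := by ring
  · have hr0 : 0 < r := by linarith
    have h1 : 1 ≤ (|w| + 1) ^ 6 / r ^ 2 := by
      rw [le_div_iff₀ (by positivity), one_mul]
      calc r ^ 2 ≤ (|w| + 1) ^ 2 := by gcongr; linarith
        _ ≤ (|w| + 1) ^ 6 :=
          pow_le_pow_right₀ (by linarith [abs_nonneg w]) (by norm_num)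
    have := mul_le_mul_of_nonneg_left (pow_six_mul_exp_neg_abs_le w)
        (show 0 ≤ 4 * Real.exp 60 / r ^ 2 by positivity)
    calc Real.exp (-w ^ 4 / 12) ≤ 1 * (Real.exp 60 * Real.exp (-|w|)) := by
          rw [one_mul]; exact exp_neg_pow_four_le w
      _ ≤ (|w| + 1) ^ 6 / r ^ 2 * (4 * (Real.exp 60 * Real.exp (-|w|))) := by
          refine mul_le_mul h1 ?_ (by positivity) (by positivity)
          linarith [mul_pos (Real.exp_pos 60) (Real.exp_pos (-|w|))]
      _ = 4 * Real.exp 60 / r ^ 2 * ((|w| + 1) ^ 6 * Real.exp (-|w|)) := by ring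
      _ ≤ _ := this
      _ = _ := by ring

lemma integrable_exp_neg_pow_four : Integrable fun w : ℝ => Real.exp (-w ^ 4 / 12) := by
  refine (integrable_inv_one_add_sq.const_mul (Real.exp 60 * (40320 * Real.exp 1))).mono'
    (by fun_prop) (Filter.Eventually.of_forall fun w => ?_)
  rw [Real.norm_eq_abs, Real.abs_exp]
  refine (exp_neg_pow_four_le w).trans ?_
  rw [mul_assoc]
  gcongr
  refine le_trans ?_ (pow_six_mul_exp_neg_abs_le w)
  exact le_mul_of_one_le_left (Real.exp_pos _).le
    (one_le_pow₀ (by linarith [abs_nonneg w]))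

lemma integral_exp_neg_pow_four :
    (∫ w : ℝ, Real.exp (-w ^ 4 / 12))
      = (Real.sqrt 2 / ((3 : ℝ) ^ ((1 : ℝ) / 4) * Real.Gamma (1 / 4)))⁻¹ := by
  have h1 := integral_comp_abs (f := fun x : ℝ => Real.exp (-(1 / 12) * x ^ (4 : ℝ)))
  have h2 := integral_exp_neg_mul_rpow (p := 4) (b := 1 / 12) (by norm_num) (by norm_num)
  have h3 : ∀ w : ℝ, Real.exp (-w ^ 4 / 12) = Real.exp (-(1 / 12) * |w| ^ (4 : ℝ)) := by
    intro w
    rw [← (show Even 4 by decide).pow_abs w, ← Real.rpow_natCast]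
    congr 1; push_cast; ring
  simp_rw [h3]
  rw [h1, h2, Real.Gamma_add_one (by norm_num)]
  have h4 : (1 / 12 : ℝ) ^ (-1 / 4 : ℝ) = 3 ^ ((1 : ℝ) / 4) * Real.sqrt 2 := by
    rw [one_div, Real.inv_rpow (by norm_num), ← Real.rpow_neg (by norm_num),
      show (12 : ℝ) = 3 * 2 ^ (2 : ℝ) by norm_num, Real.mul_rpow (by norm_num) (by norm_num),
      ← Real.rpow_mul (by norm_num), Real.sqrt_eq_rpow]
    norm_num
  rw [h4]
  have hG : 0 < Real.Gamma (1 / 4) := Real.Gamma_pos_of_pos (by norm_num)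
  have h5 : Real.sqrt 2 ^ 2 = 2 := Real.sq_sqrt (by norm_num)
  have h6 : (0 : ℝ) < 3 ^ ((1 : ℝ) / 4) := by positivity
  field_simp
  rw [h5]; norm_num

/-- The normalized weights, summed over magnetizations at most `z`, approximate the integral. -/
lemma exists_abs_sum_nweight_sub_le : ∃ K : ℝ, ∀ (n : ℕ) (r : ℝ), 1 ≤ r → r ^ 4 = n → ∀ z : ℝ,
    |∑ k ∈ range (n + 1), 2 / r ^ 3 * (if mag n k / r ^ 3 ≤ z then nweight n k else 0)
      - ∫ w in Set.Iic z, Real.exp (-w ^ 4 / 12)| ≤ K / r ^ 2 := by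
  obtain ⟨K, hK1, hK⟩ := exists_nweight_bound
  refine ⟨K * (Real.pi + 2), fun n r hr hn z => ?_⟩
  obtain ⟨hin, hout⟩ := hK n r hr hn
  have hr0 : 0 < r := by linarith
  have hr3 : 0 < r ^ 3 := by positivity
  let c : ℕ → ℝ := fun k => (mag n k - 1) / r ^ 3
  let h : ℝ → ℝ := fun w => K / r ^ 2 * (1 + w ^ 2)⁻¹
    + (Set.Icc (z - 1 / r ^ 3) (z + 1 / r ^ 3)).indicator (fun _ => K) w
  have hc : Monotone c := by
    refine monotone_nat_of_le_succ fun k => ?_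
    simp only [c, mag]; push_cast; gcongr; linarith
  have hcd : ∀ k, c (k + 1) - c k = 2 / r ^ 3 := by
    intro k; simp only [c, mag]; push_cast; field_simp; ring
  have hi1 : Integrable fun w : ℝ => K / r ^ 2 * (1 + w ^ 2)⁻¹ :=
    integrable_inv_one_add_sq.const_mul _
  have hi2 : Integrable ((Set.Icc (z - 1 / r ^ 3) (z + 1 / r ^ 3)).indicator fun _ => K) :=
    (integrable_indicator_iff measurableSet_Icc).2 (integrableOn_const (by simp))
  have hint : ∫ w, h w ≤ K * (Real.pi + 2) / r ^ 2 := by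
    have : ∫ w, h w = K / r ^ 2 * Real.pi + 2 / r ^ 3 * K := by
      rw [integral_add hi1 hi2, integral_const_mul, integral_univ_inv_one_add_sq,
        integral_indicator measurableSet_Icc, setIntegral_const, smul_eq_mul,
        Real.volume_real_Icc_of_le (by linarith [one_div_pos.2 hr3])]
      ring
    rw [this]
    have : 2 / r ^ 3 * K ≤ 2 / r ^ 2 * K := by
      gcongr 2 / ?_ * K
      exact pow_le_pow_right₀ hr (by norm_num)
    calc _ ≤ K / r ^ 2 * Real.pi + 2 / r ^ 2 * K := by linarith
      _ = _ := by ring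
  have hpos : ∀ w : ℝ, 0 ≤ K / r ^ 2 * (1 + w ^ 2)⁻¹ := fun w => by positivity
  have hpos2 : ∀ w, 0 ≤ (Set.Icc (z - 1 / r ^ 3) (z + 1 / r ^ 3)).indicator (fun _ => K) w :=
    fun w => Set.indicator_nonneg (fun _ _ => by linarith) w
  have key := abs_sum_sub_integral_le (c := c) (m := n + 1) (h := h)
    (φ := fun k => if mag n k / r ^ 3 ≤ z then nweight n k else 0)
    (u := (Set.Iic z).indicator fun w => Real.exp (-w ^ 4 / 12)) hc
    (integrable_exp_neg_pow_four.indicator measurableSet_Iic) (hi1.add hi2) ?_ ?_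
  · simp only [hcd] at key
    rw [integral_indicator measurableSet_Iic] at key
    exact key.trans hint
  · rintro k hk w ⟨hw1, hw2⟩
    have hk' : k ≤ n := by omega
    have hw1' : mag n k - 1 < w * r ^ 3 := (div_lt_iff₀ hr3).1 hw1
    have hw2' : w * r ^ 3 ≤ mag n k + 1 := by
      have : c (k + 1) = (mag n k + 1) / r ^ 3 := by
        simp only [c, mag]; push_cast; ring
      rw [this] at hw2
      exact (le_div_iff₀ hr3).1 hw2
    obtain ⟨f1, f2⟩ := hin k hk' w (by rw [abs_le]; constructor <;> linarith)
    have hf0 : 0 ≤ nweight n k := mul_nonneg (weight_pos hk').le (Real.exp_pos _).le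
    have hq0 := Real.exp_pos (-w ^ 4 / 12)
    have hq1 : Real.exp (-w ^ 4 / 12) ≤ 1 := by
      rw [Real.exp_le_one_iff]
      have : 0 ≤ w ^ 4 := by positivity
      linarith
    have hz : ∀ v : ℝ, v ≤ z ↔ v * r ^ 3 ≤ z * r ^ 3 := fun v => (mul_le_mul_iff_left₀ hr3).symm
    have hmem : |w * r ^ 3 - z * r ^ 3| ≤ 1 → w ∈ Set.Icc (z - 1 / r ^ 3) (z + 1 / r ^ 3) := by
      intro hh
      rw [← sub_mul, abs_mul, abs_of_pos hr3, ← le_div_iff₀ hr3, abs_le] at hh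
      constructor <;> linarith [hh.1, hh.2]
    simp only [Set.indicator_apply, Set.mem_Iic, div_le_iff₀ hr3, hz w]
    have hp := hpos w
    by_cases h1 : mag n k ≤ z * r ^ 3 <;> by_cases h2 : w * r ^ 3 ≤ z * r ^ 3
    · simp only [h1, h2, if_true]
      exact f2.trans (le_add_of_nonneg_right (hpos2 w))
    · simp only [h1, h2, if_true, if_false, sub_zero, h]
      rw [Set.indicator_of_mem (hmem (by rw [abs_le]; constructor <;> linarith)),
        abs_of_nonneg hf0]
      linarith
    · simp only [h1, h2, if_true, if_false, zero_sub, abs_neg, h]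
      rw [Set.indicator_of_mem (hmem (by rw [abs_le]; constructor <;> linarith)), Real.abs_exp]
      linarith
    · simp only [h1, h2, if_false, sub_zero, abs_zero, h]
      exact add_nonneg (hpos w) (hpos2 w)
  · intro w hw
    have hw' : r ≤ |w| := by
      by_contra hlt
      rw [not_le, abs_lt] at hlt
      apply hw
      have hnr : (n : ℝ) / r ^ 3 = r := by rw [← hn]; field_simp
      have e1 : c 0 = -(n / r ^ 3) - 1 / r ^ 3 := by
        simp only [c, mag]; push_cast; ring
      have e2 : c (n + 1) = n / r ^ 3 + 1 / r ^ 3 := by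
        simp only [c, mag]; push_cast; ring
      rw [e1, e2, hnr]
      have := one_div_pos.2 hr3
      exact ⟨by linarith [hlt.1], by linarith [hlt.2]⟩
    refine le_trans ?_ ((hout w hw').trans (le_add_of_nonneg_right (hpos2 w)))
    rw [abs_of_nonneg (Set.indicator_nonneg (fun _ _ => (Real.exp_pos _).le) w)]
    exact Set.indicator_le_self' (fun _ _ => (Real.exp_pos _).le) w

lemma exists_abs_total_sub_le : ∃ K : ℝ, ∀ (n : ℕ) (r : ℝ), 1 ≤ r → r ^ 4 = n →
    |∑ k ∈ range (n + 1), 2 / r ^ 3 * nweight n k - ∫ w, Real.exp (-w ^ 4 / 12)|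
      ≤ K / r ^ 2 := by
  obtain ⟨K, hK⟩ := exists_abs_sum_nweight_sub_le
  refine ⟨K, fun n r hr hn => ?_⟩
  have hlim : Filter.Tendsto (fun z : ℝ => ∫ w in Set.Iic z, Real.exp (-w ^ 4 / 12))
      Filter.atTop (nhds (∫ w, Real.exp (-w ^ 4 / 12))) := by
    have := tendsto_setIntegral_of_monotone (μ := volume) (s := fun z : ℝ => Set.Iic z)
      (f := fun w : ℝ => Real.exp (-w ^ 4 / 12)) (fun _ => measurableSet_Iic)
      (fun _ _ h => Set.Iic_subset_Iic.2 h) integrable_exp_neg_pow_four.integrableOn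
    rwa [Set.iUnion_Iic, setIntegral_univ] at this
  refine le_of_tendsto (hlim.const_sub _).abs ?_
  filter_upwards [Filter.eventually_ge_atTop (n : ℝ)] with z hz
  have hr3 : 1 ≤ r ^ 3 := one_le_pow₀ hr
  refine le_trans (le_of_eq ?_) (hK n r hr hn z)
  congr 2
  refine Finset.sum_congr rfl fun k hk => ?_
  rw [if_pos]
  have hkn : (k : ℝ) ≤ n := by exact_mod_cast Nat.lt_succ_iff.1 (mem_range.1 hk)
  rw [div_le_iff₀ (by linarith)]
  have : (n : ℝ) ≤ z * r ^ 3 := by nlinarith [Nat.cast_nonneg (α := ℝ) n]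
  unfold mag
  linarith

lemma sum_spin_eq_mag {n : ℕ} (σ : Fin n → Bool) :
    ∑ i, (if σ i then (1 : ℝ) else -1) = mag n #{i | σ i = true} := by
  have : ∀ i, (if σ i then (1 : ℝ) else -1) = 2 * (if σ i = true then 1 else 0) - 1 := by
    intro i; split_ifs <;> norm_num
  simp only [this, Finset.sum_sub_distrib, ← Finset.mul_sum, Finset.sum_boole]
  simp [mag]

lemma sum_lt_mul_eq {n : ℕ} (x : Fin n → ℝ) (hx : ∀ i, x i ^ 2 = 1) :
    ∑ i, ∑ j, (if i < j then x i * x j else 0) = ((∑ i, x i) ^ 2 - n) / 2 := by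
  have h1 : (∑ i, x i) ^ 2 = ∑ i, ∑ j, x i * x j := by rw [sq, Finset.sum_mul_sum]
  have h2 : ∀ i j, x i * x j = (if i < j then x i * x j else 0)
      + (if j < i then x j * x i else 0) + (if i = j then 1 else 0) := by
    intro i j
    rcases lt_trichotomy i j with h | h | h
    · simp [h, h.ne, h.le]
    · subst h; simp [← sq, hx]
    · simp [h, h.ne', h.le, mul_comm]
  have h3 : (∑ i, x i) ^ 2 = ∑ i, ∑ j, (if i < j then x i * x j else 0)
      + ∑ i, ∑ j, (if i < j then x i * x j else 0) + n := by
    rw [h1]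
    conv_lhs => enter [2, i, 2, j]; rw [h2 i j]
    simp only [Finset.sum_add_distrib]
    rw [Finset.sum_comm (f := fun i j => if j < i then x j * x i else 0)]
    simp
  linarith

lemma sum_spin_configurations {n : ℕ} (g : ℕ → ℝ) :
    ∑ σ : Fin n → Bool, g #{i | σ i = true} = ∑ k ∈ range (n + 1), n.choose k * g k := by
  have h := Finset.sum_powerset_apply_card g (x := (univ : Finset (Fin n)))
  rw [Finset.card_univ, Fintype.card_fin, Finset.powerset_univ] at h
  simp only [nsmul_eq_mul] at h
  rw [← h]
  refine Finset.sum_nbij' (fun σ => ({i | σ i = true} : Finset (Fin n)))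
    (fun s i => decide (i ∈ s)) ?_ ?_ ?_ ?_ ?_ <;> simp

lemma exp_hamiltonian_eq {n : ℕ} (hn : 0 < n) (σ : Fin n → Bool) :
    Real.exp ((1 / (n : ℝ)) * ∑ i : Fin n, ∑ j : Fin n,
      (if i < j then (if σ i then (1 : ℝ) else -1) * (if σ j then (1 : ℝ) else -1) else 0))
    = Real.exp (-1 / 2) * Real.exp (mag n #{i | σ i = true} ^ 2 / (2 * n)) := by
  have hn' : (0 : ℝ) < n := by exact_mod_cast hn
  rw [sum_lt_mul_eq (fun i => if σ i then (1 : ℝ) else -1) (fun i => by split_ifs <;> norm_num),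
    sum_spin_eq_mag, ← Real.exp_add]
  congr 1
  field_simp; ring

lemma abs_div_sub_div_le {A B G J ε : ℝ} (hA : 0 ≤ A) (hAB : A ≤ B) (hB : 0 < B) (hJ : 0 < J)
    (h1 : |A - G| ≤ ε) (h2 : |B - J| ≤ ε) : |A / B - G / J| ≤ 2 * ε / J := by
  have e : A / B - G / J = ((A - G) + A / B * (J - B)) / J := by field_simp; ring
  rw [e, abs_div, abs_of_pos hJ]
  gcongr
  have hq : |A / B| ≤ 1 := by
    rw [abs_of_nonneg (by positivity)]; exact (div_le_one hB).2 hAB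
  refine (abs_add_le _ _).trans ?_
  rw [abs_mul, abs_sub_comm J]
  nlinarith [abs_nonneg (B - J), abs_nonneg (A / B)]


open scoped Classical in
/-- **Theorem 2.1** (Chatterjee–Shao). Berry–Esseen bound of order n^{-1/2} for the
magnetization of the Curie–Weiss model at the critical temperature T = 1: the law of
W = n^{-3/4} Σ σᵢ is within c·n^{-1/2} (in Kolmogorov distance) of the law with density
proportional to exp(-w⁴/12). Spins are encoded by σ : Fin n → Bool, with spin value
`if σ i then 1 else -1`. -/
theorem curieWeiss_critical_berry_esseen :
    ∃ c : ℝ, ∀ n : ℕ, 0 < n → ∀ z : ℝ,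
      |(∑ σ ∈ Finset.univ.filter (fun σ : Fin n → Bool =>
            (n : ℝ) ^ (-(3 : ℝ) / 4)
              * (∑ i : Fin n, (if σ i then (1 : ℝ) else -1)) ≤ z),
          Real.exp ((1 / (n : ℝ)) * ∑ i : Fin n,
            ∑ j ∈ Finset.univ.filter (fun j : Fin n => i < j),
              (if σ i then (1 : ℝ) else -1) * (if σ j then (1 : ℝ) else -1)))
        / (∑ σ : Fin n → Bool,
            Real.exp ((1 / (n : ℝ)) * ∑ i : Fin n,
              ∑ j ∈ Finset.univ.filter (fun j : Fin n => i < j),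
                (if σ i then (1 : ℝ) else -1) * (if σ j then (1 : ℝ) else -1)))
       - ∫ w in Set.Iic z,
            (Real.sqrt 2 / ((3 : ℝ) ^ ((1 : ℝ) / 4) * Real.Gamma (1 / 4)))
              * Real.exp (-w ^ 4 / 12)|
      ≤ c * (n : ℝ) ^ (-(1 : ℝ) / 2) := by
  obtain ⟨K₁, hK₁⟩ := exists_abs_sum_nweight_sub_le
  obtain ⟨K₂, hK₂⟩ := exists_abs_total_sub_le
  set κ := Real.sqrt 2 / ((3 : ℝ) ^ ((1 : ℝ) / 4) * Real.Gamma (1 / 4)) with hκ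
  have hκ0 : 0 < κ := by
    have := Real.Gamma_pos_of_pos (show (0 : ℝ) < 1 / 4 by norm_num)
    positivity
  refine ⟨2 * max K₁ K₂ * κ, fun n hn z => ?_⟩
  have hn' : (0 : ℝ) < n := by exact_mod_cast hn
  obtain ⟨r, hr1, hrn⟩ : ∃ r : ℝ, 1 ≤ r ∧ r ^ 4 = n :=
    ⟨(n : ℝ) ^ ((1 : ℝ) / 4), Real.one_le_rpow (by exact_mod_cast hn) (by norm_num), by
      rw [← Real.rpow_natCast, ← Real.rpow_mul hn'.le]; norm_num⟩
  have hr0 : 0 < r := by linarith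
  have hr3 : (n : ℝ) ^ (-(3 : ℝ) / 4) = (r ^ 3)⁻¹ := by
    rw [← hrn, ← Real.rpow_natCast, ← Real.rpow_mul hr0.le, ← Real.rpow_natCast,
      ← Real.rpow_neg hr0.le]
    norm_num
  have hr2 : (n : ℝ) ^ (-(1 : ℝ) / 2) = (r ^ 2)⁻¹ := by
    rw [← hrn, ← Real.rpow_natCast, ← Real.rpow_mul hr0.le, ← Real.rpow_natCast,
      ← Real.rpow_neg hr0.le]
    norm_num
  simp only [Finset.sum_filter]
  simp only [exp_hamiltonian_eq hn, sum_spin_eq_mag, hr3, hr2]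
  rw [sum_spin_configurations (fun k => if (r ^ 3)⁻¹ * mag n k ≤ z then
      Real.exp (-1 / 2) * Real.exp (mag n k ^ 2 / (2 * n)) else 0),
    sum_spin_configurations (fun k => Real.exp (-1 / 2) * Real.exp (mag n k ^ 2 / (2 * n))),
    integral_const_mul]
  set R := Real.exp (-resid n ((n + 1) / 2)) with hR
  set A := ∑ k ∈ range (n + 1), 2 / r ^ 3 * (if mag n k / r ^ 3 ≤ z then nweight n k else 0)
    with hA
  set B := ∑ k ∈ range (n + 1), 2 / r ^ 3 * nweight n k with hB
  set S := 2 / r ^ 3 * R * Real.exp (1 / 2) with hS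
  have hRpos : 0 < R := Real.exp_pos _
  have hSpos : 0 < S := by positivity
  have hee : Real.exp (1 / 2) * Real.exp (-1 / 2) = 1 := by
    rw [← Real.exp_add]; norm_num
  have hw : ∀ k, S * (n.choose k * (Real.exp (-1 / 2) * Real.exp (mag n k ^ 2 / (2 * n))))
      = 2 / r ^ 3 * nweight n k := by
    intro k
    rw [hS, nweight, weight, ← hR]
    linear_combination (2 / r ^ 3 * R * n.choose k * Real.exp (mag n k ^ 2 / (2 * n))) * hee
  have hAS : A = S * ∑ k ∈ range (n + 1), n.choose k * (if (r ^ 3)⁻¹ * mag n k ≤ z then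
      Real.exp (-1 / 2) * Real.exp (mag n k ^ 2 / (2 * n)) else 0) := by
    rw [hA, Finset.mul_sum]
    refine Finset.sum_congr rfl fun k _ => ?_
    rw [inv_mul_eq_div]
    split_ifs
    · rw [hw]
    · simp
  have hBS : B = S * ∑ k ∈ range (n + 1), n.choose k *
      (Real.exp (-1 / 2) * Real.exp (mag n k ^ 2 / (2 * n))) := by
    rw [hB, Finset.mul_sum]
    exact Finset.sum_congr rfl fun k _ => (hw k).symm
  rw [← mul_div_mul_left _ _ hSpos.ne', ← hAS, ← hBS]
  have hpos : ∀ k ∈ range (n + 1), 0 < nweight n k := fun k hk =>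
    mul_pos (weight_pos (Nat.lt_succ_iff.1 (mem_range.1 hk))) (Real.exp_pos _)
  have hBpos : 0 < B :=
    Finset.sum_pos (fun k hk => mul_pos (by positivity) (hpos k hk)) ⟨0, by simp⟩
  have hA0 : 0 ≤ A := Finset.sum_nonneg fun k hk => by
    have := hpos k hk
    split_ifs <;> positivity
  have hAB : A ≤ B := Finset.sum_le_sum fun k hk => by
    have := hpos k hk
    gcongr
    split_ifs <;> linarith
  have main := abs_div_sub_div_le (ε := max K₁ K₂ / r ^ 2) hA0 hAB hBpos (inv_pos.2 hκ0)
    ((hK₁ n r hr1 hrn z).trans (by gcongr; exact le_max_left _ _))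
    (by
      have h := hK₂ n r hr1 hrn
      rw [integral_exp_neg_pow_four] at h
      exact h.trans (by gcongr; exact le_max_right _ _))
  rw [div_inv_eq_mul, div_inv_eq_mul, mul_comm _ κ] at main
  refine main.trans (le_of_eq ?_)
  ring
end
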